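/- For every integer d ≥ 2, a very general complex hypersurface of bidegree (d, 2) in ℙ² × ℙ³ is not stably rational. -/

import Mathlib

/-!
Rationality, stable rationality and stable birationality, expressed via function fields:
a variety `X` over `k` with function field `F` (a `k`-algebra via `c : k →+* F`) is rational
iff `F ≅ k(t₁,…,t_n)` over `k`, and stably rational iff `F(t₁,…,t_m) ≅ k(t₁,…,t_n)` over `k`
for some `m, n`. Two varieties are stably birational iff their function fields become
isomorphic after adjoining finitely many indeterminates.
-/

noncomputable section

/-- The rational function field `k(t₁, …, t_n)`. -/
def ratFuncField (k : Type) [Field k] (n : ℕ) : Type :=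
  FractionRing (MvPolynomial (Fin n) k)

instance (k : Type) [Field k] (n : ℕ) : Field (ratFuncField k n) := by
  unfold ratFuncField; infer_instance

/-- The canonical map `k → k(t₁, …, t_n)`. -/
def ratFuncFieldMap (k : Type) [Field k] (n : ℕ) : k →+* ratFuncField k n :=
  (algebraMap (MvPolynomial (Fin n) k) (FractionRing (MvPolynomial (Fin n) k))).comp
    (MvPolynomial.C)

/-- Given a function field `F` over `k` (via `c : k →+* F`), the canonical map
`k → Frac(F[t₁,…,t_m]) = F(t₁,…,t_m)`. -/
def adjoinIndetsMap {k F : Type} [CommRing k] [CommRing F] (c : k →+* F) (m : ℕ) :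
    k →+* FractionRing (MvPolynomial (Fin m) F) :=
  (algebraMap (MvPolynomial (Fin m) F) (FractionRing (MvPolynomial (Fin m) F))).comp
    ((MvPolynomial.C).comp c)

/-- A variety over `k` with function field `F` (via `c : k →+* F`) is rational iff
`F ≅ k(t₁,…,t_n)` as `k`-algebras for some `n`. -/
def IsRationalFunctionField {k F : Type} [Field k] [CommRing F] (c : k →+* F) : Prop :=
  ∃ (n : ℕ) (e : F ≃+* ratFuncField k n), (e : F →+* ratFuncField k n).comp c =
    ratFuncFieldMap k n

/-- A variety over `k` with function field `F` (via `c : k →+* F`) is stably rational iff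
`F(t₁,…,t_m) ≅ k(t₁,…,t_n)` as `k`-algebras for some `m, n`. -/
def IsStablyRationalFunctionField {k F : Type} [Field k] [CommRing F] (c : k →+* F) : Prop :=
  ∃ (m n : ℕ) (e : FractionRing (MvPolynomial (Fin m) F) ≃+* ratFuncField k n),
    (e : FractionRing (MvPolynomial (Fin m) F) →+* ratFuncField k n).comp
      (adjoinIndetsMap c m) = ratFuncFieldMap k n

/-- Two varieties over `K` with function fields `L₁, L₂` (via `i₁ : K →+* L₁`,
`i₂ : K →+* L₂`) are stably birational over `K` iff `L₁(t₁,…,t_a) ≅ L₂(t₁,…,t_b)`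
as `K`-algebras for some `a, b`. -/
def StablyBirationalOver {K L₁ L₂ : Type} [Field K] [CommRing L₁] [CommRing L₂]
    (i₁ : K →+* L₁) (i₂ : K →+* L₂) : Prop :=
  ∃ (a b : ℕ) (e : FractionRing (MvPolynomial (Fin a) L₁) ≃+*
      FractionRing (MvPolynomial (Fin b) L₂)),
    (e : FractionRing (MvPolynomial (Fin a) L₁) →+*
      FractionRing (MvPolynomial (Fin b) L₂)).comp (adjoinIndetsMap i₁ a) =
      adjoinIndetsMap i₂ b

end

/-!
Very general members of linear families, and quadric surface bundles over `ℙ²` given by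
symmetric matrices of homogeneous forms, described via affine charts and function fields.
-/

noncomputable section

/-- A polynomial function on a `ℂ`-vector space `P`: a function factoring through finitely
many linear coordinates via a polynomial. -/
def IsPolynomialFun {P : Type} [AddCommGroup P] [Module ℂ P] (f : P → ℂ) : Prop :=
  ∃ (N : ℕ) (l : Fin N → (P →ₗ[ℂ] ℂ)) (F : MvPolynomial (Fin N) ℂ),
    ∀ p : P, f p = MvPolynomial.eval (fun i => l i p) F

/-- A property `Q` holds for a very general member of the linear parameter space `P` if it
holds away from a countable union of proper algebraic hypersurfaces, i.e. if there are
countably many nonzero polynomial functions on `P` such that `Q p` holds whenever none of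
them vanishes at `p`. -/
def VeryGeneral {P : Type} [AddCommGroup P] [Module ℂ P] (Q : P → Prop) : Prop :=
  ∃ 𝒞 : Set (P → ℂ), 𝒞.Countable ∧ (∀ f ∈ 𝒞, IsPolynomialFun f ∧ f ≠ 0) ∧
    ∀ p : P, (∀ f ∈ 𝒞, f p ≠ 0) → Q p

/-- Dehomogenization `ℂ[x,y,z] → ℂ[x,y] ⊆ ℂ[x,y,z₁,z₂,z₃]` at the chart `z = 1` of `ℙ²`
(the first two variables of `Fin 5` are the base coordinates). -/
def dehomP2 : MvPolynomial (Fin 3) ℂ →+* MvPolynomial (Fin 5) ℂ :=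
  (MvPolynomial.aeval ![MvPolynomial.X 0, MvPolynomial.X 1, 1]).toRingHom

/-- Dehomogenization `ℂ[x,y,z] → ℂ[x,y]` at the chart `z = 1`. -/
def dehomP2' : MvPolynomial (Fin 3) ℂ →+* MvPolynomial (Fin 2) ℂ :=
  (MvPolynomial.aeval ![MvPolynomial.X 0, MvPolynomial.X 1, 1]).toRingHom

/-- The defining polynomial `∑_{i,j} a_{ij}(x,y,1) z_i z_j` (with `z₀ = 1`) of the affine
chart of the quadric surface bundle `X = {∑ a_{ij} z_i z_j = 0} ⊆ ℙ(E)` over `ℙ²`. -/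
def quadricBundleChartPoly (A : Fin 4 → Fin 4 → MvPolynomial (Fin 3) ℂ) :
    MvPolynomial (Fin 5) ℂ :=
  ∑ i : Fin 4, ∑ j : Fin 4, dehomP2 (A i j) *
    (![1, MvPolynomial.X 2, MvPolynomial.X 3, MvPolynomial.X 4] i) *
    (![1, MvPolynomial.X 2, MvPolynomial.X 3, MvPolynomial.X 4] j)

/-- The coordinate ring of the affine chart (`z = 1` on `ℙ²` and `z₀ = 1` on the fibre)
of the quadric surface bundle `X ⊆ ℙ(E)` over `ℙ²` determined by the symmetric matrix
`(a_{ij})`. -/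
def quadricBundleChartRing (A : Fin 4 → Fin 4 → MvPolynomial (Fin 3) ℂ) : Type :=
  MvPolynomial (Fin 5) ℂ ⧸ Ideal.span {quadricBundleChartPoly A}

instance (A : Fin 4 → Fin 4 → MvPolynomial (Fin 3) ℂ) :
    CommRing (quadricBundleChartRing A) :=
  Ideal.Quotient.commRing _

/-- The function field `ℂ(X)` of the quadric surface bundle `X` over `ℙ²` given by the
matrix `(a_{ij})`, as the fraction ring of the affine chart. -/
def quadricBundleFunctionField (A : Fin 4 → Fin 4 → MvPolynomial (Fin 3) ℂ) : Type :=
  FractionRing (quadricBundleChartRing A)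

instance (A : Fin 4 → Fin 4 → MvPolynomial (Fin 3) ℂ) :
    CommRing (quadricBundleFunctionField A) := by
  unfold quadricBundleFunctionField; infer_instance

/-- The canonical map `ℂ → ℂ(X)`. -/
def quadricBundleFFMap (A : Fin 4 → Fin 4 → MvPolynomial (Fin 3) ℂ) :
    ℂ →+* quadricBundleFunctionField A :=
  (algebraMap (quadricBundleChartRing A) (FractionRing (quadricBundleChartRing A))).comp
    ((Ideal.Quotient.mk _).comp (MvPolynomial.C))

/-- The conditions for the symmetric matrix `(a_{ij})` of forms to define a quadric surface
bundle over `ℙ²`: the quadratic form is generically nondegenerate, and nonzero on every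
fibre (so that `X → ℙ²` is flat). Homogeneity of the `a_{ij}` of the correct degrees is
part of the choice of parameter space. -/
def IsQuadricBundleP2 (A : Fin 4 → Fin 4 → MvPolynomial (Fin 3) ℂ) : Prop :=
  Matrix.det (Matrix.of fun i j => A i j + A j i) ≠ 0 ∧
  ∀ v : Fin 3 → ℂ, v ≠ 0 → ∃ i j, MvPolynomial.eval v (A i j + A j i) ≠ 0

/-- The quadric surface bundle over `ℙ²` given by `(a_{ij})` admits a rational section:
there are rational functions `σ₀, …, σ₃` on `ℙ²`, not all zero, with
`∑ a_{ij} σ_i σ_j = 0`. -/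
def HasRationalSectionP2 (A : Fin 4 → Fin 4 → MvPolynomial (Fin 3) ℂ) : Prop :=
  ∃ σ : Fin 4 → FractionRing (MvPolynomial (Fin 2) ℂ), σ ≠ 0 ∧
    ∑ i : Fin 4, ∑ j : Fin 4,
      (algebraMap (MvPolynomial (Fin 2) ℂ) (FractionRing (MvPolynomial (Fin 2) ℂ)))
        (dehomP2' (A i j)) * σ i * σ j = 0

end

/-!
STATEMENT 10: For every integer `d ≥ 2`, a very general complex hypersurface of bidegree
`(d, 2)` in `ℙ² × ℙ³` is not stably rational. A bihomogeneous polynomial `F` of bidegree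
`(d,2)` in the variables `x₀,x₁,x₂;z₀,…,z₃` (i.e. of weighted degree `d` for the weights
`(1,1,1,0,0,0,0)` and `2` for `(0,0,0,1,1,1,1)`) defines `X = {F = 0} ⊆ ℙ² × ℙ³`, whose
function field is the fraction field of the chart `x₀ = z₀ = 1`.
-/

noncomputable section

/-- The weight vector selecting the `ℙ²`-variables. -/
def biWeight1 : Fin 7 → ℕ := ![1, 1, 1, 0, 0, 0, 0]

/-- The weight vector selecting the `ℙ³`-variables. -/
def biWeight2 : Fin 7 → ℕ := ![0, 0, 0, 1, 1, 1, 1]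

/-- Dehomogenization at the chart `x₀ = 1`, `z₀ = 1` of `ℙ² × ℙ³`. -/
def dehomP2P3 : MvPolynomial (Fin 7) ℂ →+* MvPolynomial (Fin 5) ℂ :=
  (MvPolynomial.aeval ![1, MvPolynomial.X 0, MvPolynomial.X 1, 1,
    MvPolynomial.X 2, MvPolynomial.X 3, MvPolynomial.X 4]).toRingHom

/-- The coordinate ring of the affine chart of the hypersurface `{F = 0} ⊆ ℙ² × ℙ³`. -/
def bidegreeChartRing (F : MvPolynomial (Fin 7) ℂ) : Type :=
  MvPolynomial (Fin 5) ℂ ⧸ Ideal.span {dehomP2P3 F}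

instance (F : MvPolynomial (Fin 7) ℂ) : CommRing (bidegreeChartRing F) :=
  Ideal.Quotient.commRing _

/-- The canonical map `ℂ → ℂ(X)` for `X = {F = 0} ⊆ ℙ² × ℙ³`. -/
def bidegreeChartFFMap (F : MvPolynomial (Fin 7) ℂ) :
    ℂ →+* FractionRing (bidegreeChartRing F) :=
  (algebraMap (bidegreeChartRing F) (FractionRing (bidegreeChartRing F))).comp
    ((Ideal.Quotient.mk _).comp (MvPolynomial.C))

section

open Polynomial

/-- The diagonal ternary quadratic form with coefficients `a`, `b`, `c` has a nontrivial zero. -/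
def Isotropic3 {R : Type*} [CommRing R] (a b c : R) : Prop :=
  ∃ x y z : R, (x ≠ 0 ∨ y ≠ 0 ∨ z ≠ 0) ∧ a * x ^ 2 + b * y ^ 2 + c * z ^ 2 = 0

theorem Isotropic3.rotate {R : Type*} [CommRing R] {a b c : R} (h : Isotropic3 a b c) :
    Isotropic3 b c a := by
  obtain ⟨x, y, z, hne, h⟩ := h
  exact ⟨y, z, x, by tauto, by linear_combination h⟩



variable {E : Type*} [Field E]

theorem exists_small_congruent {W : Type*} [AddCommGroup W] [Module E W] [FiniteDimensional E W]
    {g₀ g₁ g₂ : E[X]} (b₀ b₁ b₂ : E[X]) (h₀ : g₀ ≠ 0) (h₁ : g₁ ≠ 0) (h₂ : g₂ ≠ 0)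
    (e₀ e₁ e₂ : ℕ) (l : E[X] × E[X] × E[X] →ₗ[E] W)
    (hd : Module.finrank E W + (g₀.natDegree + g₁.natDegree + g₂.natDegree) < e₀ + e₁ + e₂ + 3) :
    ∃ x y z : E[X], (x ≠ 0 ∨ y ≠ 0 ∨ z ≠ 0) ∧ x.natDegree ≤ e₀ ∧ y.natDegree ≤ e₁ ∧
      z.natDegree ≤ e₂ ∧ l (x, y, z) = 0 ∧
      g₀ ∣ g₁ * y - b₀ * z ∧ g₁ ∣ g₂ * z - b₁ * x ∧ g₂ ∣ g₀ * x - b₂ * y := by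
  let V₀ := Polynomial.degreeLT E (e₀ + 1)
  let V₁ := Polynomial.degreeLT E (e₁ + 1)
  let V₂ := Polynomial.degreeLT E (e₂ + 1)
  let ι : V₀ × V₁ × V₂ →ₗ[E] E[X] × E[X] × E[X] :=
    V₀.subtype.prodMap (V₁.subtype.prodMap V₂.subtype)
  let q (g : E[X]) : E[X] →ₗ[E] E[X] ⧸ Ideal.span {g} :=
    (Ideal.Quotient.mkₐ E (Ideal.span {g})).toLinearMap
  let px : E[X] × E[X] × E[X] →ₗ[E] E[X] := LinearMap.fst _ _ _
  let py : E[X] × E[X] × E[X] →ₗ[E] E[X] := LinearMap.fst _ _ _ ∘ₗ LinearMap.snd _ _ _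
  let pz : E[X] × E[X] × E[X] →ₗ[E] E[X] := LinearMap.snd _ _ _ ∘ₗ LinearMap.snd _ _ _
  let m (g : E[X]) : E[X] →ₗ[E] E[X] := LinearMap.mulLeft E g
  let T := (l.prod ((q g₀ ∘ₗ (m g₁ ∘ₗ py - m b₀ ∘ₗ pz)).prod
    ((q g₁ ∘ₗ (m g₂ ∘ₗ pz - m b₁ ∘ₗ px)).prod (q g₂ ∘ₗ (m g₀ ∘ₗ px - m b₂ ∘ₗ py))))) ∘ₗ ι
  have fin (g : E[X]) (hg : g ≠ 0) : Module.Finite E (E[X] ⧸ Ideal.span {g}) :=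
    (AdjoinRoot.powerBasis hg).finite
  have := fin g₀ h₀
  have := fin g₁ h₁
  have := fin g₂ h₂
  have fV (n : ℕ) : Module.finrank E (Polynomial.degreeLT E n) = n := by
    rw [(Polynomial.degreeLTEquiv E n).finrank_eq]; simp
  have fi (n : ℕ) : Module.Finite E (Polynomial.degreeLT E n) :=
    Module.Finite.equiv (Polynomial.degreeLTEquiv E n).symm
  have := fi (e₀ + 1)
  have := fi (e₁ + 1)
  have := fi (e₂ + 1)
  have hker : LinearMap.ker T ≠ ⊥ := by
    apply LinearMap.ker_ne_bot_of_finrank_lt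
    simp only [Module.finrank_prod, finrank_quotient_span_eq_natDegree, V₀, V₁, V₂, fV]
    omega
  obtain ⟨⟨x, y, z⟩, hv, hne⟩ := Submodule.exists_mem_ne_zero_of_ne_bot hker
  have key : T (x, y, z) = 0 := hv
  have hdeg (n : ℕ) (p : Polynomial.degreeLT E (n + 1)) : (p : E[X]).natDegree ≤ n := by
    have := Polynomial.mem_degreeLT.1 p.2
    by_cases hp : (p : E[X]) = 0
    · simp [hp]
    · have := (Polynomial.natDegree_lt_iff_degree_lt hp).2 this
      omega
  have k1 : l ((x : E[X]), (y : E[X]), (z : E[X])) = 0 := congrArg Prod.fst key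
  have k2 : q g₀ (g₁ * y - b₀ * z) = 0 := congrArg (fun t => t.2.1) key
  have k3 : q g₁ (g₂ * z - b₁ * x) = 0 := congrArg (fun t => t.2.2.1) key
  have k4 : q g₂ (g₀ * x - b₂ * y) = 0 := congrArg (fun t => t.2.2.2) key
  refine ⟨x, y, z, ?_, hdeg _ x, hdeg _ y, hdeg _ z, k1, ?_, ?_, ?_⟩
  · by_contra! hc
    apply hne
    ext1
    · exact Subtype.ext hc.1
    · ext1
      · exact Subtype.ext hc.2.1
      · exact Subtype.ext hc.2.2
  · exact Ideal.mem_span_singleton.1 (Ideal.Quotient.eq_zero_iff_mem.1 k2)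
  · exact Ideal.mem_span_singleton.1 (Ideal.Quotient.eq_zero_iff_mem.1 k3)
  · exact Ideal.mem_span_singleton.1 (Ideal.Quotient.eq_zero_iff_mem.1 k4)

theorem dvd_diag_of_congruent {R : Type*} [CommRing R] {g₀ g₁ g₂ b x y z : R}
    (hc : IsCoprime g₀ g₁) (hb : g₀ ∣ b ^ 2 + g₁ * g₂) (hxy : g₀ ∣ g₁ * y - b * z) :
    g₀ ∣ g₀ * x ^ 2 + g₁ * y ^ 2 + g₂ * z ^ 2 := by
  apply hc.dvd_of_dvd_mul_left
  obtain ⟨s, hs⟩ := hb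
  obtain ⟨t, ht⟩ := hxy
  refine ⟨g₁ * x ^ 2 + t * (g₁ * y + b * z) + s * z ^ 2, ?_⟩
  linear_combination (g₁ * y + b * z) * ht + z ^ 2 * hs

theorem isotropic3_of_linear {W : Type*} [AddCommGroup W] [Module E W] [FiniteDimensional E W]
    {g₀ g₁ g₂ b₀ b₁ b₂ : E[X]} (h₀ : g₀ ≠ 0) (h₁ : g₁ ≠ 0) (h₂ : g₂ ≠ 0)
    (c₀₁ : IsCoprime g₀ g₁) (c₁₂ : IsCoprime g₁ g₂) (c₂₀ : IsCoprime g₂ g₀)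
    (hb₀ : g₀ ∣ b₀ ^ 2 + g₁ * g₂) (hb₁ : g₁ ∣ b₁ ^ 2 + g₂ * g₀) (hb₂ : g₂ ∣ b₂ ^ 2 + g₀ * g₁)
    (e₀ e₁ e₂ : ℕ) (l : E[X] × E[X] × E[X] →ₗ[E] W)
    (hd : Module.finrank E W + (g₀.natDegree + g₁.natDegree + g₂.natDegree) < e₀ + e₁ + e₂ + 3)
    (he₀ : 2 * e₀ ≤ g₁.natDegree + g₂.natDegree) (he₁ : 2 * e₁ ≤ g₂.natDegree + g₀.natDegree)
    (he₂ : 2 * e₂ ≤ g₀.natDegree + g₁.natDegree)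
    (H : ∀ x y z : E[X], x.natDegree ≤ e₀ → y.natDegree ≤ e₁ → z.natDegree ≤ e₂ →
      l (x, y, z) = 0 → g₀ ∣ g₁ * y - b₀ * z → g₁ ∣ g₂ * z - b₁ * x → g₂ ∣ g₀ * x - b₂ * y →
      ∀ c : E, g₀ * x ^ 2 + g₁ * y ^ 2 + g₂ * z ^ 2 = C c * (g₀ * g₁ * g₂) → c = 0) :
    Isotropic3 g₀ g₁ g₂ := by
  obtain ⟨x, y, z, hne, hx, hy, hz, hl, k₀, k₁, k₂⟩ :=
    exists_small_congruent b₀ b₁ b₂ h₀ h₁ h₂ e₀ e₁ e₂ l hd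
  refine ⟨x, y, z, hne, ?_⟩
  have d₀ : g₀ ∣ g₀ * x ^ 2 + g₁ * y ^ 2 + g₂ * z ^ 2 := dvd_diag_of_congruent c₀₁ hb₀ k₀
  have d₁ : g₁ ∣ g₀ * x ^ 2 + g₁ * y ^ 2 + g₂ * z ^ 2 := by
    have : g₁ ∣ g₁ * y ^ 2 + g₂ * z ^ 2 + g₀ * x ^ 2 := dvd_diag_of_congruent c₁₂ hb₁ k₁
    convert this using 1; ring
  have d₂ : g₂ ∣ g₀ * x ^ 2 + g₁ * y ^ 2 + g₂ * z ^ 2 := by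
    have : g₂ ∣ g₂ * z ^ 2 + g₀ * x ^ 2 + g₁ * y ^ 2 := dvd_diag_of_congruent c₂₀ hb₂ k₂
    convert this using 1; ring
  obtain ⟨r, hr⟩ : g₀ * g₁ * g₂ ∣ g₀ * x ^ 2 + g₁ * y ^ 2 + g₂ * z ^ 2 :=
    IsCoprime.mul_dvd (IsCoprime.mul_left c₂₀.symm c₁₂) (c₀₁.mul_dvd d₀ d₁) d₂
  have hdeg : (g₀ * x ^ 2 + g₁ * y ^ 2 + g₂ * z ^ 2).natDegree ≤
      g₀.natDegree + g₁.natDegree + g₂.natDegree := by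
    have t (g w : E[X]) : (g * w ^ 2).natDegree ≤ g.natDegree + 2 * w.natDegree :=
      natDegree_mul_le.trans (Nat.add_le_add_left natDegree_pow_le _)
    refine natDegree_add_le_of_degree_le (natDegree_add_le_of_degree_le ?_ ?_) ?_
    · have := t g₀ x; omega
    · have := t g₁ y; omega
    · have := t g₂ z; omega
  have hrc : r = C (r.coeff 0) := by
    by_cases hr0 : r = 0
    · simp [hr0]
    apply eq_C_of_natDegree_eq_zero
    rw [hr, natDegree_mul (by simp [h₀, h₁, h₂]) hr0, natDegree_mul (by simp [h₀, h₁]) h₂,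
      natDegree_mul h₀ h₁] at hdeg
    omega
  have := H x y z hx hy hz hl k₀ k₁ k₂ (r.coeff 0) (by rw [hr, ← hrc]; ring)
  rw [hr, hrc, this]; simp

theorem isotropic3_of_odd
    {g₀ g₁ g₂ b₀ b₁ b₂ : E[X]} (h₀ : g₀ ≠ 0) (h₁ : g₁ ≠ 0) (h₂ : g₂ ≠ 0)
    (c₀₁ : IsCoprime g₀ g₁) (c₁₂ : IsCoprime g₁ g₂) (c₂₀ : IsCoprime g₂ g₀)
    (hb₀ : g₀ ∣ b₀ ^ 2 + g₁ * g₂) (hb₁ : g₁ ∣ b₁ ^ 2 + g₂ * g₀) (hb₂ : g₂ ∣ b₂ ^ 2 + g₀ * g₁)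
    (p₀ : Even (g₁.natDegree + g₂.natDegree)) (p₁ : Odd (g₂.natDegree + g₀.natDegree))
    (p₂ : Odd (g₀.natDegree + g₁.natDegree)) :
    Isotropic3 g₀ g₁ g₂ := by
  obtain ⟨e₀, he₀⟩ := p₀
  obtain ⟨e₁, he₁⟩ := p₁
  obtain ⟨e₂, he₂⟩ := p₂
  refine isotropic3_of_linear h₀ h₁ h₂ c₀₁ c₁₂ c₂₀ hb₀ hb₁ hb₂ e₀ e₁ e₂
    (lcoeff E e₀ ∘ₗ LinearMap.fst E E[X] (E[X] × E[X])) ?_ (by omega) (by omega) (by omega) ?_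
  · rw [Module.finrank_self]; omega
  intro x y z hx hy hz hl _ _ _ c hc
  have hl' : x.coeff e₀ = 0 := hl
  set D := g₀.natDegree + g₁.natDegree + g₂.natDegree with hD
  have t (g w : E[X]) (e : ℕ) (hw : w.natDegree ≤ e) (h : g.natDegree + 2 * e < D) :
      (g * w ^ 2).coeff D = 0 := by
    apply coeff_eq_zero_of_natDegree_lt
    have : (g * w ^ 2).natDegree ≤ g.natDegree + 2 * w.natDegree :=
      natDegree_mul_le.trans (Nat.add_le_add_left natDegree_pow_le _)
    omega
  have tx : (g₀ * x ^ 2).coeff D = 0 := by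
    rcases Nat.eq_zero_or_pos e₀ with h | h
    · subst h
      have : x = 0 := by rw [eq_C_of_natDegree_le_zero hx, hl', C_0]
      simp [this]
    · apply t g₀ x (e₀ - 1) _ (by omega)
      have : x.natDegree ≠ e₀ := by
        intro h'
        have h2 : x.leadingCoeff = 0 := by rw [leadingCoeff, h', hl']
        rw [leadingCoeff_eq_zero.1 h2] at h'
        simp at h'
        omega
      omega
  have hcf := congrArg (fun p => p.coeff D) hc
  simp only [coeff_add, tx, t g₁ y e₁ hy (by omega), t g₂ z e₂ hz (by omega), coeff_C_mul] at hcf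
  have : (g₀ * g₁ * g₂).coeff D ≠ 0 := by
    rw [hD, ← natDegree_mul h₀ h₁, ← natDegree_mul (by simp [h₀, h₁]) h₂, coeff_natDegree]
    simp [h₀, h₁, h₂]
  simpa [this] using hcf.symm

theorem isotropic3_of_even
    {g₀ g₁ g₂ b₀ b₁ b₂ : E[X]} (h₀ : g₀ ≠ 0) (h₁ : g₁ ≠ 0) (h₂ : g₂ ≠ 0)
    (c₀₁ : IsCoprime g₀ g₁) (c₁₂ : IsCoprime g₁ g₂) (c₂₀ : IsCoprime g₂ g₀)
    (hb₀ : g₀ ∣ b₀ ^ 2 + g₁ * g₂) (hb₁ : g₁ ∣ b₁ ^ 2 + g₂ * g₀) (hb₂ : g₂ ∣ b₂ ^ 2 + g₀ * g₁)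
    (p₀ : Even (g₁.natDegree + g₂.natDegree)) (p₁ : Even (g₂.natDegree + g₀.natDegree))
    (p₂ : Even (g₀.natDegree + g₁.natDegree))
    (hX : ¬ X ∣ g₀ * g₁ * g₂) (hz : Isotropic3 (g₀.coeff 0) (g₁.coeff 0) (g₂.coeff 0)) :
    Isotropic3 g₀ g₁ g₂ := by
  obtain ⟨e₀, he₀⟩ := p₀
  obtain ⟨e₁, he₁⟩ := p₁
  obtain ⟨e₂, he₂⟩ := p₂
  obtain ⟨a₀, a₁, a₂, hne, ha⟩ := hz
  let a : E × E × E := (a₀, a₁, a₂)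
  have ha0 : a ≠ 0 := by
    intro h; simp [a, Prod.ext_iff] at h; tauto
  let ev : E[X] × E[X] × E[X] →ₗ[E] E × E × E :=
    (lcoeff E 0).prodMap ((lcoeff E 0).prodMap (lcoeff E 0))
  refine isotropic3_of_linear h₀ h₁ h₂ c₀₁ c₁₂ c₂₀ hb₀ hb₁ hb₂ e₀ e₁ e₂
    ((Submodule.span E {a}).mkQ ∘ₗ ev) ?_ (by omega) (by omega) (by omega) ?_
  · have := Submodule.finrank_quotient_add_finrank (Submodule.span E {a})
    rw [finrank_span_singleton ha0] at this
    simp only [Module.finrank_prod, Module.finrank_self] at this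
    omega
  intro x y z hx hy hz hl _ _ _ c hc
  have hl' : ev (x, y, z) ∈ Submodule.span E {a} := (Submodule.Quotient.mk_eq_zero _).1 hl
  obtain ⟨s, hs⟩ := Submodule.mem_span_singleton.1 hl'
  have s0 : s * a₀ = x.coeff 0 := congrArg Prod.fst hs
  have s1 : s * a₁ = y.coeff 0 := congrArg (fun t => t.2.1) hs
  have s2 : s * a₂ = z.coeff 0 := congrArg (fun t => t.2.2) hs
  have hcf := congrArg (fun p => p.coeff 0) hc
  simp only [coeff_add, mul_coeff_zero, pow_two, coeff_C_zero, ← s0, ← s1, ← s2] at hcf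
  rw [X_dvd_iff] at hX
  simp only [mul_coeff_zero] at hX
  have : c * (g₀.coeff 0 * g₁.coeff 0 * g₂.coeff 0) = 0 := by
    rw [← hcf]; linear_combination s ^ 2 * ha
  simpa [hX] using this

theorem isotropic3_of_even_of_dvd
    {g₀ g₁ g₂ b₀ b₁ b₂ : E[X]} (h₀ : g₀ ≠ 0) (h₁ : g₁ ≠ 0) (h₂ : g₂ ≠ 0)
    (c₀₁ : IsCoprime g₀ g₁) (c₁₂ : IsCoprime g₁ g₂) (c₂₀ : IsCoprime g₂ g₀)
    (hb₀ : g₀ ∣ b₀ ^ 2 + g₁ * g₂) (hb₁ : g₁ ∣ b₁ ^ 2 + g₂ * g₀) (hb₂ : g₂ ∣ b₂ ^ 2 + g₀ * g₁)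
    (p₀ : Even (g₁.natDegree + g₂.natDegree)) (p₁ : Even (g₂.natDegree + g₀.natDegree))
    (p₂ : Even (g₀.natDegree + g₁.natDegree))
    (hX : X ∣ g₀) (hX2 : ¬ X ^ 2 ∣ g₀ * g₁ * g₂) :
    Isotropic3 g₀ g₁ g₂ := by
  obtain ⟨e₀, he₀⟩ := p₀
  obtain ⟨e₁, he₁⟩ := p₁
  obtain ⟨e₂, he₂⟩ := p₂
  let ev : E[X] × E[X] × E[X] →ₗ[E] E × E :=
    (lcoeff E 0).prodMap (lcoeff E 0 ∘ₗ LinearMap.snd _ _ _)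
  refine isotropic3_of_linear h₀ h₁ h₂ c₀₁ c₁₂ c₂₀ hb₀ hb₁ hb₂ e₀ e₁ e₂
    ev ?_ (by omega) (by omega) (by omega) ?_
  · simp only [Module.finrank_prod, Module.finrank_self]
    omega
  intro x y z hx hy hz hl k₀ _ _ c hc
  have l1 : x.coeff 0 = 0 := congrArg Prod.fst hl
  have l2 : z.coeff 0 = 0 := congrArg Prod.snd hl
  have x1 : X ∣ x := X_dvd_iff.2 l1
  have x2 : X ∣ z := X_dvd_iff.2 l2
  have x3 : X ∣ y := by
    have : X ∣ g₁ * y := by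
      have := dvd_add (hX.trans k₀) (x2.mul_left b₀)
      simpa using this
    refine (IsCoprime.of_isCoprime_of_dvd_left c₀₁ hX).dvd_of_dvd_mul_left this
  by_contra hc0
  apply hX2
  have : X ^ 2 ∣ C c * (g₀ * g₁ * g₂) := by
    rw [← hc]
    exact dvd_add (dvd_add ((pow_dvd_pow_of_dvd x1 2).mul_left _)
      ((pow_dvd_pow_of_dvd x3 2).mul_left _)) ((pow_dvd_pow_of_dvd x2 2).mul_left _)
  exact (IsUnit.dvd_mul_left (isUnit_C.2 (IsUnit.mk0 _ hc0))).1 this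

/-- A function field analogue of Legendre's theorem, with a local condition at `0` only when
none of the coefficients vanishes there. -/
theorem isotropic3_polynomial
    {g₀ g₁ g₂ b₀ b₁ b₂ : E[X]} (h₀ : g₀ ≠ 0) (h₁ : g₁ ≠ 0) (h₂ : g₂ ≠ 0)
    (c₀₁ : IsCoprime g₀ g₁) (c₁₂ : IsCoprime g₁ g₂) (c₂₀ : IsCoprime g₂ g₀)
    (hb₀ : g₀ ∣ b₀ ^ 2 + g₁ * g₂) (hb₁ : g₁ ∣ b₁ ^ 2 + g₂ * g₀) (hb₂ : g₂ ∣ b₂ ^ 2 + g₀ * g₁)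
    (hX2 : ¬ X ^ 2 ∣ g₀ * g₁ * g₂)
    (hz : ¬ X ∣ g₀ * g₁ * g₂ → Isotropic3 (g₀.coeff 0) (g₁.coeff 0) (g₂.coeff 0)) :
    Isotropic3 g₀ g₁ g₂ := by
  have hX2' : ¬ X ^ 2 ∣ g₁ * g₂ * g₀ := by rwa [show g₁ * g₂ * g₀ = g₀ * g₁ * g₂ by ring]
  have hX2'' : ¬ X ^ 2 ∣ g₂ * g₀ * g₁ := by rwa [show g₂ * g₀ * g₁ = g₀ * g₁ * g₂ by ring]
  rcases Nat.even_or_odd (g₁.natDegree + g₂.natDegree) with p₀ | p₀ <;>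
  rcases Nat.even_or_odd (g₂.natDegree + g₀.natDegree) with p₁ | p₁ <;>
  rcases Nat.even_or_odd (g₀.natDegree + g₁.natDegree) with p₂ | p₂
  · by_cases hX : X ∣ g₀ * g₁ * g₂
    · rcases prime_X.dvd_or_dvd hX with hX | hX
      · rcases prime_X.dvd_or_dvd hX with hX | hX
        · exact isotropic3_of_even_of_dvd h₀ h₁ h₂ c₀₁ c₁₂ c₂₀ hb₀ hb₁ hb₂ p₀ p₁ p₂ hX hX2
        · exact (isotropic3_of_even_of_dvd h₁ h₂ h₀ c₁₂ c₂₀ c₀₁ hb₁ hb₂ hb₀ p₁ p₂ p₀ hX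
            hX2').rotate.rotate
      · exact (isotropic3_of_even_of_dvd h₂ h₀ h₁ c₂₀ c₀₁ c₁₂ hb₂ hb₀ hb₁ p₂ p₀ p₁ hX
          hX2'').rotate
    · exact isotropic3_of_even h₀ h₁ h₂ c₀₁ c₁₂ c₂₀ hb₀ hb₁ hb₂ p₀ p₁ p₂ hX (hz hX)
  · exfalso; grind
  · exfalso; grind
  · exact isotropic3_of_odd h₀ h₁ h₂ c₀₁ c₁₂ c₂₀ hb₀ hb₁ hb₂ p₀ p₁ p₂
  · exfalso; grind
  · exact (isotropic3_of_odd h₁ h₂ h₀ c₁₂ c₂₀ c₀₁ hb₁ hb₂ hb₀ p₁ p₂ p₀).rotate.rotate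
  · exact (isotropic3_of_odd h₂ h₀ h₁ c₂₀ c₀₁ c₁₂ hb₂ hb₀ hb₁ p₂ p₀ p₁).rotate
  · exfalso; grind

end

section

open Polynomial

theorem exists_primitive {R ι : Type*} [CommRing R] [IsDomain R] [WfDvdMonoid R] {p : R}
    (hp : Prime p) {z : ι → R} (hz : z ≠ 0) :
    ∃ (k : ℕ) (w : ι → R), (∀ i, z i = p ^ k * w i) ∧ ∃ i, ¬ p ∣ w i := by
  by_contra! hc
  obtain ⟨i, hi⟩ := Function.ne_iff.1 hz
  have key : ∀ k : ℕ, ∃ w : ι → R, ∀ i, z i = p ^ k * w i := by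
    intro k
    induction k with
    | zero => exact ⟨z, by simp⟩
    | succ k ih =>
      obtain ⟨w, hw⟩ := ih
      choose v hv using hc k w hw
      exact ⟨v, fun i => by rw [hw, hv, pow_succ, mul_assoc]⟩
  obtain ⟨n, hn⟩ := FiniteMultiplicity.of_not_isUnit hp.not_isUnit hi
  obtain ⟨w, hw⟩ := key (n + 1)
  exact hn ⟨w i, hw i⟩

section Residue

variable {R : Type*} [CommRing R] [IsDomain R] [IsPrincipalIdealRing R] {p : R}

theorem exists_sq_add_of_dvd (hp : Prime p) {a b c : R} (hb : ¬ p ∣ b)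
    (h : p ∣ c ^ 2 + a * b ^ 2) : ∃ t, p ∣ t ^ 2 + a := by
  obtain ⟨u, v, huv⟩ := (hp.irreducible.coprime_iff_not_dvd).2 hb
  obtain ⟨w, hw⟩ := h
  refine ⟨c * v, ⟨w * v ^ 2 + a * u * (1 + v * b), ?_⟩⟩
  linear_combination v ^ 2 * hw - a * (1 + v * b) * huv

theorem exists_sq_add_of_residue (hp : Prime p) {Φ s e₀ e₁ e₂ : R} (hs : ¬ p ∣ s)
    (hΦ : p ∣ Φ - s ^ 2) (h₀ : ¬ p ∣ e₀) (h₁ : ¬ p ∣ e₁)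
    {z : Fin 4 → R} (hz : z ≠ 0)
    (h : e₁ * e₂ * z 1 ^ 2 + Φ * z 0 ^ 2 + p * e₀ * (e₂ * z 2 ^ 2 + e₁ * z 3 ^ 2) = 0) :
    ∃ t, p ∣ t ^ 2 + e₁ * e₂ := by
  obtain ⟨k, w, hw, i, hi⟩ := exists_primitive hp hz
  have hpk : p ^ k ≠ 0 := pow_ne_zero _ hp.ne_zero
  have h' : e₁ * e₂ * w 1 ^ 2 + Φ * w 0 ^ 2 + p * e₀ * (e₂ * w 2 ^ 2 + e₁ * w 3 ^ 2) = 0 := by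
    simp only [hw] at h
    have : (p ^ k) ^ 2 * (e₁ * e₂ * w 1 ^ 2 + Φ * w 0 ^ 2 +
      p * e₀ * (e₂ * w 2 ^ 2 + e₁ * w 3 ^ 2)) = 0 := by linear_combination h
    exact (mul_eq_zero.1 this).resolve_left (pow_ne_zero _ hpk)
  obtain ⟨r, hr⟩ := hΦ
  by_cases w1 : p ∣ w 1
  · have d0 : p ∣ (s * w 0) ^ 2 := by
      obtain ⟨a, ha⟩ := w1
      refine ⟨- (e₁ * e₂ * w 1 * a) - r * w 0 ^ 2 - e₀ * (e₂ * w 2 ^ 2 + e₁ * w 3 ^ 2), ?_⟩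
      linear_combination h' - w 0 ^ 2 * hr - e₁ * e₂ * w 1 * ha
    have w0 : p ∣ w 0 := (hp.dvd_or_dvd (hp.dvd_of_dvd_pow d0)).resolve_left hs
    have d1 : p ∣ e₀ * (e₂ * w 2 ^ 2 + e₁ * w 3 ^ 2) := by
      obtain ⟨a, ha⟩ := w1
      obtain ⟨b, hb⟩ := w0
      refine ⟨- (e₁ * e₂ * a ^ 2) - Φ * b ^ 2, mul_left_cancel₀ hp.ne_zero ?_⟩
      rw [ha, hb] at h'
      linear_combination h'
    have d2 := (hp.dvd_or_dvd d1).resolve_left h₀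
    by_cases w2 : p ∣ w 2
    · have w3 : p ∣ w 3 := by
        have : p ∣ e₁ * w 3 ^ 2 := by
          have := dvd_sub d2 ((w2.trans (dvd_pow_self _ two_ne_zero)).mul_left e₂)
          simpa using this
        exact hp.dvd_of_dvd_pow ((hp.dvd_or_dvd this).resolve_left h₁)
      exfalso
      fin_cases i
      exacts [hi w0, hi w1, hi w2, hi w3]
    · refine exists_sq_add_of_dvd hp (c := e₁ * w 3) w2 ?_
      have := d2.mul_left e₁
      convert this using 1; ring
  · refine exists_sq_add_of_dvd hp (c := s * w 0) w1
      ⟨- r * w 0 ^ 2 - e₀ * (e₂ * w 2 ^ 2 + e₁ * w 3 ^ 2), ?_⟩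
    linear_combination h' - w 0 ^ 2 * hr

theorem exists_sq_add_of_squarefree (a : R) {g : R} (hg : g ≠ 0) (hsq : Squarefree g)
    (h : ∀ p, Prime p → p ∣ g → ∃ t, p ∣ t ^ 2 + a) : ∃ b, g ∣ b ^ 2 + a := by
  induction g using UniqueFactorizationMonoid.induction_on_prime with
  | h₁ => exact absurd rfl hg
  | h₂ x hx => exact ⟨0, hx.dvd⟩
  | h₃ g p hg0 hp ih =>
    obtain ⟨b, hb⟩ := ih hg0 (hsq.of_mul_right) (fun q hq hqg => h q hq (hqg.mul_left p))
    obtain ⟨t, ht⟩ := h p hp (dvd_mul_right _ _)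
    have hpg : ¬ p ∣ g := by
      rintro ⟨c, rfl⟩
      exact hp.not_isUnit (hsq p ⟨c, by ring⟩)
    have hcop := (hp.irreducible.coprime_iff_not_dvd).2 hpg
    obtain ⟨u, v, huv⟩ := hcop
    refine ⟨t * (v * g) + b * (u * p), IsCoprime.mul_dvd ⟨u, v, huv⟩ ?_ ?_⟩
    · obtain ⟨c, hc⟩ := ht
      have hv : v * g = 1 - u * p := by linear_combination huv
      refine ⟨c + (- u * t + b * u) * (t + t * (v * g) + b * (u * p)), ?_⟩
      rw [hv]
      linear_combination hc
    · obtain ⟨c, hc⟩ := hb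
      have hv : u * p = 1 - v * g := by linear_combination huv
      refine ⟨c + (- v * b + t * v) * (b + t * (v * g) + b * (u * p)), ?_⟩
      rw [hv]
      linear_combination hc

end Residue

section Forms

variable {R : Type*} [CommRing R]

/-- The discriminant-type coefficient of `z₀²` in the Hassett–Pirutka–Tschinkel form. -/
def hptConic (x₀ x₁ x₂ : R) : R :=
  x₀ ^ 2 + x₁ ^ 2 + x₂ ^ 2 - 2 * x₀ * x₁ - 2 * x₁ * x₂ - 2 * x₀ * x₂

/-- The Hassett–Pirutka–Tschinkel form of bidegree `(2, 2)`. -/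
def hptForm (x₀ x₁ x₂ : R) (z : Fin 4 → R) : R :=
  x₁ * x₂ * z 1 ^ 2 + x₀ * x₂ * z 2 ^ 2 + x₀ * x₁ * z 3 ^ 2 + hptConic x₀ x₁ x₂ * z 0 ^ 2

theorem hptForm_mul (a x₀ x₁ x₂ : R) (z : Fin 4 → R) :
    hptForm (a * x₀) (a * x₁) (a * x₂) z = a ^ 2 * hptForm x₀ x₁ x₂ z := by
  simp only [hptForm, hptConic]; ring

theorem hptForm_rotate (x₀ x₁ x₂ : R) (z : Fin 4 → R) :
    hptForm x₁ x₂ x₀ ![z 0, z 2, z 3, z 1] = hptForm x₀ x₁ x₂ z := by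
  simp [hptForm, hptConic]; ring

theorem hptConic_mod {p : R} {n₀ n₁ n₂ : ℕ} {e₀ e₁ e₂ : R}
    (h₀ : ¬ p ∣ e₀) (h₁ : ¬ p ∣ e₁) (h₂ : ¬ p ∣ e₂)
    (hmin : n₀ = 0 ∨ n₁ = 0 ∨ n₂ = 0) (hne : ¬ (n₀ = n₁ ∧ n₁ = n₂)) :
    (∃ s, ¬ p ∣ s ∧ p ∣ hptConic (p ^ n₀ * e₀) (p ^ n₁ * e₁) (p ^ n₂ * e₂) - s ^ 2) ∨
      (n₁ = 0 ∧ n₂ = 0 ∧ p ∣ e₁ - e₂) ∨ (n₂ = 0 ∧ n₀ = 0 ∧ p ∣ e₂ - e₀) ∨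
      (n₀ = 0 ∧ n₁ = 0 ∧ p ∣ e₀ - e₁) := by
  have key (x₀ x₁ x₂ s u₀ u₁ u₂ : R) (hu : hptConic u₀ u₁ u₂ = s ^ 2) (d₀ : p ∣ x₀ - u₀)
      (d₁ : p ∣ x₁ - u₁) (d₂ : p ∣ x₂ - u₂) : p ∣ hptConic x₀ x₁ x₂ - s ^ 2 := by
    rw [← hu]
    obtain ⟨c₀, d₀⟩ := d₀
    obtain ⟨c₁, d₁⟩ := d₁
    obtain ⟨c₂, d₂⟩ := d₂
    rw [sub_eq_iff_eq_add] at d₀ d₁ d₂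
    subst d₀ d₁ d₂
    exact ⟨c₀ * (p * c₀ + 2 * u₀) + c₁ * (p * c₁ + 2 * u₁) + c₂ * (p * c₂ + 2 * u₂)
      - 2 * (c₀ * (p * c₁ + u₁) + u₀ * c₁) - 2 * (c₁ * (p * c₂ + u₂) + u₁ * c₂)
      - 2 * (c₀ * (p * c₂ + u₂) + u₀ * c₂), by simp only [hptConic]; ring⟩
  have z (n : ℕ) (hn : n ≠ 0) (e : R) : p ∣ p ^ n * e - 0 := by
    rw [sub_zero]; exact (dvd_pow_self _ hn).mul_right _
  have r (e : R) : p ∣ p ^ 0 * e - e := by simp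
  by_cases a₀ : n₀ = 0 <;> by_cases a₁ : n₁ = 0 <;> by_cases a₂ : n₂ = 0
  · exact absurd ⟨by omega, by omega⟩ hne
  · by_cases hd : p ∣ e₀ - e₁
    · exact Or.inr (Or.inr (Or.inr ⟨a₀, a₁, hd⟩))
    · subst a₀ a₁
      exact Or.inl ⟨_, hd, key _ _ _ _ e₀ e₁ 0
        (by simp only [hptConic]; ring) (r _) (r _) (z _ a₂ _)⟩
  · by_cases hd : p ∣ e₂ - e₀
    · exact Or.inr (Or.inr (Or.inl ⟨a₂, a₀, hd⟩))
    · subst a₀ a₂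
      exact Or.inl ⟨_, hd, key _ _ _ _ e₀ 0 e₂
        (by simp only [hptConic]; ring) (r _) (z _ a₁ _) (r _)⟩
  · subst a₀
    exact Or.inl ⟨_, h₀, key _ _ _ _ e₀ 0 0
      (by simp only [hptConic]; ring) (r _) (z _ a₁ _) (z _ a₂ _)⟩
  · by_cases hd : p ∣ e₁ - e₂
    · exact Or.inr (Or.inl ⟨a₁, a₂, hd⟩)
    · subst a₁ a₂
      exact Or.inl ⟨_, hd, key _ _ _ _ 0 e₁ e₂
        (by simp only [hptConic]; ring) (z _ a₀ _) (r _) (r _)⟩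
  · subst a₁
    exact Or.inl ⟨_, h₁, key _ _ _ _ 0 e₁ 0
      (by simp only [hptConic]; ring) (z _ a₀ _) (r _) (z _ a₂ _)⟩
  · subst a₂
    exact Or.inl ⟨_, h₂, key _ _ _ _ 0 0 e₂
      (by simp only [hptConic]; ring) (z _ a₀ _) (z _ a₁ _) (r _)⟩
  · omega

end Forms

theorem exists_sub_min (n₀ n₁ n₂ : ℕ) : ∃ m m₀ m₁ m₂ : ℕ, n₀ = m + m₀ ∧ n₁ = m + m₁ ∧
    n₂ = m + m₂ ∧ (m₀ = 0 ∨ m₁ = 0 ∨ m₂ = 0) :=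
  ⟨min n₀ (min n₁ n₂), n₀ - min n₀ (min n₁ n₂), n₁ - min n₀ (min n₁ n₂),
    n₂ - min n₀ (min n₁ n₂), by omega, by omega, by omega, by omega⟩

section Local

variable {R : Type*} [CommRing R] [IsDomain R] {p : R}

theorem hptForm_sub_min (hp : Prime p) {m m₀ m₁ m₂ : ℕ} {e₀ e₁ e₂ : R} {z : Fin 4 → R}
    (h : hptForm (p ^ (m + m₀) * e₀) (p ^ (m + m₁) * e₁) (p ^ (m + m₂) * e₂) z = 0) :
    hptForm (p ^ m₀ * e₀) (p ^ m₁ * e₁) (p ^ m₂ * e₂) z = 0 := by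
  rw [pow_add, pow_add, pow_add, mul_assoc, mul_assoc, mul_assoc, hptForm_mul] at h
  exact (mul_eq_zero.1 h).resolve_left (pow_ne_zero _ (pow_ne_zero _ hp.ne_zero))

variable [IsPrincipalIdealRing R]

theorem exists_sq_add_of_hptForm (hp : Prime p) {i : R} (hi : i ^ 2 = -1)
    {n₀ n₁ n₂ : ℕ} {e₀ e₁ e₂ : R} (h₀ : ¬ p ∣ e₀) (h₁ : ¬ p ∣ e₁) (h₂ : ¬ p ∣ e₂)
    {z : Fin 4 → R} (hz : z ≠ 0)
    (h : hptForm (p ^ n₀ * e₀) (p ^ n₁ * e₁) (p ^ n₂ * e₂) z = 0)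
    (hn : Even (n₁ + n₂)) (hn' : Odd (n₀ + n₁)) : ∃ t, p ∣ t ^ 2 + e₁ * e₂ := by
  obtain ⟨m, m₀, m₁, m₂, rfl, rfl, rfl, hmin⟩ := exists_sub_min n₀ n₁ n₂
  replace h := hptForm_sub_min hp h
  have hodd : Odd (m₀ + m₂) := by grind
  replace hn : Even (m₁ + m₂) := by grind
  replace hn' : Odd (m₀ + m₁) := by grind
  rcases hptConic_mod h₀ h₁ h₂ hmin (by grind) with ⟨s, hs, hd⟩ | ⟨_, _, c, hc⟩ | h' | h'
  · obtain ⟨a, ha⟩ := hn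
    obtain ⟨b, hb⟩ := hodd
    obtain ⟨c, hc⟩ := hn'
    refine exists_sq_add_of_residue hp (e₂ := e₂) hs hd h₀ h₁
      (z := ![z 0, p ^ a * z 1, p ^ b * z 2, p ^ c * z 3]) ?_ ?_
    · intro h0
      apply hz
      have hne (n : ℕ) : p ^ n ≠ 0 := pow_ne_zero _ hp.ne_zero
      funext j
      have := congrFun h0 j
      fin_cases j
      · simpa using this
      all_goals simpa [hp.ne_zero] using this
    · simp only [hptForm] at h
      rw [← h]
      have ea : p ^ m₁ * p ^ m₂ = (p ^ a) ^ 2 := by rw [← pow_add, ha, ← pow_mul, mul_two]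
      have eb : p ^ m₀ * p ^ m₂ = p * (p ^ b) ^ 2 := by
        rw [← pow_add, hb, ← pow_mul, pow_succ, mul_comm b, mul_comm p]
      have ec : p ^ m₀ * p ^ m₁ = p * (p ^ c) ^ 2 := by
        rw [← pow_add, hc, ← pow_mul, pow_succ, mul_comm c, mul_comm p]
      simp
      linear_combination - (e₁ * e₂ * z 1 ^ 2) * ea - (e₀ * e₂ * z 2 ^ 2) * eb
        - (e₀ * e₁ * z 3 ^ 2) * ec
  · refine ⟨i * e₁, ⟨- e₁ * c, ?_⟩⟩
    linear_combination - e₁ * hc + e₁ ^ 2 * hi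
  · grind
  · grind

end Local

section Field

variable {E : Type*} [Field E]

theorem isotropic3_of_pfister {a b p q r w : E}
    (hne : w ≠ 0 ∨ p ≠ 0 ∨ q ≠ 0 ∨ r ≠ 0)
    (h : w ^ 2 + a * p ^ 2 + b * q ^ 2 + a * b * r ^ 2 = 0) : Isotropic3 a b (a * b) := by
  by_cases hN : q ^ 2 + a * r ^ 2 = 0
  · by_cases hqr : q = 0 ∧ r = 0
    · obtain ⟨rfl, rfl⟩ := hqr
      refine ⟨0, w, p, by simpa using hne, by linear_combination b * h⟩
    · refine ⟨0, q, r, by tauto, by linear_combination b * hN⟩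
  · by_cases hb : b = 0
    · subst hb
      exact ⟨0, 1, 0, by simp, by simp⟩
    refine ⟨b * (q ^ 2 + a * r ^ 2), a * (p * q - w * r), w * q + a * p * r,
      Or.inl (mul_ne_zero hb hN), ?_⟩
    linear_combination a * b * (q ^ 2 + a * r ^ 2) * h

theorem isotropic3_of_residue {a b c p q r w s : E} (ha : a ≠ 0) (hb : b ≠ 0) (hc : c ≠ 0)
    (hs : s ≠ 0) (hne : w ≠ 0 ∨ p ≠ 0 ∨ q ≠ 0 ∨ r ≠ 0)
    (h : b * c * p ^ 2 + a * c * q ^ 2 + a * b * r ^ 2 + s ^ 2 * w ^ 2 = 0) :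
    Isotropic3 a b c := by
  obtain ⟨x, y, z, hne', h'⟩ := isotropic3_of_pfister (a := b * c) (b := a * c) (w := s * w)
    (p := p) (q := q) (r := r / c) (by simpa [hs, hc] using hne)
    (by field_simp; linear_combination h)
  refine ⟨x / a, y / b, z, by simpa [ha, hb] using hne', ?_⟩
  have hh : a * b * c * (a * (x / a) ^ 2 + b * (y / b) ^ 2 + c * z ^ 2) = 0 := by
    field_simp
    linear_combination h'
  simpa [ha, hb, hc] using hh

theorem isotropic3_coeff_zero {i : E} (hi : i ^ 2 = -1)
    {n₀ n₁ n₂ : ℕ} {e₀ e₁ e₂ : E[X]} (h₀ : ¬ X ∣ e₀) (h₁ : ¬ X ∣ e₁) (h₂ : ¬ X ∣ e₂)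
    {z : Fin 4 → E[X]} (hz : z ≠ 0)
    (h : hptForm (X ^ n₀ * e₀) (X ^ n₁ * e₁) (X ^ n₂ * e₂) z = 0)
    (hn : Even (n₁ + n₂)) (hn' : Even (n₀ + n₁))
    (heq : n₀ = n₁ → n₁ = n₂ → Isotropic3 (e₀.coeff 0) (e₁.coeff 0) (e₂.coeff 0)) :
    Isotropic3 (e₀.coeff 0) (e₁.coeff 0) (e₂.coeff 0) := by
  by_cases hall : n₀ = n₁ ∧ n₁ = n₂
  · exact heq hall.1 hall.2
  obtain ⟨m, m₀, m₁, m₂, rfl, rfl, rfl, hmin⟩ := exists_sub_min n₀ n₁ n₂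
  replace h := hptForm_sub_min prime_X h
  have he : Even (m₀ + m₂) := by grind
  replace hn : Even (m₁ + m₂) := by grind
  replace hn' : Even (m₀ + m₁) := by grind
  have hi' : 1 + i ^ 2 = 0 := by rw [hi]; ring
  rcases hptConic_mod h₀ h₁ h₂ hmin (by grind) with ⟨s, hs, hd⟩ | h' | h' | h'
  · obtain ⟨a, ha⟩ := hn
    obtain ⟨b, hb⟩ := he
    obtain ⟨c, hc⟩ := hn'
    have hne (n : ℕ) : (X : E[X]) ^ n ≠ 0 := pow_ne_zero _ X_ne_zero
    have hz' : ![z 0, X ^ a * z 1, X ^ b * z 2, X ^ c * z 3] ≠ 0 := by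
      intro h0
      apply hz
      funext j
      have := congrFun h0 j
      fin_cases j
      · simpa using this
      all_goals simpa using this
    obtain ⟨k, w, hw, j, hj⟩ := exists_primitive prime_X hz'
    have ea : (X : E[X]) ^ m₁ * X ^ m₂ = (X ^ a) ^ 2 := by
      rw [← pow_add, ha, ← pow_mul, mul_two]
    have eb : (X : E[X]) ^ m₀ * X ^ m₂ = (X ^ b) ^ 2 := by
      rw [← pow_add, hb, ← pow_mul, mul_two]
    have ec : (X : E[X]) ^ m₀ * X ^ m₁ = (X ^ c) ^ 2 := by
      rw [← pow_add, hc, ← pow_mul, mul_two]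
    have w0 : z 0 = X ^ k * w 0 := hw 0
    have w1 : X ^ a * z 1 = X ^ k * w 1 := hw 1
    have w2 : X ^ b * z 2 = X ^ k * w 2 := hw 2
    have w3 : X ^ c * z 3 = X ^ k * w 3 := hw 3
    have hform : e₁ * e₂ * w 1 ^ 2 + e₀ * e₂ * w 2 ^ 2 + e₀ * e₁ * w 3 ^ 2 +
        hptConic (X ^ m₀ * e₀) (X ^ m₁ * e₁) (X ^ m₂ * e₂) * w 0 ^ 2 = 0 := by
      apply (mul_eq_zero.1 (?_ : (X ^ k) ^ 2 * _ = 0)).resolve_left (pow_ne_zero _ (hne k))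
      rw [hptForm] at h
      calc _ = e₁ * e₂ * (X ^ k * w 1) ^ 2 + e₀ * e₂ * (X ^ k * w 2) ^ 2 +
            e₀ * e₁ * (X ^ k * w 3) ^ 2 +
            hptConic (X ^ m₀ * e₀) (X ^ m₁ * e₁) (X ^ m₂ * e₂) * (X ^ k * w 0) ^ 2 := by ring
        _ = 0 := by
          rw [← w0, ← w1, ← w2, ← w3, ← h]
          linear_combination - (e₁ * e₂ * z 1 ^ 2) * ea - (e₀ * e₂ * z 2 ^ 2) * eb
            - (e₀ * e₁ * z 3 ^ 2) * ec
    obtain ⟨r, hr⟩ := hd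
    rw [sub_eq_iff_eq_add] at hr
    rw [hr] at hform
    have hc0 := congrArg (fun p => p.coeff 0) hform
    simp only [coeff_add, mul_coeff_zero, pow_two, coeff_X_zero, coeff_zero, zero_mul,
      zero_add] at hc0
    rw [X_dvd_iff] at h₀ h₁ h₂ hs hj
    refine isotropic3_of_residue h₀ h₁ h₂ hs (p := (w 1).coeff 0) (q := (w 2).coeff 0)
      (r := (w 3).coeff 0) (w := (w 0).coeff 0) ?_ (by linear_combination hc0)
    fin_cases j
    · exact Or.inl hj
    · exact Or.inr (Or.inl hj)
    · exact Or.inr (Or.inr (Or.inl hj))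
    · exact Or.inr (Or.inr (Or.inr hj))
  · have := X_dvd_iff.1 h'.2.2
    rw [coeff_sub, sub_eq_zero] at this
    exact ⟨0, 1, i, by simp, by linear_combination this + e₂.coeff 0 * hi'⟩
  · have := X_dvd_iff.1 h'.2.2
    rw [coeff_sub, sub_eq_zero] at this
    exact ⟨i, 0, 1, by simp, by linear_combination this + e₀.coeff 0 * hi'⟩
  · have := X_dvd_iff.1 h'.2.2
    rw [coeff_sub, sub_eq_zero] at this
    exact ⟨1, i, 0, by simp, by linear_combination this + e₁.coeff 0 * hi'⟩

end Field

end

section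

open Polynomial

/-- Two triples have the same classes modulo squares, up to a common factor. -/
def SquareEquivalent {R : Type*} [CommRing R] (f g : Fin 3 → R) : Prop :=
  ∃ (l m : R) (p q : Fin 3 → R), l ≠ 0 ∧ m ≠ 0 ∧
    ∀ j, p j ≠ 0 ∧ q j ≠ 0 ∧ l * f j * p j ^ 2 = m * g j * q j ^ 2

theorem SquareEquivalent.isotropic3 {R : Type*} [CommRing R] [IsDomain R] {f g : Fin 3 → R}
    (h : SquareEquivalent f g) (hg : Isotropic3 (g 0) (g 1) (g 2)) :
    Isotropic3 (f 0) (f 1) (f 2) := by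
  obtain ⟨l, m, p, q, hl, hm, h⟩ := h
  obtain ⟨x, y, z, hne, hq⟩ := hg
  refine ⟨p 0 * q 1 * q 2 * x, p 1 * q 0 * q 2 * y, p 2 * q 0 * q 1 * z, ?_, ?_⟩
  · simpa [fun j => (h j).1, fun j => (h j).2.1] using hne
  · apply (mul_eq_zero.1 (?_ : l * _ = 0)).resolve_left hl
    linear_combination (q 1 * q 2 * x) ^ 2 * (h 0).2.2 + (q 0 * q 2 * y) ^ 2 * (h 1).2.2 +
      (q 0 * q 1 * z) ^ 2 * (h 2).2.2 + m * (q 0 * q 1 * q 2) ^ 2 * hq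

theorem SquareEquivalent.symm {R : Type*} [CommRing R] {f g : Fin 3 → R}
    (h : SquareEquivalent f g) : SquareEquivalent g f := by
  obtain ⟨l, m, p, q, hl, hm, h⟩ := h
  exact ⟨m, l, q, p, hm, hl, fun j => ⟨(h j).2.1, (h j).1, (h j).2.2.symm⟩⟩

theorem pow_mul_inj {R : Type*} [CommRing R] [IsDomain R] {p a b : R} (hp : Prime p)
    (ha : ¬ p ∣ a) (hb : ¬ p ∣ b) {m n : ℕ} (h : p ^ m * a = p ^ n * b) : m = n ∧ a = b := by
  have key : ∀ (m n : ℕ) (a b : R), ¬ p ∣ a → p ^ m * a = p ^ n * b → n ≤ m := by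
    intro m n a b ha h
    by_contra! hlt
    obtain ⟨k, rfl⟩ := Nat.exists_eq_add_of_lt hlt
    apply ha
    refine ⟨p ^ k * b, mul_left_cancel₀ (pow_ne_zero m hp.ne_zero) ?_⟩
    rw [h]; ring
  have hmn : m = n := le_antisymm (key n m b a hb h.symm) (key m n a b ha h)
  subst hmn
  exact ⟨rfl, mul_left_cancel₀ (pow_ne_zero m hp.ne_zero) h⟩

theorem SquareEquivalent.localize {R : Type*} [CommRing R] [IsDomain R] [WfDvdMonoid R]
    {f g : Fin 3 → R} (h : SquareEquivalent f g) {p : R} (hp : Prime p) {n r : Fin 3 → ℕ}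
    {e w : Fin 3 → R} (he : ∀ j, ¬ p ∣ e j) (hw : ∀ j, ¬ p ∣ w j)
    (hf : ∀ j, f j = p ^ n j * e j) (hg : ∀ j, g j = p ^ r j * w j) :
    ∃ (L M : ℕ) (P Q : Fin 3 → ℕ) (l m : R) (u v : Fin 3 → R), ¬ p ∣ l ∧ ¬ p ∣ m ∧
      ∀ j, ¬ p ∣ u j ∧ ¬ p ∣ v j ∧ L + n j + 2 * P j = M + r j + 2 * Q j ∧
        l * e j * u j ^ 2 = m * w j * v j ^ 2 := by
  obtain ⟨l, m, s, t, hl, hm, h⟩ := h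
  have dec (a : R) (ha : a ≠ 0) : ∃ (k : ℕ) (b : R), a = p ^ k * b ∧ ¬ p ∣ b := by
    obtain ⟨b, hb⟩ :=
      (FiniteMultiplicity.of_not_isUnit hp.not_isUnit ha).exists_eq_pow_mul_and_not_dvd
    exact ⟨_, b, hb⟩
  obtain ⟨L, l', hl', hl''⟩ := dec l hl
  obtain ⟨M, m', hm', hm''⟩ := dec m hm
  choose P u hu using fun j => dec (s j) (h j).1
  choose Q v hv using fun j => dec (t j) (h j).2.1
  refine ⟨L, M, P, Q, l', m', u, v, hl'', hm'', fun j => ⟨(hu j).2, (hv j).2, ?_⟩⟩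
  have hj := (h j).2.2
  rw [(hu j).1, (hv j).1, hl', hm', hf, hg] at hj
  apply pow_mul_inj hp
  · exact hp.not_dvd_mul (hp.not_dvd_mul hl'' (he j))
      (fun h => (hu j).2 (hp.dvd_of_dvd_pow h))
  · exact hp.not_dvd_mul (hp.not_dvd_mul hm'' (hw j))
      (fun h => (hv j).2 (hp.dvd_of_dvd_pow h))
  · rw [pow_add, pow_add, pow_add, pow_add, pow_mul', pow_mul']
    linear_combination hj

variable {E : Type*} [Field E]

theorem exists_squarefree_squareEquivalent (f : Fin 3 → E[X]) (hf : ∀ j, f j ≠ 0) :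
    ∃ g : Fin 3 → E[X], (∀ j, g j ≠ 0) ∧ SquareEquivalent f g ∧ Squarefree (g 0 * g 1 * g 2) := by
  let S : Set (Fin 3 → E[X]) := {g | (∀ j, g j ≠ 0) ∧ SquareEquivalent f g}
  have hS : S.Nonempty := ⟨f, hf, 1, 1, 1, 1, by simp, by simp, by simp⟩
  let deg : (Fin 3 → E[X]) → ℕ := fun g => ∑ j, (g j).natDegree
  obtain ⟨g, ⟨hg0, hfg⟩, hmin⟩ := WellFounded.has_min (measure deg).wf S hS
  refine ⟨g, hg0, hfg, ?_⟩
  by_contra hsq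
  obtain ⟨l, m, p, q, hl, hm, h⟩ := hfg
  obtain ⟨π, hπ, hd⟩ : ∃ π : E[X], Prime π ∧ π * π ∣ g 0 * g 1 * g 2 := by
    simp only [Squarefree, not_forall] at hsq
    obtain ⟨x, hx, hu⟩ := hsq
    obtain ⟨π, hπ, hdvd⟩ := WfDvdMonoid.exists_irreducible_factor hu (by
      rintro rfl
      simp [hg0] at hx)
    exact ⟨π, hπ.prime, (mul_dvd_mul hdvd hdvd).trans hx⟩
  have hπd : 0 < π.natDegree := by
    rw [Nat.pos_iff_ne_zero]
    intro h0
    apply hπ.not_isUnit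
    rw [eq_C_of_natDegree_eq_zero h0]
    have : π.coeff 0 ≠ 0 := by
      intro hc
      apply hπ.ne_zero
      rw [eq_C_of_natDegree_eq_zero h0, hc, C_0]
    exact isUnit_C.2 (IsUnit.mk0 _ this)
  have split (a b : E[X]) (hab : π * π ∣ a * b) : π * π ∣ a ∨ π * π ∣ b ∨ (π ∣ a ∧ π ∣ b) := by
    by_cases ha : π ∣ a
    · by_cases hb : π ∣ b
      · exact Or.inr (Or.inr ⟨ha, hb⟩)
      · left
        have := (hπ.irreducible.coprime_iff_not_dvd).2 hb
        exact (this.mul_left this).dvd_of_dvd_mul_right hab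
    · right; left
      have := (hπ.irreducible.coprime_iff_not_dvd).2 ha
      exact (this.mul_left this).dvd_of_dvd_mul_left hab
  have step1 (j : Fin 3) : ¬ π * π ∣ g j := by
    rintro ⟨a, ha⟩
    have ha0 : a ≠ 0 := by rintro rfl; exact hg0 j (by simpa using ha)
    refine hmin (Function.update g j a) ⟨fun k => ?_, l, m, p,
      Function.update q j (π * q j), hl, hm, fun k => ⟨(h k).1, ?_, ?_⟩⟩ ?_
    · by_cases hk : k = j
      · subst hk; simpa using ha0
      · simpa [hk] using hg0 k
    · by_cases hk : k = j
      · subst hk; simpa [hπ.ne_zero] using (h k).2.1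
      · simpa [hk] using (h k).2.1
    · by_cases hk : k = j
      · subst hk
        simp only [Function.update_self]
        rw [(h k).2.2, ha]; ring
      · simpa [hk] using (h k).2.2
    · change deg _ < deg g
      apply Finset.sum_lt_sum
      · intro k _
        by_cases hk : k = j
        · subst hk
          simp only [Function.update_self]
          rw [ha, natDegree_mul (by simp [hπ.ne_zero]) ha0]; omega
        · simp [hk]
      · refine ⟨j, Finset.mem_univ _, ?_⟩
        simp only [Function.update_self]
        rw [ha, natDegree_mul (by simp [hπ.ne_zero]) ha0, natDegree_mul hπ.ne_zero hπ.ne_zero]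
        omega
  have step2 (j k : Fin 3) (hjk : j ≠ k) : ¬ (π ∣ g j ∧ π ∣ g k) := by
    rintro ⟨⟨a, ha⟩, ⟨b, hb⟩⟩
    have ha0 : a ≠ 0 := by rintro rfl; exact hg0 j (by simpa using ha)
    have hb0 : b ≠ 0 := by rintro rfl; exact hg0 k (by simpa using hb)
    refine hmin (fun i => if i = j then a else if i = k then b else π * g i) ⟨fun i => ?_, l * π, m,
      p, fun i => if i = j ∨ i = k then π * q i else q i, by simp [hl, hπ.ne_zero], hm,
      fun i => ⟨(h i).1, ?_, ?_⟩⟩ ?_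
    · dsimp only
      split_ifs <;> simp [*, hπ.ne_zero]
    · have := (h i).2.1
      dsimp only
      split_ifs <;> simp [*, hπ.ne_zero]
    · have hi := (h i).2.2
      dsimp only
      by_cases hij : i = j
      · subst hij
        simp only [true_or, if_true]
        rw [ha] at hi
        linear_combination π * hi
      · by_cases hik : i = k
        · subst hik
          simp only [or_true, hij, if_true, if_false]
          rw [hb] at hi
          linear_combination π * hi
        · simp only [hij, hik, or_false, if_false]
          linear_combination π * hi
    · change deg _ < deg g
      have da : (g j).natDegree = π.natDegree + a.natDegree := by
        rw [ha, natDegree_mul hπ.ne_zero ha0]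
      have db : (g k).natDegree = π.natDegree + b.natDegree := by
        rw [hb, natDegree_mul hπ.ne_zero hb0]
      have dm (i : Fin 3) : (π * g i).natDegree = π.natDegree + (g i).natDegree :=
        natDegree_mul hπ.ne_zero (hg0 i)
      simp only [deg, Fin.sum_univ_three]
      fin_cases j <;> fin_cases k <;> simp at hjk <;> simp at da db <;> simp [dm] <;> omega
  rcases split _ _ hd with h1 | h1 | ⟨h1, h2⟩
  · rcases split _ _ h1 with h1 | h1 | h1
    · exact step1 0 h1
    · exact step1 1 h1
    · exact step2 0 1 (by decide) h1
  · exact step1 2 h1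
  · rcases hπ.dvd_or_dvd h1 with h1 | h1
    · exact step2 0 2 (by decide) ⟨h1, h2⟩
    · exact step2 1 2 (by decide) ⟨h1, h2⟩

theorem exists_sq_add_of_squareEquivalent {i : E} (hi : i ^ 2 = -1) {f g : Fin 3 → E[X]}
    (hf : ∀ j, f j ≠ 0) (hg : ∀ j, g j ≠ 0) (hfg : SquareEquivalent f g)
    (hsq : Squarefree (g 0 * g 1 * g 2)) {z : Fin 4 → E[X]} (hz : z ≠ 0)
    (h : hptForm (f 0) (f 1) (f 2) z = 0) : ∃ b, g 0 ∣ b ^ 2 + g 1 * g 2 := by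
  refine exists_sq_add_of_squarefree _ (hg 0) (hsq.of_mul_left.of_mul_left) fun p hp hpg => ?_
  have dec (a : E[X]) (ha : a ≠ 0) : ∃ (k : ℕ) (b : E[X]), a = p ^ k * b ∧ ¬ p ∣ b := by
    obtain ⟨b, hb⟩ :=
      (FiniteMultiplicity.of_not_isUnit hp.not_isUnit ha).exists_eq_pow_mul_and_not_dvd
    exact ⟨_, b, hb⟩
  choose n e he using fun j => dec (f j) (hf j)
  obtain ⟨w, hw⟩ := hpg
  have d12 : ¬ p ∣ w * g 1 * g 2 := by
    rintro ⟨c, hc⟩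
    exact hp.not_isUnit (hsq p ⟨c, by rw [hw]; linear_combination p * hc⟩)
  have hw' : ¬ p ∣ w := fun hh => d12 ((hh.mul_right _).mul_right _)
  have hg1 : ¬ p ∣ g 1 := fun hh => d12 ((hh.mul_left _).mul_right _)
  have hg2 : ¬ p ∣ g 2 := fun hh => d12 (hh.mul_left _)
  obtain ⟨L, M, P, Q, l, m, u, v, hl, hm, H⟩ := hfg.localize hp (n := n) (e := e)
    (r := ![1, 0, 0]) (w := ![w, g 1, g 2]) (fun j => (he j).2)
    (by intro j; fin_cases j <;> assumption) (fun j => (he j).1)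
    (by intro j; fin_cases j <;> simp [hw])
  have H0 := (H 0).2.2.1
  have H1 := (H 1).2.2.1
  have H2 := (H 2).2.2.1
  simp at H0 H1 H2
  have hiC : (C i : E[X]) ^ 2 = -1 := by rw [← C_pow, hi]; simp
  obtain ⟨t, ht⟩ := exists_sq_add_of_hptForm hp hiC (he 0).2 (he 1).2 (he 2).2 hz
    (by rw [← (he 0).1, ← (he 1).1, ← (he 2).1]; exact h)
    (by rw [Nat.even_iff]; omega) (by rw [Nat.odd_iff]; omega)
  refine exists_sq_add_of_dvd hp (b := m * v 1 * v 2) (c := t * l * u 1 * u 2)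
    (hp.not_dvd_mul (hp.not_dvd_mul hm (H 1).2.1) (H 2).2.1) ?_
  have E1 := (H 1).2.2.2
  have E2 := (H 2).2.2.2
  simp at E1 E2
  have := ht.mul_right ((l * u 1 * u 2) ^ 2)
  convert this using 1
  linear_combination - (l * e 2 * u 2 ^ 2) * E1 - (m * g 1 * v 1 ^ 2) * E2

theorem SquareEquivalent.comp {R : Type*} [CommRing R] {f g : Fin 3 → R}
    (h : SquareEquivalent f g) (σ : Fin 3 → Fin 3) : SquareEquivalent (f ∘ σ) (g ∘ σ) := by
  obtain ⟨l, m, p, q, hl, hm, h⟩ := h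
  exact ⟨l, m, p ∘ σ, q ∘ σ, hl, hm, fun j => h (σ j)⟩

/-- A local-global principle: if the quadric with discriminant cover given by the
Hassett–Pirutka–Tschinkel form has a point over `E(u)`, then the diagonal form with the
coordinates as coefficients is isotropic, provided it is so at `u = 0` in the unramified case. -/
theorem isotropic3_of_hptForm {i : E} (hi : i ^ 2 = -1) (f : Fin 3 → E[X])
    (hf : ∀ j, f j ≠ 0) {z : Fin 4 → E[X]} (hz : z ≠ 0)
    (h : hptForm (f 0) (f 1) (f 2) z = 0)
    (h0 : ∀ k, (∀ j, (f j).coeff k ≠ 0 ∧ ∀ k' < k, (f j).coeff k' = 0) →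
      Isotropic3 ((f 0).coeff k) ((f 1).coeff k) ((f 2).coeff k)) :
    Isotropic3 (f 0) (f 1) (f 2) := by
  obtain ⟨g, hg, hfg, hsq⟩ := exists_squarefree_squareEquivalent f hf
  obtain ⟨b₀, hb₀⟩ := exists_sq_add_of_squareEquivalent hi hf hg hfg hsq hz h
  obtain ⟨b₁, hb₁⟩ := exists_sq_add_of_squareEquivalent (f := f ∘ ![1, 2, 0])
    (g := g ∘ ![1, 2, 0]) (z := ![z 0, z 2, z 3, z 1]) hi (fun j => hf _) (fun j => hg _)
    (hfg.comp _) (by convert hsq using 1; simp; ring)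
    (by
      intro hc; apply hz; funext j
      have h0 := congrFun hc 0
      have h1 := congrFun hc 1
      have h2 := congrFun hc 2
      have h3 := congrFun hc 3
      fin_cases j <;> assumption)
    (by rw [← h]; exact hptForm_rotate _ _ _ _)
  obtain ⟨b₂, hb₂⟩ := exists_sq_add_of_squareEquivalent (f := f ∘ ![2, 0, 1])
    (g := g ∘ ![2, 0, 1]) (z := ![z 0, z 3, z 1, z 2]) hi (fun j => hf _) (fun j => hg _)
    (hfg.comp _) (by convert hsq using 1; simp; ring)
    (by
      intro hc; apply hz; funext j
      have h0 := congrFun hc 0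
      have h1 := congrFun hc 1
      have h2 := congrFun hc 2
      have h3 := congrFun hc 3
      fin_cases j <;> assumption)
    (((hptForm_rotate (f 1) (f 2) (f 0) ![z 0, z 2, z 3, z 1]).trans
      (hptForm_rotate (f 0) (f 1) (f 2) z)).trans h)
  apply hfg.isotropic3
  have c₀₁ : IsCoprime (g 0) (g 1) := by
    have := hsq.of_mul_left
    exact (squarefree_mul_iff.1 this).1.isCoprime
  have c₀₁₂ : IsCoprime (g 0 * g 1) (g 2) := (squarefree_mul_iff.1 hsq).1.isCoprime
  refine isotropic3_polynomial (hg 0) (hg 1) (hg 2) c₀₁ c₀₁₂.of_mul_left_right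
    c₀₁₂.of_mul_left_left.symm hb₀ hb₁ hb₂ ?_ ?_
  · intro hX
    rw [pow_two] at hX
    exact prime_X.not_isUnit (hsq X hX)
  · intro hX
    have dec (a : E[X]) (ha : a ≠ 0) : ∃ (k : ℕ) (b : E[X]), a = X ^ k * b ∧ ¬ X ∣ b := by
      obtain ⟨b, hb⟩ :=
        (FiniteMultiplicity.of_not_isUnit prime_X.not_isUnit ha).exists_eq_pow_mul_and_not_dvd
      exact ⟨_, b, hb⟩
    choose n e he using fun j => dec (f j) (hf j)
    have hgX : ∀ j, ¬ X ∣ g j := by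
      intro j hj
      apply hX
      fin_cases j
      · exact (hj.mul_right _).mul_right _
      · exact (hj.mul_left _).mul_right _
      · exact hj.mul_left _
    obtain ⟨L, M, P, Q, l, m, u, v, hl, hm, H⟩ := hfg.localize prime_X (n := n) (e := e)
      (r := 0) (w := g) (fun j => (he j).2) hgX (fun j => (he j).1) (by simp)
    have H0 := (H 0).2.2.1
    have H1 := (H 1).2.2.1
    have H2 := (H 2).2.2.1
    simp at H0 H1 H2
    have hc := isotropic3_coeff_zero hi (he 0).2 (he 1).2 (he 2).2 hz
      (by rw [← (he 0).1, ← (he 1).1, ← (he 2).1]; exact h)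
      (by rw [Nat.even_iff]; omega) (by rw [Nat.even_iff]; omega) (by
        intro h01 h12
        have hn : ∀ j, n j = n 0 := by
          intro j; fin_cases j
          exacts [rfl, h01.symm, (h01.trans h12).symm]
        have hco : ∀ j, (f j).coeff (n 0) = (e j).coeff 0 := by
          intro j
          rw [(he j).1, hn j, coeff_X_pow_mul', if_pos le_rfl, Nat.sub_self]
        have := h0 (n 0) (fun j => ⟨by rw [hco]; exact fun hh => (he j).2 (X_dvd_iff.2 hh),
          fun k' hk' => by rw [(he j).1, hn j, coeff_X_pow_mul', if_neg (by omega)]⟩)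
        simpa only [hco] using this)
    have hequiv : SquareEquivalent (fun j => (g j).coeff 0) (fun j => (e j).coeff 0) := by
      refine ⟨m.coeff 0, l.coeff 0, fun j => (v j).coeff 0, fun j => (u j).coeff 0,
        fun hh => hm (X_dvd_iff.2 hh), fun hh => hl (X_dvd_iff.2 hh), fun j =>
        ⟨fun hh => (H j).2.1 (X_dvd_iff.2 hh), fun hh => (H j).1 (X_dvd_iff.2 hh), ?_⟩⟩
      have := congrArg (fun p => p.coeff 0) (H j).2.2.2
      simp only [mul_coeff_zero, pow_two] at this
      linear_combination - this
    exact hequiv.isotropic3 hc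

end

section

open Polynomial

theorem Isotropic3.of_natDegree {E : Type*} [Field E] {f₀ f₁ f₂ : E[X]} {k : ℕ}
    (d₀ : f₀.natDegree ≤ k) (d₁ : f₁.natDegree ≤ k) (d₂ : f₂.natDegree ≤ k)
    (h : Isotropic3 f₀ f₁ f₂) : Isotropic3 (f₀.coeff k) (f₁.coeff k) (f₂.coeff k) := by
  obtain ⟨x, y, z, hne, h⟩ := h
  let N := max x.natDegree (max y.natDegree z.natDegree)
  have hx : x.natDegree ≤ N := le_max_left _ _
  have hy : y.natDegree ≤ N := (le_max_left _ _).trans (le_max_right _ _)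
  have hz : z.natDegree ≤ N := (le_max_right _ _).trans (le_max_right _ _)
  refine ⟨x.coeff N, y.coeff N, z.coeff N, ?_, ?_⟩
  · by_contra! hc
    have key (p : E[X]) (hp : p.natDegree = N) (h0 : p.coeff N = 0) : N = 0 ∧ p = 0 := by
      have : p = 0 := by rw [← leadingCoeff_eq_zero, leadingCoeff, hp, h0]
      refine ⟨?_, this⟩
      rw [← hp, this, natDegree_zero]
    have hN : N = 0 := by
      rcases max_choice x.natDegree (max y.natDegree z.natDegree) with h1 | h1
      · exact (key x h1.symm hc.1).1
      · rcases max_choice y.natDegree z.natDegree with h2 | h2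
        · exact (key y (h2.symm.trans h1.symm) hc.2.1).1
        · exact (key z (h2.symm.trans h1.symm) hc.2.2).1
    rcases hne with hne | hne | hne
    · exact hne (key x (by omega) hc.1).2
    · exact hne (key y (by omega) hc.2.1).2
    · exact hne (key z (by omega) hc.2.2).2
  · have t (g w : E[X]) (hg : g.natDegree ≤ k) (hw : w.natDegree ≤ N) :
        (g * w ^ 2).coeff (k + 2 * N) = g.coeff k * w.coeff N ^ 2 := by
      rw [coeff_mul_add_eq_of_natDegree_le hg (natDegree_pow_le_of_le 2 hw),
        coeff_pow_of_natDegree_le hw]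
    have := congrArg (fun p => p.coeff (k + 2 * N)) h
    simpa only [coeff_add, t _ _ d₀ hx, t _ _ d₁ hy, t _ _ d₂ hz, coeff_zero] using this

/-- The point of `𝔸³ × 𝔸⁴` with given coordinates. -/
def biPoint {R : Type*} (x : Fin 3 → R) (z : Fin 4 → R) : Fin 7 → R :=
  ![x 0, x 1, x 2, z 0, z 1, z 2, z 3]

theorem comp_biPoint {R S : Type*} (g : R → S) (x : Fin 3 → R) (z : Fin 4 → R) :
    g ∘ biPoint x z = biPoint (g ∘ x) (g ∘ z) := by
  funext j; fin_cases j <;> rfl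

section Place

variable {L E : Type*} [Field L] [Field E] (W : ValuationSubring L) (ρ : W →+* E)

theorem exists_lift_polynomial {p : L[X]} (hp : ∀ k, W.valuation (p.coeff k) ≤ 1) :
    ∃ q : W[X], q.map W.subtype = p := by
  have : p ∈ Polynomial.lifts W.subtype := by
    rw [lifts_iff_coeff_lifts]
    intro k
    exact ⟨⟨p.coeff k, (W.valuation_le_one_iff _).1 (hp k)⟩, rfl⟩
  exact (mem_lifts p).1 this

variable {W ρ}

theorem ValuationSubring.map_ne_zero_iff_valuation (hρ : ∀ w : W, ρ w = 0 ↔ W.valuation w < 1)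
    (w : W) : ρ w ≠ 0 ↔ W.valuation w = 1 := by
  rw [Ne, hρ, not_lt]
  exact ⟨fun h => le_antisymm (W.valuation_le_one w) h, fun h => h.ge⟩

theorem exists_lift_family (hρ : ∀ w : W, ρ w = 0 ↔ W.valuation w < 1)
    {ι : Type*} [Finite ι] {z : ι → L[X]} (hz : z ≠ 0) :
    ∃ (b : L) (q : ι → W[X]), (∀ i, (q i).map W.subtype = C b * z i) ∧
      (fun i => (q i).map ρ) ≠ 0 := by
  have := Fintype.ofFinite ι
  let T : Finset ((_ : ι) × ℕ) := Finset.univ.sigma fun i => (z i).support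
  have hT : T.Nonempty := by
    obtain ⟨i, hi⟩ := Function.ne_iff.1 hz
    obtain ⟨k, hk⟩ := Polynomial.support_nonempty.2 hi
    exact ⟨⟨i, k⟩, by simpa [T] using hk⟩
  obtain ⟨⟨i, k⟩, hik, hmax⟩ :=
    Finset.exists_max_image T (fun t => W.valuation ((z t.1).coeff t.2)) hT
  have h0 : (z i).coeff k ≠ 0 := by simpa [T] using hik
  have hle : ∀ i' k', W.valuation ((C ((z i).coeff k)⁻¹ * z i').coeff k') ≤ 1 := by
    intro i' k'
    rw [coeff_C_mul, map_mul, map_inv₀]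
    by_cases hz' : (z i').coeff k' = 0
    · simp [hz']
    · have := hmax ⟨i', k'⟩ (by simpa [T] using hz')
      rw [inv_mul_le_iff₀ (by simpa [zero_lt_iff] using h0), mul_one]
      exact this
  choose q hq using fun i' => exists_lift_polynomial W (hle i')
  refine ⟨_, q, hq, fun hc => ?_⟩
  have h1 : ρ ((q i).coeff k) = 0 := by
    rw [← coeff_map]
    have := congrFun hc i
    simp only [Pi.zero_apply] at this
    rw [this, coeff_zero]
  rw [hρ] at h1
  have h2 : ((q i).coeff k : L) = 1 := by
    have := congrArg (fun p => p.coeff k) (hq i)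
    simpa [h0] using this
  rw [h2, map_one] at h1
  exact lt_irrefl _ h1

/-- Specialization of a polynomial identity along a place. -/
theorem eval₂_map_eq_zero {F : MvPolynomial (Fin 7) W} {y : Fin 7 → W[X]}
    (h : F.eval₂ (C.comp W.subtype) (fun i => (y i).map W.subtype) = 0) :
    F.eval₂ (C.comp ρ) (fun i => (y i).map ρ) = 0 := by
  have h1 : F.eval₂ C y = 0 := by
    apply Polynomial.map_injective W.subtype Subtype.val_injective
    rw [Polynomial.map_zero, ← h]
    change mapRingHom W.subtype _ = _
    rw [MvPolynomial.eval₂_comp_left]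
    congr 1
    ext; simp
  have h2 := congrArg (mapRingHom ρ) h1
  rw [MvPolynomial.eval₂_comp_left, map_zero] at h2
  rw [← h2]
  congr 1
  ext; simp

open Classical in
theorem isotropic3_path_aux (hρ : ∀ w : W, ρ w = 0 ↔ W.valuation w < 1)
    (hdiv : ∀ a : L, a ≠ 0 → ∀ m : ℕ, 0 < m → ∃ c, W.valuation c ^ m = W.valuation a)
    {i : E} (hi : i ^ 2 = -1) {d : ℕ} {F : MvPolynomial (Fin 7) W}
    (hF : ∀ (x : Fin 3 → E[X]) (z : Fin 4 → E[X]), F.eval₂ (C.comp ρ) (biPoint x z) =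
      (x 0 + x 1 + x 2) ^ d * hptForm (x 0) (x 1) (x 2) z)
    (hhom : ∀ (a b : L) (x : Fin 3 → L[X]) (z : Fin 4 → L[X]),
      F.eval₂ (C.comp W.subtype) (biPoint x z) = 0 →
      F.eval₂ (C.comp W.subtype) (biPoint (fun j => C a * x j) (fun j => C b * z j)) = 0)
    {x : Fin 3 → L[X]} {z : Fin 4 → L[X]} (hz : z ≠ 0)
    (h : F.eval₂ (C.comp W.subtype) (biPoint x z) = 0) (h0 : (x 0).coeff 0 ≠ 0)
    (h1 : (x 1).coeff 0 ≠ 0 → ∃ e, (x 0).coeff 0 + e ^ 2 * (x 1).coeff 0 = 0) (k : ℕ) :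
    ∀ (s c : L) (a : Fin 3 → W), (∀ j, (a j : L) = s * (x j).coeff k) → (∀ j, ρ (a j) ≠ 0) →
      c ≠ 0 → (∀ j, ∀ k' > k, W.valuation (s * (x j).coeff k' * c ^ (k' - k)) ≤ 1) →
      (∀ j, ∀ k' < k, W.valuation (s * (x j).coeff k') < W.valuation c ^ (k - k')) →
      Isotropic3 (ρ (a 0)) (ρ (a 1)) (ρ (a 2)) := by
  induction k using Nat.strong_induction_on with
  | _ k ih =>
  intro s c a ha haρ hc hgt hlt
  have hs : s ≠ 0 := by
    rintro rfl
    apply haρ 0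
    have : a 0 = 0 := Subtype.ext (by simp [ha 0])
    rw [this, map_zero]
  rcases Nat.eq_zero_or_pos k with rfl | hk
  · have hx1 : (x 1).coeff 0 ≠ 0 := by
      intro hx
      apply haρ 1
      have : a 1 = 0 := Subtype.ext (by simp [ha 1, hx])
      rw [this, map_zero]
    obtain ⟨e, he⟩ := h1 hx1
    have hae : (a 0 : L) + e ^ 2 * (a 1 : L) = 0 := by
      rw [ha, ha]; linear_combination s * he
    have hv : W.valuation e ≤ 1 := by
      have e1 := (ValuationSubring.map_ne_zero_iff_valuation hρ _).1 (haρ 0)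
      have e2 := (ValuationSubring.map_ne_zero_iff_valuation hρ _).1 (haρ 1)
      have e3 : W.valuation (e ^ 2 * (a 1 : L)) = 1 := by
        rw [show e ^ 2 * (a 1 : L) = - (a 0 : L) by linear_combination hae, Valuation.map_neg, e1]
      rw [map_mul, map_pow, e2, mul_one] at e3
      exact ((pow_eq_one_iff_of_nonneg zero_le two_ne_zero).1 e3).le
    let e' : W := ⟨e, (W.valuation_le_one_iff _).1 hv⟩
    have hae' : a 0 + e' ^ 2 * a 1 = 0 := Subtype.ext hae
    refine ⟨1, ρ e', 0, by simp, ?_⟩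
    have := congrArg ρ hae'
    simp only [map_add, map_mul, map_pow, map_zero] at this
    linear_combination this
  · let T : Finset (Fin 3 × ℕ) := {t ∈ Finset.univ ×ˢ Finset.range k | (x t.1).coeff t.2 ≠ 0}
    have hT : T.Nonempty := ⟨(0, 0), by simp [T, hk, h0]⟩
    have hr : ∀ t ∈ T, ∃ r, W.valuation r ^ (k - t.2) = W.valuation (s * (x t.1).coeff t.2) := by
      intro t ht
      simp only [T, Finset.mem_filter, Finset.mem_product, Finset.mem_range] at ht
      exact hdiv _ (mul_ne_zero hs ht.2) _ (by omega)
    choose! r hr using hr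
    obtain ⟨⟨j₀, k₀⟩, ht₀, hmax⟩ := Finset.exists_max_image T (fun t => W.valuation (r t)) hT
    have hr₀ := hr _ ht₀
    set c₁ := r (j₀, k₀) with hc₁
    have ht₀' : k₀ < k ∧ (x j₀).coeff k₀ ≠ 0 := by simpa [T] using ht₀
    dsimp only at hr₀ hmax
    have hc₁0 : c₁ ≠ 0 := by
      intro hh
      rw [hh, map_zero, zero_pow (by omega)] at hr₀
      exact mul_ne_zero hs ht₀'.2 ((map_eq_zero _).1 hr₀.symm)
    have hc₁p : 0 < W.valuation c₁ := by
      rw [zero_lt_iff]; exact (_root_.map_ne_zero _).2 hc₁0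
    have hcp : 0 < W.valuation c := by
      rw [zero_lt_iff]; exact (_root_.map_ne_zero _).2 hc
    have hlt₁ : W.valuation c₁ < W.valuation c := by
      have := hlt j₀ k₀ ht₀'.1
      rw [← hr₀] at this
      exact lt_of_pow_lt_pow_left₀ _ zero_le this
    have hle₁ : ∀ j, ∀ k' < k, W.valuation (s * (x j).coeff k') ≤ W.valuation c₁ ^ (k - k') := by
      intro j k' hk'
      by_cases hx : (x j).coeff k' = 0
      · simp [hx]
      · have hm : (j, k') ∈ T := by simp [T, hk', hx]
        rw [← hr _ hm]
        exact pow_le_pow_left₀ zero_le (hmax _ hm) _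
    have hgt₁ : ∀ j, ∀ k' > k, W.valuation (s * (x j).coeff k' * c₁ ^ (k' - k)) < 1 := by
      intro j k' hk'
      by_cases hx : (x j).coeff k' = 0
      · simp [hx]
      · refine lt_of_lt_of_le ?_ (hgt j k' hk')
        rw [map_mul, map_mul _ _ (c ^ _), map_pow, map_pow]
        refine mul_lt_mul_of_pos_left (pow_lt_pow_left₀ hlt₁ zero_le (by omega)) ?_
        rw [zero_lt_iff]; exact (_root_.map_ne_zero _).2 (mul_ne_zero hs hx)
    let φ : L[X] →+* L[X] := compRingHom (C c₁ * X)
    have hφ (p : L[X]) (n : ℕ) : (φ p).coeff n = p.coeff n * c₁ ^ n :=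
      comp_C_mul_X_coeff
    let s' := s / c₁ ^ k
    have hcoef (j : Fin 3) (n : ℕ) :
        (C s' * φ (x j)).coeff n = s * (x j).coeff n * c₁ ^ n / c₁ ^ k := by
      rw [coeff_C_mul, hφ]; ring
    have hcoef_lt (j : Fin 3) (n : ℕ) (hn : n < k) : W.valuation ((C s' * φ (x j)).coeff n) =
        W.valuation (s * (x j).coeff n) / W.valuation c₁ ^ (k - n) := by
      rw [hcoef, ← map_pow, ← map_div₀]
      congr 1
      rw [div_eq_div_iff (pow_ne_zero _ hc₁0) (pow_ne_zero _ hc₁0), mul_assoc, ← pow_add]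
      congr 3; omega
    have hcoef_gt (j : Fin 3) (n : ℕ) (hn : k < n) : (C s' * φ (x j)).coeff n =
        s * (x j).coeff n * c₁ ^ (n - k) := by
      rw [hcoef, div_eq_iff (pow_ne_zero _ hc₁0), mul_assoc (s * _), ← pow_add]
      congr 3; omega
    have hcoef_k (j : Fin 3) : (C s' * φ (x j)).coeff k = a j := by
      rw [hcoef, ha, mul_div_cancel_right₀ _ (pow_ne_zero _ hc₁0)]
    have hle : ∀ j n, W.valuation ((C s' * φ (x j)).coeff n) ≤ 1 := by
      intro j n
      rcases lt_trichotomy n k with hn | hn | hn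
      · rw [hcoef_lt j n hn]
        exact div_le_one_of_le₀ (hle₁ j n hn) zero_le
      · subst hn; rw [hcoef_k]; exact W.valuation_le_one _
      · rw [hcoef_gt j n hn]; exact (hgt₁ j n hn).le
    choose q hq using fun j => exists_lift_polynomial W (hle j)
    have hqc (j : Fin 3) (n : ℕ) : ((q j).coeff n : L) = (C s' * φ (x j)).coeff n := by
      rw [← hq, coeff_map]; rfl
    have hφz : (fun j => φ (z j)) ≠ 0 := by
      intro hh
      apply hz
      funext j
      ext n
      have := congrArg (fun p => p.coeff n) (congrFun hh j)
      simp only [hφ, Pi.zero_apply, coeff_zero] at this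
      simpa [hc₁0] using this
    obtain ⟨b, w, hw, hwne⟩ := exists_lift_family hρ hφz
    have hzero : F.eval₂ (C.comp ρ)
        (biPoint (fun j => (q j).map ρ) (fun j => (w j).map ρ)) = 0 := by
      have e1 : F.eval₂ (C.comp W.subtype) (biPoint (fun j => φ (x j)) (fun j => φ (z j))) = 0 := by
        have := congrArg φ h
        rw [MvPolynomial.eval₂_comp_left, map_zero, comp_biPoint] at this
        rw [← this]
        congr 1
        ext; simp [φ]
      have e2 := hhom s' b _ _ e1
      have e3 : F.eval₂ (C.comp W.subtype) (fun i => (biPoint q w i).map W.subtype) = 0 := by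
        rw [← e2]
        congr 1
        have := comp_biPoint (Polynomial.map W.subtype) q w
        refine this.trans ?_
        congr 1
        · funext j; exact hq j
        · funext j; exact hw j
      have e4 := eval₂_map_eq_zero (ρ := ρ) e3
      rw [← e4]
      congr 1
      exact (comp_biPoint (Polynomial.map ρ) q w).symm
    rw [hF] at hzero
    have hfk (j : Fin 3) : ((q j).map ρ).coeff k = ρ (a j) := by
      rw [coeff_map]
      congr 1
      apply Subtype.ext
      rw [hqc, hcoef_k]
    have hfdeg (j : Fin 3) : ((q j).map ρ).natDegree ≤ k := by
      rw [natDegree_le_iff_coeff_eq_zero]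
      intro n hn
      rw [coeff_map, hρ, hqc, hcoef_gt j n hn]
      exact hgt₁ j n hn
    have hf0 (j : Fin 3) : (q j).map ρ ≠ 0 := by
      intro hh
      apply haρ j
      rw [← hfk, hh, coeff_zero]
    rcases mul_eq_zero.1 hzero with hl | hh
    · replace hl := eq_zero_of_pow_eq_zero hl
      have := congrArg (fun p => p.coeff k) hl
      simp only [coeff_add, hfk, coeff_zero] at this
      exact ⟨1, 1, 1, by simp, by linear_combination this⟩
    · have hiso := isotropic3_of_hptForm hi (fun j => (q j).map ρ) hf0 hwne hh ?_
      · have := hiso.of_natDegree (hfdeg 0) (hfdeg 1) (hfdeg 2)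
        simpa only [hfk] using this
      intro k₁ hk₁
      have hk₁k : k₁ < k := by
        refine lt_of_le_of_lt ?_ ht₀'.1
        by_contra! hcon
        have := (hk₁ j₀).2 k₀ hcon
        rw [coeff_map, hρ, hqc, hcoef_lt j₀ k₀ ht₀'.1, ← hr₀,
          div_self (pow_ne_zero _ hc₁p.ne')] at this
        exact lt_irrefl _ this
      have := ih k₁ hk₁k (s' * c₁ ^ k₁) c₁ (fun j => (q j).coeff k₁)
        (fun j => by rw [hqc, coeff_C_mul, hφ]; ring)
        (fun j => by rw [← coeff_map]; exact (hk₁ j).1) hc₁0 ?_ ?_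
      · simpa only [coeff_map] using this
      · intro j k' hk'
        have := hle j k'
        rw [coeff_C_mul, hφ] at this
        convert this using 2
        rw [show k' = k₁ + (k' - k₁) by omega, pow_add, Nat.add_sub_cancel_left]; ring
      · intro j k' hk'
        have h2 := (hk₁ j).2 k' hk'
        rw [coeff_map, hρ, hqc, coeff_C_mul, hφ] at h2
        have e : s' * c₁ ^ k₁ * (x j).coeff k' =
            s' * ((x j).coeff k' * c₁ ^ k') * c₁ ^ (k₁ - k') := by
          rw [show k₁ = k' + (k₁ - k') by omega, pow_add, Nat.add_sub_cancel_left]; ring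
        rw [e, map_mul, map_pow]
        exact mul_lt_of_lt_one_left (pow_pos hc₁p _) h2

/-- If the quadric bundle given by `F`, which specializes to a power of a linear form times the
Hassett–Pirutka–Tschinkel form, has a section along a polynomial path of degree `D`, then the
diagonal form given by the specialized endpoint at infinity is isotropic. -/
theorem isotropic3_path (hρ : ∀ w : W, ρ w = 0 ↔ W.valuation w < 1)
    (hdiv : ∀ a : L, a ≠ 0 → ∀ m : ℕ, 0 < m → ∃ c, W.valuation c ^ m = W.valuation a)
    {ϖ : L} (hϖ0 : ϖ ≠ 0) (hϖ : W.valuation ϖ < 1)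
    {i : E} (hi : i ^ 2 = -1) {d : ℕ} {F : MvPolynomial (Fin 7) W}
    (hF : ∀ (x : Fin 3 → E[X]) (z : Fin 4 → E[X]), F.eval₂ (C.comp ρ) (biPoint x z) =
      (x 0 + x 1 + x 2) ^ d * hptForm (x 0) (x 1) (x 2) z)
    (hhom : ∀ (a b : L) (x : Fin 3 → L[X]) (z : Fin 4 → L[X]),
      F.eval₂ (C.comp W.subtype) (biPoint x z) = 0 →
      F.eval₂ (C.comp W.subtype) (biPoint (fun j => C a * x j) (fun j => C b * z j)) = 0)
    {x : Fin 3 → L[X]} {z : Fin 4 → L[X]} (hz : z ≠ 0)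
    (h : F.eval₂ (C.comp W.subtype) (biPoint x z) = 0) (h0 : (x 0).coeff 0 ≠ 0)
    (h1 : (x 1).coeff 0 ≠ 0 → ∃ e, (x 0).coeff 0 + e ^ 2 * (x 1).coeff 0 = 0)
    {D : ℕ} (hD : ∀ j, (x j).natDegree ≤ D) (s : L) (a : Fin 3 → W)
    (ha : ∀ j, (a j : L) = s * (x j).coeff D) (haρ : ∀ j, ρ (a j) ≠ 0) :
    Isotropic3 (ρ (a 0)) (ρ (a 1)) (ρ (a 2)) := by
  classical
  obtain ⟨M, hM⟩ := Finset.exists_le (insert 1 ((Finset.univ ×ˢ Finset.range D).image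
    fun t : Fin 3 × ℕ => W.valuation (s * (x t.1).coeff t.2)))
  obtain ⟨m, rfl⟩ := W.valuation_surjective M
  have hm1 : 1 ≤ W.valuation m := hM 1 (by simp)
  have hm : ∀ j, ∀ k < D, W.valuation (s * (x j).coeff k) ≤ W.valuation m := fun j k hk =>
    hM _ (Finset.mem_insert_of_mem (Finset.mem_image.2 ⟨(j, k), by simp [hk], rfl⟩))
  have hvϖ : 0 < W.valuation ϖ := by rw [zero_lt_iff]; exact (_root_.map_ne_zero _).2 hϖ0
  have hc : W.valuation m < W.valuation (m / ϖ) := by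
    rw [map_div₀, lt_div_iff₀ hvϖ]
    exact mul_lt_of_lt_one_right (zero_lt_one.trans_le hm1) hϖ
  refine isotropic3_path_aux hρ hdiv hi hF hhom hz h h0 h1 D s (m / ϖ) a ha haρ ?_ ?_ ?_
  · intro hh
    rw [hh, map_zero] at hc
    exact not_lt_zero hc
  · intro j k' hk'
    rw [coeff_eq_zero_of_natDegree_lt ((hD j).trans_lt hk')]
    simp
  · intro j k' hk'
    refine (hm j k' hk').trans_lt (hc.trans_le ?_)
    exact le_self_pow₀ (hm1.trans hc.le) (by omega)

end Place

end

section

open Polynomial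

/-- The diagonal quadratic form with coefficients `a` has no nontrivial zero. -/
def AnisotropicDiag {R ι : Type*} [CommRing R] [Fintype ι] (a : ι → R) : Prop :=
  ∀ v : ι → R, ∑ i, a i * v i ^ 2 = 0 → v = 0

section Anisotropic

variable {K ι : Type*} [Field K] [Fintype ι] {a : ι → K}

theorem AnisotropicDiag.natDegree_eq (ha : AnisotropicDiag a) {v : ι → K[X]} (hv : v ≠ 0) :
    ∃ N, (∀ i, (v i).natDegree ≤ N) ∧ (∑ i, C (a i) * v i ^ 2).natDegree = 2 * N ∧
      ∑ i, C (a i) * v i ^ 2 ≠ 0 := by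
  classical
  obtain ⟨i₀, hi₀⟩ := Function.ne_iff.1 hv
  have hne : (Finset.univ.filter fun i => v i ≠ 0).Nonempty := ⟨i₀, by simpa using hi₀⟩
  obtain ⟨i₁, hi₁, hmax⟩ := Finset.exists_max_image _ (fun i => (v i).natDegree) hne
  simp only [Finset.mem_filter, Finset.mem_univ, true_and] at hi₁ hmax
  have hle : ∀ i, (v i).natDegree ≤ (v i₁).natDegree := by
    intro i
    by_cases hi : v i = 0
    · simp [hi]
    · exact hmax i hi
  have hc : (∑ i, C (a i) * v i ^ 2).coeff (2 * (v i₁).natDegree) ≠ 0 := by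
    rw [finsetSum_coeff]
    have : ∀ i, (C (a i) * v i ^ 2).coeff (2 * (v i₁).natDegree) =
        a i * (v i).coeff (v i₁).natDegree ^ 2 := by
      intro i
      rw [coeff_C_mul, coeff_pow_of_natDegree_le (hle i)]
    simp only [this]
    intro h
    have := congrFun (ha _ h) i₁
    simp only [coeff_natDegree, Pi.zero_apply, leadingCoeff_eq_zero] at this
    exact hi₁ this
  refine ⟨_, hle, le_antisymm ?_ (le_natDegree_of_ne_zero hc), fun h => hc (by rw [h, coeff_zero])⟩
  apply natDegree_sum_le_of_forall_le
  intro i _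
  exact (natDegree_C_mul_le _ _).trans (natDegree_pow_le_of_le 2 (hle i))

theorem AnisotropicDiag.polynomial (ha : AnisotropicDiag a) :
    AnisotropicDiag (fun i => (C (a i) : K[X])) := by
  intro v hv
  by_contra hne
  obtain ⟨N, -, -, h⟩ := ha.natDegree_eq hne
  exact h hv

theorem AnisotropicDiag.fractionRing {R : Type*} [CommRing R] [IsDomain R] {a : ι → R}
    (ha : AnisotropicDiag a) : AnisotropicDiag (fun i => algebraMap R (FractionRing R) (a i)) := by
  intro v hv
  obtain ⟨b, hb⟩ := IsLocalization.exist_integer_multiples_of_finite (nonZeroDivisors R) v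
  choose w hw using hb
  have hb0 : algebraMap R (FractionRing R) b ≠ 0 :=
    IsFractionRing.to_map_ne_zero_of_mem_nonZeroDivisors b.2
  have : w = 0 := by
    apply ha
    apply IsFractionRing.injective R (FractionRing R)
    rw [map_sum, map_zero]
    have : (algebraMap R (FractionRing R) b) ^ 2 *
      ∑ i, algebraMap R (FractionRing R) (a i) * v i ^ 2 = 0 := by rw [hv, mul_zero]
    rw [← this, Finset.mul_sum]
    refine Finset.sum_congr rfl fun i _ => ?_
    rw [map_mul, map_pow, hw, Algebra.smul_def]
    change _ * (algebraMap R (FractionRing R) b * v i) ^ 2 = _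
    ring
  funext i
  have hi := hw i
  rw [this, Algebra.smul_def] at hi
  simp only [Pi.zero_apply, map_zero] at hi
  exact (mul_eq_zero.1 hi.symm).resolve_left hb0

/-- The constant embedding `K → K(t)`. -/
def fracC (K : Type*) [Field K] : K →+* FractionRing K[X] :=
  (algebraMap K[X] (FractionRing K[X])).comp C

/-- The indeterminate of `K(t)`. -/
def fracX (K : Type*) [Field K] : FractionRing K[X] := algebraMap K[X] (FractionRing K[X]) X

theorem AnisotropicDiag.fracC (ha : AnisotropicDiag a) :
    AnisotropicDiag (fun i => fracC K (a i)) :=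
  ha.polynomial.fractionRing

theorem AnisotropicDiag.sum_X {ι' : Type*} [Fintype ι'] {b : ι' → K} (ha : AnisotropicDiag a)
    (hb : AnisotropicDiag b) :
    AnisotropicDiag (Sum.elim (fun i => _root_.fracC K (a i))
      (fun i => fracX K * _root_.fracC K (b i))) := by
  have key : AnisotropicDiag (Sum.elim (fun i => (C (a i) : K[X])) (fun i => X * C (b i))) := by
    intro v hv
    rw [Fintype.sum_sum_type] at hv
    simp only [Sum.elim_inl, Sum.elim_inr, mul_assoc X] at hv
    rw [← Finset.mul_sum] at hv
    have h1 : (fun i => v (Sum.inl i)) = 0 ∧ (fun i => v (Sum.inr i)) = 0 := by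
      by_cases h1 : (fun i => v (Sum.inl i)) = 0
      · refine ⟨h1, hb.polynomial _ ?_⟩
        have : ∀ i, v (Sum.inl i) = 0 := fun i => congrFun h1 i
        simp only [this] at hv
        simpa using hv
      · obtain ⟨N, -, hN, hN0⟩ := ha.natDegree_eq h1
        by_cases h2 : (fun i => v (Sum.inr i)) = 0
        · have : ∀ i, v (Sum.inr i) = 0 := fun i => congrFun h2 i
          simp only [this] at hv
          exact absurd (by simpa using hv) hN0
        · obtain ⟨M, -, hM, hM0⟩ := hb.natDegree_eq h2
          have := congrArg natDegree (eq_neg_of_add_eq_zero_left hv)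
          rw [natDegree_neg, natDegree_X_mul hM0, hN, hM] at this
          omega
    funext i
    rcases i with i | i
    · exact congrFun h1.1 i
    · exact congrFun h1.2 i
  convert key.fractionRing using 2 with i
  rcases i with i | i
  · simp [_root_.fracC]
  · simp [_root_.fracC, fracX]
    ring

theorem cassels_descent (ha : AnisotropicDiag a) {p : K[X]} (n : ℕ) :
    ∀ (D : K[X]) (x : ι → K[X]), D ≠ 0 → D.natDegree ≤ n →
      p * D ^ 2 = ∑ i, C (a i) * x i ^ 2 → ∃ y : ι → K[X], p = ∑ i, C (a i) * y i ^ 2 := by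
  induction n with
  | zero =>
    intro D x hD hn h
    obtain ⟨c, rfl⟩ : ∃ c, D = C c := ⟨_, eq_C_of_natDegree_le_zero hn⟩
    have hc : c ≠ 0 := by simpa using hD
    refine ⟨fun i => C c⁻¹ * x i, ?_⟩
    have hcc : C c * C c⁻¹ = (1 : K[X]) := by rw [← C_mul, mul_inv_cancel₀ hc, C_1]
    calc p = p * C c ^ 2 * C c⁻¹ ^ 2 := by
          linear_combination - p * (1 + C c * C c⁻¹) * hcc
      _ = _ := by
        rw [h, Finset.sum_mul]
        exact Finset.sum_congr rfl fun i _ => by ring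
  | succ n ih =>
    intro D x hD hn h
    let y : ι → K[X] := fun i => x i / D
    let r : ι → K[X] := fun i => x i % D
    have hxr : ∀ i, x i = D * y i + r i := fun i => (EuclideanDomain.div_add_mod _ _).symm
    by_cases hr : r = 0
    · refine ⟨y, mul_right_cancel₀ (pow_ne_zero 2 hD) ?_⟩
      rw [h, Finset.sum_mul]
      refine Finset.sum_congr rfl fun i _ => ?_
      rw [hxr i, hr]; simp; ring
    by_cases hD0 : D.natDegree = 0
    · exact absurd (funext fun i => by
        change x i % D = 0
        rw [EuclideanDomain.mod_eq_zero]
        rw [eq_C_of_natDegree_eq_zero hD0] at hD ⊢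
        exact (isUnit_C.2 (IsUnit.mk0 _ (by simpa using hD))).dvd) hr
    obtain ⟨N, -, hN, hN0⟩ := ha.natDegree_eq hr
    have hqr : (∑ i, C (a i) * r i ^ 2).natDegree ≤ 2 * n := by
      apply natDegree_sum_le_of_forall_le
      intro i _
      refine (natDegree_C_mul_le _ _).trans (natDegree_pow_le_of_le 2 ?_)
      have : (r i).natDegree < D.natDegree := natDegree_mod_lt _ hD0
      omega
    set q := ∑ i, C (a i) * y i ^ 2 with hq
    set b := ∑ i, C (a i) * x i * y i with hb
    set D' := p * D - 2 * b + D * q with hD'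
    have hqD : ∑ i, C (a i) * r i ^ 2 = D * D' := by
      have e1 : D * D' = p * D ^ 2 - 2 * D * b + D ^ 2 * q := by rw [hD']; ring
      rw [e1, h, hq, hb, Finset.mul_sum, Finset.mul_sum, ← Finset.sum_sub_distrib,
        ← Finset.sum_add_distrib]
      refine Finset.sum_congr rfl fun i _ => ?_
      rw [show r i = x i - D * y i by rw [hxr i]; ring]
      ring
    have hD'0 : D' ≠ 0 := by
      intro h0; rw [h0, mul_zero] at hqD; exact hN0 hqD
    refine ih D' (fun i => (q - p) * x i - 2 * (b - p * D) * y i) hD'0 ?_ ?_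
    · rw [hqD, natDegree_mul hD hD'0] at hqr
      by_contra! hcon
      have h1 : (∑ i, C (a i) * r i ^ 2).natDegree < 2 * D.natDegree := by
        rw [hN]
        have : (∑ i, C (a i) * r i ^ 2).natDegree ≤ 2 * (D.natDegree - 1) := by
          apply natDegree_sum_le_of_forall_le
          intro i _
          refine (natDegree_C_mul_le _ _).trans (natDegree_pow_le_of_le 2 ?_)
          have : (r i).natDegree < D.natDegree := natDegree_mod_lt _ hD0
          omega
        omega
      rw [hqD, natDegree_mul hD hD'0] at h1
      omega
    · have e : ∑ i, C (a i) * ((q - p) * x i - 2 * (b - p * D) * y i) ^ 2 =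
          (q - p) ^ 2 * (p * D ^ 2) - 4 * (q - p) * (b - p * D) * b
            + 4 * (b - p * D) ^ 2 * q := by
        rw [h]
        simp only [hb, hq, Finset.mul_sum, ← Finset.sum_sub_distrib, ← Finset.sum_add_distrib]
        refine Finset.sum_congr rfl fun i _ => ?_
        ring
      rw [e, hD']
      ring

/-- Cassels' theorem for polynomials of degree at most two. -/
theorem cassels_quadratic (ha : AnisotropicDiag a) {p₀ p₁ p₂ : K}
    {V : ι → FractionRing K[X]}
    (h : fracC K p₂ * fracX K ^ 2 + fracC K p₁ * fracX K + fracC K p₀ =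
      ∑ i, fracC K (a i) * V i ^ 2) :
    ∃ u v : ι → K, ∑ i, a i * v i ^ 2 = p₂ ∧ 2 * ∑ i, a i * u i * v i = p₁ ∧
      ∑ i, a i * u i ^ 2 = p₀ := by
  obtain ⟨b, hb⟩ := IsLocalization.exist_integer_multiples_of_finite (nonZeroDivisors K[X]) V
  choose w hw using hb
  have key : (C p₂ * X ^ 2 + C p₁ * X + C p₀) * (b : K[X]) ^ 2 = ∑ i, C (a i) * w i ^ 2 := by
    apply IsFractionRing.injective K[X] (FractionRing K[X])
    have : (algebraMap K[X] (FractionRing K[X]) b) ^ 2 *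
        (fracC K p₂ * fracX K ^ 2 + fracC K p₁ * fracX K + fracC K p₀) =
        (algebraMap K[X] (FractionRing K[X]) b) ^ 2 * ∑ i, fracC K (a i) * V i ^ 2 := by rw [h]
    rw [Finset.mul_sum] at this
    simp only [map_mul, map_sum, map_add, map_pow, hw, Algebra.smul_def]
    refine Eq.trans ?_ (this.trans ?_)
    · simp only [fracC, fracX, RingHom.comp_apply]; ring
    · refine Finset.sum_congr rfl fun i _ => ?_
      simp only [fracC, RingHom.comp_apply]
      change _ = _ * (algebraMap K[X] (FractionRing K[X]) b * V i) ^ 2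
      ring
  obtain ⟨y, hy⟩ := cassels_descent ha _ _ w (nonZeroDivisors.ne_zero b.2) le_rfl key
  have hdeg : ∀ i, (y i).natDegree ≤ 1 := by
    by_cases hy0 : y = 0
    · simp [hy0]
    obtain ⟨N, hN, hN', -⟩ := ha.natDegree_eq hy0
    rw [← hy] at hN'
    have : (C p₂ * X ^ 2 + C p₁ * X + C p₀).natDegree ≤ 2 := natDegree_quadratic_le
    intro i
    have := hN i
    omega
  have hlin : ∀ i, y i = C ((y i).coeff 1) * X + C ((y i).coeff 0) := fun i =>
    eq_X_add_C_of_natDegree_le_one (hdeg i)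
  refine ⟨fun i => (y i).coeff 0, fun i => (y i).coeff 1, ?_⟩
  have hexp : ∑ i, C (a i) * y i ^ 2 = C (∑ i, a i * (y i).coeff 1 ^ 2) * X ^ 2 +
      C (2 * ∑ i, a i * (y i).coeff 0 * (y i).coeff 1) * X + C (∑ i, a i * (y i).coeff 0 ^ 2) := by
    simp only [map_sum, map_mul, map_pow, Finset.sum_mul, Finset.mul_sum,
      ← Finset.sum_add_distrib]
    refine Finset.sum_congr rfl fun i _ => ?_
    conv_lhs => rw [hlin i]
    rw [show (C 2 : K[X]) = 2 from rfl]
    ring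
  rw [hexp] at hy
  beta_reduce
  generalize ∑ i, a i * (y i).coeff 1 ^ 2 = q₂ at hy ⊢
  generalize 2 * ∑ i, a i * (y i).coeff 0 * (y i).coeff 1 = q₁ at hy ⊢
  generalize ∑ i, a i * (y i).coeff 0 ^ 2 = q₀ at hy ⊢
  have c0 := congrArg (fun p => p.coeff 0) hy
  have c1 := congrArg (fun p => p.coeff 1) hy
  have c2 := congrArg (fun p => p.coeff 2) hy
  simp [coeff_X, coeff_C, coeff_X_pow] at c0 c1 c2
  exact ⟨c2.symm, c1.symm, c0.symm⟩

end Anisotropic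

end

section

open Polynomial

section Descent

variable {K : Type*} [Field K]

theorem anisotropicDiag_one : AnisotropicDiag (![1] : Fin 1 → K) := by
  intro v hv
  funext i
  fin_cases i
  simpa using hv

theorem not_square_discriminant (h2 : (2 : K) ≠ 0) {x : K} (hx : x ≠ 0)
    (s : FractionRing K[X]) :
    fracX K ^ 2 - 2 * (fracC K x + 1) * fracX K + (fracC K x - 1) ^ 2 ≠ s ^ 2 := by
  intro h
  obtain ⟨u, v, hp2, hp1, hp0⟩ := cassels_quadratic (K := K) anisotropicDiag_one
    (p₂ := 1) (p₁ := -2 * (x + 1)) (p₀ := (x - 1) ^ 2) (V := ![s]) (by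
      simp only [Fin.sum_univ_one, Matrix.cons_val_zero, map_one, map_mul, map_neg, map_ofNat,
        map_add, map_pow, map_sub]
      linear_combination h)
  simp only [Fin.sum_univ_one, Matrix.cons_val_zero] at hp2 hp1 hp0
  have h4 : (2 * 2 * (2 * 2)) * x = 0 := by
    linear_combination - (2 * u 0 * v 0 + (-2 * (x + 1))) * hp1 + 4 * u 0 ^ 2 * hp2 + 4 * hp0
  simp [h2, hx] at h4

theorem exists_square_of_conic (h2 : (2 : K) ≠ 0) {x F : K}
    (ha : AnisotropicDiag ![1, x]) (hx : x ≠ 0) {v w : FractionRing K[X]}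
    (h : fracC K x * fracX K ^ 2 + fracC K F = v ^ 2 + fracC K x * w ^ 2) :
    ∃ s, F = s ^ 2 := by
  obtain ⟨u, v, hp2, hp1, hp0⟩ := cassels_quadratic ha
    (p₂ := x) (p₁ := 0) (p₀ := F) (V := ![v, w]) (by
      simp only [Fin.sum_univ_two, Matrix.cons_val_zero, Matrix.cons_val_one, map_one, map_zero]
      linear_combination h)
  simp only [Fin.sum_univ_two, Matrix.cons_val_zero, Matrix.cons_val_one] at hp2 hp1 hp0
  replace hp1 := (mul_eq_zero.1 hp1).resolve_left h2
  refine ⟨u 0 * v 1 - u 1 * v 0, mul_left_cancel₀ hx ?_⟩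
  linear_combination (-(u 0) ^ 2 - x * u 1 ^ 2) * hp2 - x * hp0 +
    (u 0 * v 0 + x * u 1 * v 1) * hp1

theorem exists_of_pure_quaternion (h2 : (2 : K) ≠ 0) {x y c : K}
    (ha : AnisotropicDiag ![x, y, x * y]) {V : Fin 3 → FractionRing K[X]}
    (h : fracC K x * fracX K ^ 2 - fracC K c = fracC K x * V 0 ^ 2 + fracC K y * V 1 ^ 2 +
      fracC K (x * y) * V 2 ^ 2) :
    ∃ s t, -c = y * s ^ 2 + x * y * t ^ 2 := by
  obtain ⟨u, v, hp2, hp1, hp0⟩ := cassels_quadratic ha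
    (p₂ := x) (p₁ := 0) (p₀ := -c) (V := V) (by
      simp only [Fin.sum_univ_three, Matrix.cons_val_zero, Matrix.cons_val_one, Matrix.cons_val,
        map_zero, map_neg]
      linear_combination h)
  have hx : x ≠ 0 := by
    rintro rfl
    have := congrFun (ha ![1, 0, 0] (by simp [Fin.sum_univ_three])) 0
    simp at this
  simp only [Fin.sum_univ_three, Matrix.cons_val_zero, Matrix.cons_val_one, Matrix.cons_val]
    at hp2 hp1 hp0
  replace hp1 := (mul_eq_zero.1 hp1).resolve_left h2
  by_cases hv : v 0 = 1
  · have := ha ![0, v 1, v 2] (by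
      simp only [Fin.sum_univ_three, Matrix.cons_val_zero, Matrix.cons_val_one, Matrix.cons_val]
      rw [hv] at hp2
      linear_combination hp2)
    have h1 : v 1 = 0 := by simpa using congrFun this 1
    have h3 : v 2 = 0 := by simpa using congrFun this 2
    rw [h1, h3, hv] at hp1
    have hu : u 0 = 0 := by simpa [hx] using hp1
    rw [hu] at hp0
    exact ⟨u 1, u 2, by linear_combination - hp0⟩
  · have hv' : 1 - v 0 ≠ 0 := sub_ne_zero.2 (Ne.symm hv)
    obtain ⟨k, hk⟩ : ∃ k, k * (1 - v 0) = u 0 := ⟨u 0 / (1 - v 0), div_mul_cancel₀ _ hv'⟩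
    refine ⟨u 1 + k * v 1, u 2 + k * v 2, ?_⟩
    rw [← hk] at hp1 hp0
    linear_combination - hp0 - 2 * k * hp1 - k ^ 2 * hp2

theorem represents_of_isotropic_quadratic_ext {x y δ : K} (ha : AnisotropicDiag ![1, x, y])
    {v w : Fin 3 → K} (hvw : v ≠ 0 ∨ w ≠ 0)
    (h1 : v 0 ^ 2 + x * v 1 ^ 2 + y * v 2 ^ 2 + δ * (w 0 ^ 2 + x * w 1 ^ 2 + y * w 2 ^ 2) = 0)
    (h2 : v 0 * w 0 + x * v 1 * w 1 + y * v 2 * w 2 = 0) :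
    ∃ V : Fin 3 → K, x * V 0 ^ 2 + y * V 1 ^ 2 + x * y * V 2 ^ 2 = -δ := by
  have hq : ∀ u : Fin 3 → K, u 0 ^ 2 + x * u 1 ^ 2 + y * u 2 ^ 2 = 0 → u = 0 := by
    intro u hu
    apply ha
    simp only [Fin.sum_univ_three, Matrix.cons_val_zero, Matrix.cons_val_one, Matrix.cons_val]
    linear_combination hu
  have hw : w ≠ 0 := by
    rintro rfl
    refine hvw.elim (fun hv => hv (hq v ?_)) (fun h => h rfl)
    simpa using h1
  set q := w 0 ^ 2 + x * w 1 ^ 2 + y * w 2 ^ 2 with hqdef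
  have hq0 : q ≠ 0 := fun h => hw (hq w h)
  refine ⟨![(v 0 * w 1 - v 1 * w 0) / q, (v 0 * w 2 - v 2 * w 0) / q,
    (v 1 * w 2 - v 2 * w 1) / q], ?_⟩
  simp only [Matrix.cons_val_zero, Matrix.cons_val_one, Matrix.cons_val]
  field_simp
  linear_combination q * h1 - (v 0 * w 0 + x * v 1 * w 1 + y * v 2 * w 2) * h2 -
    (v 0 ^ 2 + x * v 1 ^ 2 + y * v 2 ^ 2) * hqdef

theorem not_square_linear {x c : K} (ha : AnisotropicDiag ![1, x]) (s : FractionRing K[X]) :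
    fracC K c - fracC K x * fracX K ^ 2 ≠ s ^ 2 := by
  intro h
  obtain ⟨u, v, hp2, hp1, hp0⟩ := cassels_quadratic (K := K) anisotropicDiag_one
    (p₂ := -x) (p₁ := 0) (p₀ := c) (V := ![s]) (by
      simp only [Fin.sum_univ_one, Matrix.cons_val_zero, map_one, map_neg, map_zero]
      linear_combination h)
  simp only [Fin.sum_univ_one, Matrix.cons_val_zero] at hp2 hp1 hp0
  have := congrFun (ha ![v 0, 1] (by
    simp only [Fin.sum_univ_two, Matrix.cons_val_zero, Matrix.cons_val_one]
    linear_combination hp2)) 1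
  simp at this

end Descent

theorem map_hptConic {R S : Type*} [CommRing R] [CommRing S] (f : R →+* S) (a b c : R) :
    f (hptConic a b c) = hptConic (f a) (f b) (f c) := by
  have h2 : f 2 = 2 := map_ofNat f 2
  simp [hptConic, h2]

section Tower

variable (k : Type*) [Field k]

theorem anisotropicDiag_one_X : AnisotropicDiag ![1, fracX k] := by
  intro v hv
  have := AnisotropicDiag.sum_X (K := k) anisotropicDiag_one anisotropicDiag_one
    (Sum.elim ![v 0] ![v 1]) (by simpa [Fin.sum_univ_two] using hv)
  funext i
  fin_cases i
  · exact congrFun this (Sum.inl 0)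
  · exact congrFun this (Sum.inr 0)

variable {k} in
theorem anisotropicDiag_one_x_X {x : k} (ha : AnisotropicDiag ![1, x]) :
    AnisotropicDiag ![1, fracC k x, fracX k] := by
  intro v hv
  have := AnisotropicDiag.sum_X (K := k) ha anisotropicDiag_one
    (Sum.elim ![v 0, v 1] ![v 2]) (by
      simpa [Fin.sum_univ_two, Fin.sum_univ_three] using hv)
  funext i
  fin_cases i
  · exact congrFun this (Sum.inl 0)
  · exact congrFun this (Sum.inl 1)
  · exact congrFun this (Sum.inr 0)

variable {k} in
theorem anisotropicDiag_x_X_mul {x : k} (ha : AnisotropicDiag ![1, x]) (hx : x ≠ 0) :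
    AnisotropicDiag ![fracC k x, fracX k, fracC k x * fracX k] := by
  have hb : AnisotropicDiag ![x] := by
    intro v hv
    funext i
    fin_cases i
    simpa [hx] using hv
  intro v hv
  have := AnisotropicDiag.sum_X (K := k) hb ha
    (Sum.elim ![v 0] ![v 1, v 2]) (by
      simp [Fin.sum_univ_two, Fin.sum_univ_three] at hv ⊢
      linear_combination hv)
  funext i
  fin_cases i
  · exact congrFun this (Sum.inl 0)
  · exact congrFun this (Sum.inr 0)
  · exact congrFun this (Sum.inr 1)

variable {k} in
theorem AnisotropicDiag.fracC_two {x y : k} (ha : AnisotropicDiag ![x, y]) :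
    AnisotropicDiag ![_root_.fracC k x, _root_.fracC k y] := by
  convert ha.fracC using 1
  funext i
  fin_cases i <;> simp

variable {k} in
theorem AnisotropicDiag.fracC_three {x y z : k} (ha : AnisotropicDiag ![x, y, z]) :
    AnisotropicDiag ![_root_.fracC k x, _root_.fracC k y, _root_.fracC k z] := by
  convert ha.fracC using 1
  funext i
  fin_cases i <;> simp

end Tower

/-- A field with a square root of `δ` adjoined. -/
theorem exists_quadratic_ext.{u} {K : Type u} [Field K] {δ : K} (hδ : ∀ s, δ ≠ s ^ 2) :
    ∃ (E : Type u) (_ : Field E) (j : K →+* E) (w : E), w ^ 2 = j δ ∧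
      (∀ e, ∃ a b, e = j a + j b * w) ∧ ∀ a b, j a + j b * w = 0 → a = 0 ∧ b = 0 := by
  have hirr : Irreducible (X ^ 2 - C δ : K[X]) :=
    X_pow_sub_C_irreducible_of_prime Nat.prime_two fun b hb => hδ b hb.symm
  have : Fact (Irreducible (X ^ 2 - C δ : K[X])) := ⟨hirr⟩
  have hw : AdjoinRoot.root (X ^ 2 - C δ) ^ 2 = AdjoinRoot.of (X ^ 2 - C δ) δ := by
    have := AdjoinRoot.eval₂_root (X ^ 2 - C δ)
    simpa [sub_eq_zero] using this
  have hmonic : (X ^ 2 - C δ : K[X]).Monic := monic_X_pow_sub_C δ two_ne_zero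
  refine ⟨AdjoinRoot (X ^ 2 - C δ), inferInstance, AdjoinRoot.of _, AdjoinRoot.root _, hw, ?_, ?_⟩
  · intro e
    obtain ⟨p, rfl⟩ := AdjoinRoot.mk_surjective e
    refine ⟨(p %ₘ (X ^ 2 - C δ)).coeff 0, (p %ₘ (X ^ 2 - C δ)).coeff 1, ?_⟩
    have hdeg : (p %ₘ (X ^ 2 - C δ)).natDegree ≤ 1 := by
      have := natDegree_modByMonic_lt p hmonic (by
        intro h; have := congrArg natDegree h; simp at this)
      rw [natDegree_X_pow_sub_C] at this
      omega
    have h1 : AdjoinRoot.mk (X ^ 2 - C δ) p = AdjoinRoot.mk _ (p %ₘ (X ^ 2 - C δ)) := by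
      conv_lhs => rw [← modByMonic_add_div p (X ^ 2 - C δ)]
      simp
    rw [h1]
    conv_lhs => rw [eq_X_add_C_of_natDegree_le_one hdeg]
    simp [add_comm]
  · intro a b hab
    have hb : b = 0 := by
      by_contra hb
      apply hδ (-a / b)
      apply (AdjoinRoot.of (X ^ 2 - C δ)).injective
      rw [← hw, map_pow, map_div₀, map_neg, eq_neg_of_add_eq_zero_left hab]
      have : AdjoinRoot.of (X ^ 2 - C δ) b ≠ 0 := by simpa using hb
      field_simp
    refine ⟨?_, hb⟩
    subst hb
    simpa using hab

/-- Adjoin an indeterminate to a tower of rational function fields. -/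
theorem exists_injective_fracX {k K : Type*} [Field k] [Field K] {n : ℕ}
    {f : MvPolynomial (Fin n) k →+* K} (hf : Function.Injective f) :
    ∃ g : MvPolynomial (Fin (n + 1)) k →+* FractionRing K[X], Function.Injective g ∧
      (g (MvPolynomial.X 0) = fracX K) ∧
      (∀ i : Fin n, g (MvPolynomial.X i.succ) = fracC K (f (MvPolynomial.X i))) := by
  refine ⟨(algebraMap K[X] _).comp ((mapRingHom f).comp
    (MvPolynomial.finSuccEquiv k n : MvPolynomial (Fin (n + 1)) k →+* _)), ?_, ?_, ?_⟩
  · refine (IsFractionRing.injective K[X] (FractionRing K[X])).comp ?_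
    exact (map_injective f hf).comp (MvPolynomial.finSuccEquiv k n).injective
  · simp [MvPolynomial.finSuccEquiv_X_zero, fracX]
  · intro i
    simp [MvPolynomial.finSuccEquiv_X_succ, fracC]

theorem exists_quadratic_ext_not_isotropic.{u} {K : Type u} [Field K] (h2 : (2 : K) ≠ 0)
    {x y c : K} (a₁ : AnisotropicDiag ![1, x]) (a₂ : AnisotropicDiag ![1, x, y])
    (a₃ : AnisotropicDiag ![x, y, x * y]) (hc : ∀ s t, -c ≠ y * s ^ 2 + x * y * t ^ 2) :
    ∃ (E : Type u) (_ : Field E) (j : FractionRing K[X] →+* E) (w : E),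
      w ^ 2 = j (fracC K c - fracC K x * fracX K ^ 2) ∧
      (∀ a b, j a + j b * w = 0 → a = 0 ∧ b = 0) ∧
      ¬ Isotropic3 1 (j (fracC K x)) (j (fracC K y)) := by
  obtain ⟨E, _, j, w, hw, hsur, hinj⟩ :=
    exists_quadratic_ext (δ := fracC K c - fracC K x * fracX K ^ 2) (not_square_linear a₁)
  refine ⟨E, inferInstance, j, w, hw, hinj, ?_⟩
  rintro ⟨e₀, e₁, e₂, hne, h⟩
  obtain ⟨v₀, w₀, rfl⟩ := hsur e₀
  obtain ⟨v₁, w₁, rfl⟩ := hsur e₁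
  obtain ⟨v₂, w₂, rfl⟩ := hsur e₂
  set δ := fracC K c - fracC K x * fracX K ^ 2 with hδ
  have key := hinj (v₀ ^ 2 + fracC K x * v₁ ^ 2 + fracC K y * v₂ ^ 2 +
    δ * (w₀ ^ 2 + fracC K x * w₁ ^ 2 + fracC K y * w₂ ^ 2))
    (2 * (v₀ * w₀ + fracC K x * v₁ * w₁ + fracC K y * v₂ * w₂)) (by
      simp only [map_add, map_mul, map_pow, map_ofNat]
      linear_combination h - (j w₀ ^ 2 + j (fracC K x) * j w₁ ^ 2 + j (fracC K y) * j w₂ ^ 2) * hw)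
  have h2' : (2 : FractionRing K[X]) ≠ 0 := by
    rw [← map_ofNat (fracC K) 2]; exact (_root_.map_ne_zero _).2 h2
  have a₂' : AnisotropicDiag ![1, fracC K x, fracC K y] := by
    simpa using a₂.fracC_three
  obtain ⟨V, hV⟩ := represents_of_isotropic_quadratic_ext a₂' (v := ![v₀, v₁, v₂])
    (w := ![w₀, w₁, w₂]) (by
      by_contra! hcon
      obtain ⟨hv, hw⟩ := hcon
      have hv0 := congrFun hv 0
      have hv1 := congrFun hv 1
      have hv2 := congrFun hv 2
      have hw0 := congrFun hw 0
      have hw1 := congrFun hw 1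
      have hw2 := congrFun hw 2
      simp at hv0 hv1 hv2 hw0 hw1 hw2
      simp [hv0, hv1, hv2, hw0, hw1, hw2] at hne)
    key.1 ((mul_eq_zero.1 key.2).resolve_left h2')
  obtain ⟨s, t, hst⟩ := exists_of_pure_quaternion h2 a₃ (c := c) (V := V) (by
    rw [map_mul]
    linear_combination - hV - hδ)
  exact hc s t hst

/-- The generic fibre of the Hassett-Pirutka-Tschinkel quadric surface bundle: the conic
`⟨1, x, y⟩` stays anisotropic over its function field. -/
theorem exists_hpt_function_field.{u} (k : Type u) [Field k] (h2 : (2 : k) ≠ 0) :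
    ∃ (G E : Type u) (_ : Field G) (_ : Field E) (ψ : MvPolynomial (Fin 4) k →+* G) (j : G →+* E)
      (w : E), Function.Injective ψ ∧ (∀ a b, j a + j b * w = 0 → a = 0 ∧ b = 0) ∧
      (j.comp ψ (MvPolynomial.X 2) * w ^ 2 + j.comp ψ
        (MvPolynomial.X 3 * MvPolynomial.X 2 * MvPolynomial.X 0 ^ 2 +
          MvPolynomial.X 3 * MvPolynomial.X 1 ^ 2 +
          hptConic 1 (MvPolynomial.X 3) (MvPolynomial.X 2)) = 0) ∧
      ¬ Isotropic3 1 (j.comp ψ (MvPolynomial.X 3)) (j.comp ψ (MvPolynomial.X 2)) := by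
  obtain ⟨K₁, _, x, ψ₁, h2₁, hx, a₁, hψ₁, hψx⟩ : ∃ (K₁ : Type u) (_ : Field K₁) (x : K₁)
      (ψ : MvPolynomial (Fin 1) k →+* K₁), (2 : K₁) ≠ 0 ∧ x ≠ 0 ∧ AnisotropicDiag ![1, x] ∧
      Function.Injective ψ ∧ ψ (MvPolynomial.X 0) = x := by
    obtain ⟨ψ₁, hψ₁, hx₁, -⟩ := exists_injective_fracX (k := k) (K := k) (n := 0)
      (f := (MvPolynomial.isEmptyRingEquiv k (Fin 0) : MvPolynomial (Fin 0) k →+* k))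
      (MvPolynomial.isEmptyRingEquiv k (Fin 0)).injective
    refine ⟨FractionRing k[X], inferInstance, fracX k, ψ₁, ?_, by simp [fracX],
      anisotropicDiag_one_X k, hψ₁, hx₁⟩
    rw [← map_ofNat (fracC k) 2]; exact (_root_.map_ne_zero _).2 h2
  obtain ⟨K₂, _, x, y, ψ₂, h2₂, hx, hy, a₁, a₂, a₃, hsq, hψ₂, hψx, hψy⟩ :
      ∃ (K₂ : Type u) (_ : Field K₂) (x y : K₂) (ψ : MvPolynomial (Fin 2) k →+* K₂),
      (2 : K₂) ≠ 0 ∧ x ≠ 0 ∧ y ≠ 0 ∧ AnisotropicDiag ![1, x] ∧ AnisotropicDiag ![1, x, y] ∧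
      AnisotropicDiag ![x, y, x * y] ∧ (∀ s, hptConic 1 x y ≠ s ^ 2) ∧
      Function.Injective ψ ∧ ψ (MvPolynomial.X 1) = x ∧ ψ (MvPolynomial.X 0) = y := by
    obtain ⟨ψ₂, hψ₂, hy₂, hs₂⟩ := exists_injective_fracX hψ₁
    refine ⟨FractionRing K₁[X], inferInstance, fracC K₁ x, fracX K₁, ψ₂, ?_, ?_, by simp [fracX],
      ?_, anisotropicDiag_one_x_X a₁, anisotropicDiag_x_X_mul a₁ hx, ?_, hψ₂, ?_, hy₂⟩
    · rw [← map_ofNat (fracC K₁) 2]; exact (_root_.map_ne_zero _).2 h2₁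
    · exact (_root_.map_ne_zero _).2 hx
    · simpa using a₁.fracC_two
    · intro s hs
      refine not_square_discriminant h2₁ hx s (Eq.trans ?_ hs)
      unfold hptConic
      ring
    · rw [← hψx]
      exact hs₂ 0
  obtain ⟨K₃, _, x, y, z, ψ₃, h2₃, hx, hy, a₁, a₂, a₃, hc, hψ₃, hψx, hψy, hψz⟩ :
      ∃ (K₃ : Type u) (_ : Field K₃) (x y z : K₃) (ψ : MvPolynomial (Fin 3) k →+* K₃),
      (2 : K₃) ≠ 0 ∧ x ≠ 0 ∧ y ≠ 0 ∧ AnisotropicDiag ![1, x] ∧ AnisotropicDiag ![1, x, y] ∧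
      AnisotropicDiag ![x, y, x * y] ∧ (∀ s t, x * z ^ 2 + hptConic 1 x y ≠ s ^ 2 + x * t ^ 2) ∧
      Function.Injective ψ ∧ ψ (MvPolynomial.X 2) = x ∧ ψ (MvPolynomial.X 1) = y ∧
      ψ (MvPolynomial.X 0) = z := by
    obtain ⟨ψ₃, hψ₃, hz₃, hs₃⟩ := exists_injective_fracX hψ₂
    refine ⟨FractionRing K₂[X], inferInstance, fracC K₂ x, fracC K₂ y, fracX K₂, ψ₃, ?_, ?_, ?_,
      ?_, ?_, ?_, ?_, hψ₃, ?_, ?_, hz₃⟩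
    · rw [← map_ofNat (fracC K₂) 2]; exact (_root_.map_ne_zero _).2 h2₂
    · exact (_root_.map_ne_zero _).2 hx
    · exact (_root_.map_ne_zero _).2 hy
    · simpa using a₁.fracC_two
    · simpa using a₂.fracC_three
    · simpa using a₃.fracC_three
    · intro s t hst
      obtain ⟨r, hr⟩ := exists_square_of_conic h2₂ a₁ hx (F := hptConic 1 x y) (v := s) (w := t)
        (by rw [← hst, map_hptConic, map_one])
      exact hsq r hr
    · rw [← hψx]
      exact hs₃ 1
    · rw [← hψy]
      exact hs₃ 0
  obtain ⟨ψ₄, hψ₄, hz₄, hs₄⟩ := exists_injective_fracX hψ₃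
  have hcy : ∃ c, y * c = -(x * z ^ 2 + hptConic 1 x y) := ⟨_ / y, mul_div_cancel₀ _ hy⟩
  obtain ⟨c, hcy⟩ := hcy
  obtain ⟨E, _, j, w, hw, hinj, hiso⟩ := exists_quadratic_ext_not_isotropic h2₃ (c := c) a₁ a₂ a₃
    (by
      intro s t hst
      apply hc (y * s) (y * t)
      linear_combination hcy + y * hst)
  have e1 : ψ₄ (MvPolynomial.X 1) = fracC K₃ z := by rw [← hψz]; exact hs₄ 0
  have e2 : ψ₄ (MvPolynomial.X 2) = fracC K₃ y := by rw [← hψy]; exact hs₄ 1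
  have e3 : ψ₄ (MvPolynomial.X 3) = fracC K₃ x := by rw [← hψx]; exact hs₄ 2
  refine ⟨FractionRing K₃[X], E, inferInstance, inferInstance, ψ₄, j, w, hψ₄, hinj, ?_, ?_⟩
  · have hcy' := congrArg (fun t => j (fracC K₃ t)) hcy
    simp only [hptConic, map_add, map_sub, map_mul, map_neg, map_pow, map_one, map_ofNat,
      RingHom.comp_apply, e1, e2, e3, hz₄] at hcy' hw ⊢
    linear_combination j (fracC K₃ y) * hw + hcy'
  · simpa only [RingHom.comp_apply, e2, e3] using hiso

end

section

open Polynomial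

theorem exists_mvPolynomial_lift {K σ : Type*} [Field K] (O : ValuationSubring K)
    {p : MvPolynomial σ K} (hp : ∀ m, O.valuation (p.coeff m) ≤ 1) :
    ∃ q : MvPolynomial σ O, q.map O.subtype = p := by
  refine ⟨∑ m ∈ p.support, MvPolynomial.monomial m
    ⟨p.coeff m, (O.valuation_le_one_iff _).1 (hp m)⟩, ?_⟩
  rw [map_sum]
  conv_rhs => rw [← MvPolynomial.support_sum_monomial_coeff p]
  exact Finset.sum_congr rfl fun m _ => by simp [MvPolynomial.map_monomial]

/-- Scaling a nonzero finite family of polynomials to be integral with nonzero reduction. -/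
theorem exists_primitive_family {K σ ι : Type*} [Field K] [Finite ι] {O : ValuationSubring K}
    {k : Type*} [Field k] {κ : O →+* k} (hκ : ∀ a : O, κ a = 0 ↔ O.valuation a < 1)
    {U : ι → MvPolynomial σ K} (hU : U ≠ 0) :
    ∃ (c : K) (V : ι → MvPolynomial σ O), c ≠ 0 ∧
      (∀ i, U i = MvPolynomial.C c * (V i).map O.subtype) ∧
      ∃ i, (V i).map κ ≠ 0 := by
  have := Fintype.ofFinite ι
  let T : Finset ((_ : ι) × (σ →₀ ℕ)) := Finset.univ.sigma fun i => (U i).support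
  have hT : T.Nonempty := by
    obtain ⟨i, hi⟩ := Function.ne_iff.1 hU
    obtain ⟨m, hm⟩ := MvPolynomial.ne_zero_iff.1 hi
    exact ⟨⟨i, m⟩, by simpa [T] using hm⟩
  obtain ⟨⟨i, m⟩, him, hmax⟩ :=
    Finset.exists_max_image T (fun t => O.valuation ((U t.1).coeff t.2)) hT
  have h0 : (U i).coeff m ≠ 0 := by simpa [T] using him
  have hv0 : O.valuation ((U i).coeff m) ≠ 0 := (Valuation.ne_zero_iff _).2 h0
  have hle : ∀ i' m', O.valuation ((MvPolynomial.C ((U i).coeff m)⁻¹ * U i').coeff m') ≤ 1 := by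
    intro i' m'
    rw [MvPolynomial.coeff_C_mul, map_mul, map_inv₀]
    by_cases h' : (U i').coeff m' = 0
    · simp [h']
    · have := hmax ⟨i', m'⟩ (by simpa [T] using h')
      rw [inv_mul_le_iff₀ (zero_lt_iff.2 hv0), mul_one]
      exact this
  choose V hV using fun i' => exists_mvPolynomial_lift O (hle i')
  refine ⟨(U i).coeff m, V, h0, fun i' => ?_, i, fun hc => ?_⟩
  · rw [hV, ← mul_assoc, ← MvPolynomial.C_mul, mul_inv_cancel₀ h0, MvPolynomial.C_1, one_mul]
  · have h1 : κ ((V i).coeff m) = 0 := by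
      rw [← MvPolynomial.coeff_map, hc, MvPolynomial.coeff_zero]
    have h2 : (((V i).coeff m : O) : K) = 1 := by
      have := congrArg (MvPolynomial.coeff m) (hV i)
      rw [MvPolynomial.coeff_map, MvPolynomial.coeff_C_mul, inv_mul_cancel₀ h0] at this
      exact this
    rw [hκ, h2, map_one] at h1
    exact lt_irrefl _ h1

/-- Pseudo-division by a quadratic polynomial. -/
theorem exists_pseudo_division {R : Type*} [CommRing R] {f : R[X]} (hf : f.natDegree ≤ 2)
    (g : R[X]) :
    ∃ (n : ℕ) (U V : R) (h : R[X]), C (f.coeff 2) ^ n * g = C U + C V * X + f * h := by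
  have hfe : f = C (f.coeff 2) * X ^ 2 + C (f.coeff 1) * X + C (f.coeff 0) :=
    eq_quadratic_of_degree_le_two (natDegree_le_iff_degree_le.1 hf)
  induction g using Polynomial.induction_on with
  | C a => exact ⟨0, a, 0, 0, by simp⟩
  | add p q hp hq =>
    obtain ⟨n, U, V, h, e⟩ := hp
    obtain ⟨n', U', V', h', e'⟩ := hq
    refine ⟨n + n', f.coeff 2 ^ n' * U + f.coeff 2 ^ n * U',
      f.coeff 2 ^ n' * V + f.coeff 2 ^ n * V', C (f.coeff 2) ^ n' * h + C (f.coeff 2) ^ n * h', ?_⟩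
    simp only [C_add, C_mul, C_pow]
    linear_combination C (f.coeff 2) ^ n' * e + C (f.coeff 2) ^ n * e'
  | monomial n a ih =>
    obtain ⟨n', U, V, h, e⟩ := ih
    refine ⟨n' + 1, - V * f.coeff 0, f.coeff 2 * U - V * f.coeff 1,
      C (f.coeff 2) * h * X + C V, ?_⟩
    simp only [C_sub, C_mul, C_neg]
    linear_combination C (f.coeff 2) * X * e - C V * hfe

/-- A quadratic extension `L` of a rational function field over a valued field, together with a
reduction of its defining equation. -/
structure QuadraticReduction {K : Type*} [Field K] (O : ValuationSubring K) (σ k G E L : Type*)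
    [Field k] [Field G] [Field E] [Field L] where
  /-- the residue map -/
  κ : O →+* k
  /-- the embedding of the reduced base -/
  ψ : MvPolynomial σ k →+* G
  /-- the embedding of the base in the reduced extension -/
  j : G →+* E
  /-- the root of the reduced equation -/
  w : E
  /-- the equation -/
  f : (MvPolynomial σ O)[X]
  /-- the parametrization of the extension -/
  π : (MvPolynomial σ K)[X] →+* L
  κ_eq_zero : ∀ a : O, κ a = 0 ↔ O.valuation a < 1
  ψ_injective : Function.Injective ψ
  independent : ∀ a b, j a + j b * w = 0 → a = 0 ∧ b = 0
  natDegree_le : f.natDegree ≤ 2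
  coeff_ne_zero : (f.coeff 2).map κ ≠ 0
  reduction_eq_zero : f.eval₂ ((j.comp ψ).comp (MvPolynomial.map κ)) w = 0
  π_eq_zero : π (f.map (MvPolynomial.map O.subtype)) = 0
  dvd_of_π_eq_zero : ∀ g, π g = 0 → f.map (MvPolynomial.map O.subtype) ∣ g
  exists_quotient : ∀ l : L, ∃ a b, π b ≠ 0 ∧ l * π b = π a

namespace QuadraticReduction

variable {K : Type*} [Field K] {O : ValuationSubring K} {σ k G E L : Type*}
    [Field k] [Field G] [Field E] [Field L] (D : QuadraticReduction O σ k G E L)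

/-- Extension of scalars from the valuation ring. -/
def ι (_ : QuadraticReduction O σ k G E L) :
    (MvPolynomial σ O)[X] →+* (MvPolynomial σ K)[X] :=
  mapRingHom (MvPolynomial.map O.subtype)

/-- The reduction of integral polynomials. -/
def Φ : (MvPolynomial σ O)[X] →+* E :=
  eval₂RingHom ((D.j.comp D.ψ).comp (MvPolynomial.map D.κ)) D.w

theorem Φ_f : D.Φ D.f = 0 := D.reduction_eq_zero

theorem Φ_C (a : MvPolynomial σ O) : D.Φ (C a) = D.j (D.ψ (a.map D.κ)) := by
  simp [Φ]

theorem Φ_linear_ne_zero {U V : MvPolynomial σ O} (h : U.map D.κ ≠ 0 ∨ V.map D.κ ≠ 0) :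
    D.Φ (C U + C V * X) ≠ 0 := by
  intro h0
  have : D.Φ X = D.w := by simp [Φ]
  rw [map_add, map_mul, Φ_C, Φ_C, this] at h0
  have := D.independent _ _ h0
  simp only [map_eq_zero_iff D.ψ D.ψ_injective] at this
  tauto

theorem Φ_coeff_ne_zero : D.Φ (C (D.f.coeff 2)) ≠ 0 := by
  rw [Φ_C]
  simpa [map_eq_zero_iff D.ψ D.ψ_injective] using D.coeff_ne_zero

theorem map_coeff_ne_zero : (D.f.coeff 2).map O.subtype ≠ 0 := by
  intro h
  apply D.coeff_ne_zero
  have : D.f.coeff 2 = 0 := by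
    apply MvPolynomial.map_injective O.subtype Subtype.val_injective
    rw [h, map_zero]
  rw [this, map_zero]

theorem natDegree_ι_f : (D.ι D.f).natDegree = 2 := by
  apply natDegree_eq_of_le_of_coeff_ne_zero (natDegree_map_le.trans D.natDegree_le)
  change (D.f.map (MvPolynomial.map O.subtype)).coeff 2 ≠ 0
  rw [coeff_map]
  exact D.map_coeff_ne_zero

theorem linear_eq_zero {U V : MvPolynomial σ K} (h : D.π (C U + C V * X) = 0) :
    U = 0 ∧ V = 0 := by
  have h0 : C U + C V * X = 0 := by
    by_contra hne
    have h1 := natDegree_le_of_dvd (D.dvd_of_π_eq_zero _ h) hne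
    change (D.ι D.f).natDegree ≤ _ at h1
    rw [natDegree_ι_f, add_comm] at h1
    have := natDegree_linear_le (a := V) (b := U)
    omega
  have c0 := congrArg (fun p => p.coeff 0) h0
  have c1 := congrArg (fun p => p.coeff 1) h0
  simp [coeff_C, coeff_X] at c0 c1
  exact ⟨c0, c1⟩

theorem Φ_eq_zero_of_π {p : (MvPolynomial σ O)[X]} (h : D.π (D.ι p) = 0) : D.Φ p = 0 := by
  obtain ⟨n, U, V, q, e⟩ := exists_pseudo_division D.natDegree_le p
  have e1 := congrArg (fun t => D.π (D.ι t)) e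
  have hf : D.π (D.ι D.f) = 0 := D.π_eq_zero
  simp only [map_mul, map_add, h, hf, mul_zero, zero_mul, add_zero] at e1
  have hC : ∀ U, D.ι (C U) = C (U.map O.subtype) := fun U => by simp [ι]
  have hX : D.ι X = X := by simp [ι]
  rw [hC, hC, hX, ← map_mul, ← map_add] at e1
  obtain ⟨hU, hV⟩ := D.linear_eq_zero e1.symm
  have hinj := MvPolynomial.map_injective (σ := σ) O.subtype Subtype.val_injective
  rw [map_eq_zero_iff _ hinj] at hU hV
  have e2 := congrArg D.Φ e
  rw [hU, hV] at e2
  simp only [map_mul, map_add, map_pow, Φ_f, map_zero, zero_mul, add_zero] at e2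
  exact (mul_eq_zero.1 e2).resolve_left (pow_ne_zero _ D.Φ_coeff_ne_zero)

/-- The image of the base field. -/
def base : K →+* L := (D.π.comp C).comp MvPolynomial.C

theorem exists_normal_form_aux {g : (MvPolynomial σ K)[X]} (hg : D.π g ≠ 0) :
    ∃ (a : K) (p q : (MvPolynomial σ O)[X]), a ≠ 0 ∧ D.Φ p ≠ 0 ∧ D.Φ q ≠ 0 ∧
      D.π g * D.π (D.ι q) = D.base a * D.π (D.ι p) := by
  obtain ⟨n, U, V, q, e⟩ := exists_pseudo_division D.natDegree_ι_f.le g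
  have hq : C ((D.ι D.f).coeff 2) = D.ι (C (D.f.coeff 2)) := by simp [ι, coeff_map]
  have hf : D.π (D.ι D.f) = 0 := D.π_eq_zero
  have hπ := congrArg D.π e
  rw [hq] at hπ
  simp only [map_add, map_mul, hf, zero_mul, add_zero, map_pow] at hπ
  have hA : D.π (D.ι (C (D.f.coeff 2))) ≠ 0 := fun h => D.Φ_coeff_ne_zero (D.Φ_eq_zero_of_π h)
  have hUV : ![U, V] ≠ 0 := by
    intro h
    have hU : U = 0 := congrFun h 0
    have hV : V = 0 := congrFun h 1
    rw [hU, hV] at hπ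
    simp [hg] at hπ
    exact hA hπ.1
  obtain ⟨c, W, hc, hW, hne⟩ := exists_primitive_family D.κ_eq_zero hUV
  refine ⟨c, C (W 0) + C (W 1) * X, C (D.f.coeff 2) ^ n, hc, ?_, ?_, ?_⟩
  · apply D.Φ_linear_ne_zero
    obtain ⟨i, hi⟩ := hne
    fin_cases i
    · exact Or.inl hi
    · exact Or.inr hi
  · rw [map_pow]
    exact pow_ne_zero _ D.Φ_coeff_ne_zero
  · have hU : U = _ := hW 0
    have hV : V = _ := hW 1
    rw [hU, hV] at hπ
    rw [map_pow, map_pow, mul_comm, hπ]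
    simp [ι, base]
    ring

theorem exists_normal_form {l : L} (hl : l ≠ 0) :
    ∃ (a : K) (p q : (MvPolynomial σ O)[X]), a ≠ 0 ∧ D.Φ p ≠ 0 ∧ D.Φ q ≠ 0 ∧
      l * D.π (D.ι q) = D.base a * D.π (D.ι p) := by
  obtain ⟨g, b, hb, hg⟩ := D.exists_quotient l
  have hg0 : D.π g ≠ 0 := by rw [← hg]; exact mul_ne_zero hl hb
  obtain ⟨a, p, q, ha, hp, hq, h⟩ := D.exists_normal_form_aux hg0
  obtain ⟨a', p', q', ha', hp', hq', h'⟩ := D.exists_normal_form_aux hb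
  refine ⟨a / a', p * q', q * p', div_ne_zero ha ha', by simp [hp, hq'], by simp [hq, hp'], ?_⟩
  have ha'' : D.base a' ≠ 0 := (_root_.map_ne_zero _).2 ha'
  rw [map_div₀]
  field_simp
  simp only [map_mul]
  apply mul_left_cancel₀ hb
  linear_combination - l * D.π (D.ι q) * D.π b * h' + D.π b * D.π (D.ι q') * h +
    D.π b * D.π (D.ι q) * D.π (D.ι q') * hg

end QuadraticReduction

end

section

open Polynomial

namespace QuadraticReduction

variable {K : Type*} [Field K] {O : ValuationSubring K} {σ k G E L : Type*}
    [Field k] [Field G] [Field E] [Field L] (D : QuadraticReduction O σ k G E L)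

theorem π_ne_zero {q : (MvPolynomial σ O)[X]} (h : D.Φ q ≠ 0) : D.π (D.ι q) ≠ 0 :=
  fun h' => h (D.Φ_eq_zero_of_π h')

theorem Φ_sub (p q : (MvPolynomial σ O)[X]) : D.Φ (p - q) = D.Φ p - D.Φ q := map_sub D.Φ p q

theorem ι_sub (p q : (MvPolynomial σ O)[X]) : D.ι (p - q) = D.ι p - D.ι q := map_sub D.ι p q

/-- The element `l` reduces to `e`. -/
def Reduces (l : L) (e : E) : Prop :=
  ∃ p q, D.Φ q ≠ 0 ∧ l * D.π (D.ι q) = D.π (D.ι p) ∧ e * D.Φ q = D.Φ p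

variable {D}

theorem Reduces.unique {l : L} {e e' : E} (h : D.Reduces l e) (h' : D.Reduces l e') : e = e' := by
  obtain ⟨p, q, hq, h1, h2⟩ := h
  obtain ⟨p', q', hq', h1', h2'⟩ := h'
  have : D.Φ (p * q' - p' * q) = 0 := by
    apply D.Φ_eq_zero_of_π
    rw [ι_sub, map_sub]
    simp only [map_mul]
    rw [← h1, ← h1']
    ring
  rw [Φ_sub] at this
  simp only [map_mul] at this
  rw [← h2, ← h2'] at this
  apply mul_right_cancel₀ (mul_ne_zero hq hq')
  linear_combination this

theorem Reduces.add {l l' : L} {e e' : E} (h : D.Reduces l e) (h' : D.Reduces l' e') :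
    D.Reduces (l + l') (e + e') := by
  obtain ⟨p, q, hq, h1, h2⟩ := h
  obtain ⟨p', q', hq', h1', h2'⟩ := h'
  refine ⟨p * q' + p' * q, q * q', by simp [hq, hq'], ?_, ?_⟩
  · simp only [map_add, map_mul]
    linear_combination D.π (D.ι q') * h1 + D.π (D.ι q) * h1'
  · simp only [map_add, map_mul]
    linear_combination D.Φ q' * h2 + D.Φ q * h2'

theorem Reduces.mul {l l' : L} {e e' : E} (h : D.Reduces l e) (h' : D.Reduces l' e') :
    D.Reduces (l * l') (e * e') := by
  obtain ⟨p, q, hq, h1, h2⟩ := h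
  obtain ⟨p', q', hq', h1', h2'⟩ := h'
  refine ⟨p * p', q * q', by simp [hq, hq'], ?_, ?_⟩
  · simp only [map_mul]
    rw [← h1, ← h1']
    ring
  · simp only [map_mul]
    rw [← h2, ← h2']
    ring

variable (D)

theorem reduces_π (p : (MvPolynomial σ O)[X]) : D.Reduces (D.π (D.ι p)) (D.Φ p) :=
  ⟨p, 1, by simp, by simp, by simp⟩

theorem reduces_zero : D.Reduces 0 0 := by simpa using D.reduces_π 0

theorem reduces_one : D.Reduces 1 1 := by simpa using D.reduces_π 1

variable {D}

theorem Reduces.neg {l : L} {e : E} (h : D.Reduces l e) : D.Reduces (-l) (-e) := by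
  have h1 : D.Reduces (-1) (-1) := by
    have := D.reduces_π (0 - 1)
    rwa [ι_sub, Φ_sub, map_sub, map_zero, map_zero, map_zero, map_one, map_one, map_one,
      zero_sub, zero_sub] at this
  simpa using h1.mul h

theorem Reduces.inv {l : L} {e : E} (h : D.Reduces l e) (he : e ≠ 0) : D.Reduces l⁻¹ e⁻¹ := by
  obtain ⟨p, q, hq, h1, h2⟩ := h
  have hp : D.Φ p ≠ 0 := by rw [← h2]; exact mul_ne_zero he hq
  have hl : l ≠ 0 := by
    rintro rfl
    rw [zero_mul] at h1
    exact D.π_ne_zero hp h1.symm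
  refine ⟨q, p, hp, ?_, ?_⟩
  · rw [← h1, inv_mul_cancel_left₀ hl]
  · rw [← h2, inv_mul_cancel_left₀ he]

theorem Reduces.intro {l : L} {p q : (MvPolynomial σ O)[X]} (hq : D.Φ q ≠ 0)
    (h : l * D.π (D.ι q) = D.π (D.ι p)) : ∃ e, D.Reduces l e :=
  ⟨D.Φ p / D.Φ q, p, q, hq, h, div_mul_cancel₀ _ hq⟩

theorem base_mul_π (a : O) (p : (MvPolynomial σ O)[X]) :
    D.base a * D.π (D.ι p) = D.π (D.ι (C (MvPolynomial.C a) * p)) := by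
  simp [base, ι]

variable (D)

theorem reduces_or_inv (l : L) : (∃ e, D.Reduces l e) ∨ ∃ e, D.Reduces l⁻¹ e := by
  by_cases hl : l = 0
  · exact Or.inl ⟨0, hl ▸ D.reduces_zero⟩
  obtain ⟨a, p, q, ha, hp, hq, h⟩ := D.exists_normal_form hl
  rcases O.mem_or_inv_mem a with hO | hO
  · exact Or.inl (Reduces.intro hq (h.trans (base_mul_π ⟨a, hO⟩ p)))
  · refine Or.inr (Reduces.intro (q := p) (p := C (MvPolynomial.C ⟨a⁻¹, hO⟩) * q) hp ?_)
    rw [← base_mul_π]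
    have : D.base a ≠ 0 := (_root_.map_ne_zero _).2 ha
    simp only [map_inv₀]
    field_simp
    linear_combination - h

/-- The Gauss valuation ring. -/
def ring : ValuationSubring L where
  carrier := {l | ∃ e, D.Reduces l e}
  zero_mem' := ⟨0, D.reduces_zero⟩
  one_mem' := ⟨1, D.reduces_one⟩
  add_mem' := fun ⟨_, h⟩ ⟨_, h'⟩ => ⟨_, h.add h'⟩
  mul_mem' := fun ⟨_, h⟩ ⟨_, h'⟩ => ⟨_, h.mul h'⟩
  neg_mem' := fun ⟨_, h⟩ => ⟨_, h.neg⟩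
  mem_or_inv_mem' := D.reduces_or_inv

theorem exists_reduces (a : D.ring) : ∃ e, D.Reduces a e := a.2

/-- The residue map of the Gauss valuation ring. -/
def ρ : D.ring →+* E where
  toFun a := (D.exists_reduces a).choose
  map_zero' := (D.exists_reduces 0).choose_spec.unique D.reduces_zero
  map_one' := (D.exists_reduces 1).choose_spec.unique D.reduces_one
  map_add' a b := (D.exists_reduces (a + b)).choose_spec.unique
    ((D.exists_reduces a).choose_spec.add (D.exists_reduces b).choose_spec)
  map_mul' a b := (D.exists_reduces (a * b)).choose_spec.unique
    ((D.exists_reduces a).choose_spec.mul (D.exists_reduces b).choose_spec)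

theorem reduces_ρ (a : D.ring) : D.Reduces a (D.ρ a) := (D.exists_reduces a).choose_spec

theorem ρ_eq_zero_iff (a : D.ring) : D.ρ a = 0 ↔ D.ring.valuation a < 1 := by
  rw [← ValuationSubring.valuation_lt_one_iff, IsLocalRing.mem_maximalIdeal, mem_nonunits_iff]
  refine ⟨fun h hu => ?_, fun h => ?_⟩
  · exact (hu.map D.ρ).ne_zero h
  · by_contra hne
    apply h
    have hinv := (D.reduces_ρ a).inv hne
    refine IsUnit.of_mul_eq_one (⟨(a : L)⁻¹, ⟨_, hinv⟩⟩ : D.ring) ?_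
    ext
    refine mul_inv_cancel₀ fun h0 => hne ?_
    have := D.reduces_ρ a
    rw [h0] at this
    exact this.unique D.reduces_zero

/-- The structure map on integral polynomials. -/
def πO : (MvPolynomial σ O)[X] →+* D.ring :=
  (D.π.comp D.ι).codRestrict D.ring.toSubring fun p => ⟨_, D.reduces_π p⟩

@[simp] theorem coe_πO (p : (MvPolynomial σ O)[X]) : (D.πO p : L) = D.π (D.ι p) := rfl

theorem ρ_πO (p : (MvPolynomial σ O)[X]) : D.ρ (D.πO p) = D.Φ p :=
  (D.reduces_ρ _).unique (D.reduces_π p)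

theorem valuation_π {p : (MvPolynomial σ O)[X]} (hp : D.Φ p ≠ 0) :
    D.ring.valuation (D.π (D.ι p)) = 1 := by
  rw [← D.ρ_πO, Ne, D.ρ_eq_zero_iff, not_lt] at hp
  exact le_antisymm (D.ring.valuation_le_one (D.πO p)) hp

theorem exists_valuation_pow [IsAlgClosed K] {l : L} (hl : l ≠ 0) {m : ℕ} (hm : 0 < m) :
    ∃ c, D.ring.valuation c ^ m = D.ring.valuation l := by
  obtain ⟨a, p, q, ha, hp, hq, h⟩ := D.exists_normal_form hl
  obtain ⟨c, hc⟩ := IsAlgClosed.exists_pow_nat_eq a hm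
  refine ⟨D.base c, ?_⟩
  have := congrArg D.ring.valuation h
  rw [map_mul, map_mul, D.valuation_π hp, D.valuation_π hq, mul_one, mul_one] at this
  rw [this, ← hc, map_pow, map_pow]

end QuadraticReduction

end

section

open MvPolynomial

/-- Clearing denominators in the value of a polynomial at fractions. -/
theorem exists_clear_denominators {K L R : Type*} [Field K] [Field L] [CommRing R] [IsDomain R]
    (c : K →+* R) {ι : Type*} (P : ι → R) (Q : R) (S : ι → FractionRing R)
    (hS : ∀ i, S i * algebraMap R _ Q = algebraMap R _ (P i)) (G : MvPolynomial ι K) :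
    ∃ (N : ℕ) (H : R), algebraMap R (FractionRing R) H =
        algebraMap R _ Q ^ N * G.eval₂ ((algebraMap R _).comp c) S ∧
      ∀ (θ : R →+* L), θ Q ≠ 0 → θ H = θ Q ^ N * G.eval₂ (θ.comp c) (fun i => θ (P i) / θ Q) := by
  induction G using MvPolynomial.induction_on with
  | C a => exact ⟨0, c a, by simp, fun θ _ => by simp⟩
  | add p q hp hq =>
    obtain ⟨N, H, h1, h2⟩ := hp
    obtain ⟨N', H', h1', h2'⟩ := hq
    refine ⟨N + N', Q ^ N' * H + Q ^ N * H', ?_, fun θ hθ => ?_⟩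
    · simp only [map_add, map_mul, map_pow, eval₂_add, h1, h1']
      ring
    · simp only [map_add, map_mul, map_pow, eval₂_add, h2 θ hθ, h2' θ hθ]
      ring
  | mul_X p i hp =>
    obtain ⟨N, H, h1, h2⟩ := hp
    refine ⟨N + 1, H * P i, ?_, fun θ hθ => ?_⟩
    · simp only [map_mul, eval₂_mul, eval₂_X, h1, ← hS]
      ring
    · simp only [map_mul, eval₂_mul, eval₂_X, h2 θ hθ]
      field_simp
      ring

/-- A stably rational function field over an infinite base is a retract of a rational one on
finitely many elements. -/
theorem exists_retract {K L : Type} [Field K] [Field L] [Infinite L] {c : K →+* L} {m n : ℕ}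
    (e : FractionRing (MvPolynomial (Fin m) L) ≃+* FractionRing (MvPolynomial (Fin n) K))
    (he : ∀ a, e (algebraMap (MvPolynomial (Fin m) L) _ (C (c a))) =
      algebraMap (MvPolynomial (Fin n) K) _ (C a)) {ι : Type} [Finite ι]
    (y : ι → L) :
    ∃ (g : MvPolynomial (Fin n) K) (G : ι → MvPolynomial (Fin n) K) (σ : Fin n → L),
      g ≠ 0 ∧ (∀ i, e (algebraMap (MvPolynomial (Fin m) L) _ (C (y i))) * algebraMap _ _ g
        = algebraMap _ _ (G i)) ∧
      g.eval₂ c σ ≠ 0 ∧ ∀ i, (G i).eval₂ c σ = y i * g.eval₂ c σ := by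
  obtain ⟨b, hb⟩ := IsLocalization.exist_integer_multiples_of_finite
    (nonZeroDivisors (MvPolynomial (Fin n) K))
      (fun i => e (algebraMap (MvPolynomial (Fin m) L) _ (C (y i))))
  choose G hG using hb
  obtain ⟨Q, hQ⟩ := IsLocalization.exist_integer_multiples_of_finite
    (nonZeroDivisors (MvPolynomial (Fin m) L))
      (fun i : Fin n => e.symm (algebraMap (MvPolynomial (Fin n) K) _ (X i)))
  choose P hP using hQ
  have hb0 : (b : MvPolynomial (Fin n) K) ≠ 0 := nonZeroDivisors.ne_zero b.2
  have hQ0 : (Q : MvPolynomial (Fin m) L) ≠ 0 := nonZeroDivisors.ne_zero Q.2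
  have hG' : ∀ i, e (algebraMap (MvPolynomial (Fin m) L) _ (C (y i))) *
      algebraMap _ _ (b : MvPolynomial (Fin n) K) =
      algebraMap _ _ (G i) := by
    intro i
    rw [hG i, Algebra.smul_def, mul_comm]
  set S : Fin n → FractionRing (MvPolynomial (Fin m) L) :=
    fun i => e.symm (algebraMap (MvPolynomial (Fin n) K) _ (X i)) with hSdef
  have hS : ∀ i, S i * algebraMap _ _ (Q : MvPolynomial (Fin m) L) = algebraMap _ _ (P i) := by
    intro i
    rw [hP i, Algebra.smul_def, mul_comm]
  have hev : ∀ p : MvPolynomial (Fin n) K,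
      p.eval₂ ((algebraMap (MvPolynomial (Fin m) L) _).comp (C.comp c)) S =
        e.symm (algebraMap _ _ p) := by
    intro p
    have : eval₂Hom ((algebraMap (MvPolynomial (Fin m) L)
        (FractionRing (MvPolynomial (Fin m) L))).comp (C.comp c)) S =
        (e.symm : FractionRing (MvPolynomial (Fin n) K) →+* _).comp
          (algebraMap (MvPolynomial (Fin n) K) (FractionRing _)) := by
      apply MvPolynomial.ringHom_ext
      · intro a
        simp [← he]
      · intro i
        simp [hSdef]
    exact congrArg (fun f => f p) this
  obtain ⟨N, H, h1, h2⟩ := exists_clear_denominators (L := L) (C.comp c) P Q S hS b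
  rw [hev] at h1
  have hH : H ≠ 0 := by
    rintro rfl
    rw [map_zero, eq_comm, mul_eq_zero, EmbeddingLike.map_eq_zero_iff] at h1
    rcases h1 with h1 | h1
    · have h1 := eq_zero_of_pow_eq_zero h1
      rw [map_eq_zero_iff _ (IsFractionRing.injective _ _)] at h1
      exact hQ0 h1
    · rw [map_eq_zero_iff _ (IsFractionRing.injective _ _)] at h1
      exact hb0 h1
  obtain ⟨t, ht⟩ : ∃ t : Fin m → L, eval t (H * (Q : MvPolynomial (Fin m) L)) ≠ 0 := by
    by_contra! hcon
    exact mul_ne_zero hH hQ0 (MvPolynomial.funext (fun t => by rw [hcon t, map_zero]))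
  rw [map_mul] at ht
  have htH := left_ne_zero_of_mul ht
  have htQ := right_ne_zero_of_mul ht
  have hcomp : (eval t).comp (C.comp c) = c := by
    ext a
    simp
  have e1 := h2 (eval t) htQ
  rw [hcomp] at e1
  refine ⟨b, G, fun i => eval t (P i) / eval t Q, hb0, hG', ?_, ?_⟩
  · intro h0
    rw [h0, mul_zero] at e1
    exact htH e1
  · intro i
    obtain ⟨N', H', h1', h2'⟩ := exists_clear_denominators (L := L) (C.comp c) P Q S hS (G i)
    have e2 := h2' (eval t) htQ
    rw [hcomp] at e2
    rw [hev, ← hG' i, map_mul, RingEquiv.symm_apply_apply] at h1'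
    have h3 : (Q : MvPolynomial (Fin m) L) ^ N * H' =
        C (y i) * (Q : MvPolynomial (Fin m) L) ^ N' * H := by
      apply IsFractionRing.injective _ (FractionRing (MvPolynomial (Fin m) L))
      simp only [map_mul, map_pow, h1, h1']
      ring
    have h4 := congrArg (eval t) h3
    simp only [map_mul, map_pow, eval_C, e1, e2] at h4
    apply mul_left_cancel₀ (pow_ne_zero (N + N') htQ)
    linear_combination h4

end

section

open Polynomial

/-- All monomials have degree `d` in the first three and degree `2` in the last four variables. -/
def Bihomogeneous {R : Type*} [CommRing R] (d : ℕ) (F : MvPolynomial (Fin 7) R) : Prop :=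
  ∀ m, F.coeff m ≠ 0 → m 0 + m 1 + m 2 = d ∧ m 3 + m 4 + m 5 + m 6 = 2

theorem Bihomogeneous.eval₂_mul {R S : Type*} [CommRing R] [CommRing S] {d : ℕ}
    {F : MvPolynomial (Fin 7) R} (hF : Bihomogeneous d F) (φ : R →+* S) (a b : S) (P : Fin 7 → S) :
    F.eval₂ φ (fun i => ![a, a, a, b, b, b, b] i * P i) = a ^ d * b ^ 2 * F.eval₂ φ P := by
  rw [MvPolynomial.eval₂_eq', MvPolynomial.eval₂_eq', Finset.mul_sum]
  refine Finset.sum_congr rfl fun m hm => ?_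
  obtain ⟨h1, h2⟩ := hF m (MvPolynomial.mem_support_iff.1 hm)
  rw [← h1, ← h2]
  simp only [Fin.prod_univ_seven, Matrix.cons_val_zero, Matrix.cons_val_one, Matrix.cons_val,
    mul_pow, pow_add]
  ring

theorem Bihomogeneous.eval₂_biPoint_mul {R S : Type*} [CommRing R] [CommRing S] {d : ℕ}
    {F : MvPolynomial (Fin 7) R} (hF : Bihomogeneous d F) (φ : R →+* S) (a b : S) (x : Fin 3 → S)
    (z : Fin 4 → S) :
    F.eval₂ φ (biPoint (fun j => a * x j) (fun j => b * z j)) =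
      a ^ d * b ^ 2 * F.eval₂ φ (biPoint x z) := by
  rw [← hF.eval₂_mul]
  congr 1
  funext i
  fin_cases i <;> rfl

theorem Bihomogeneous.eval₂_mul_same {R S : Type*} [CommRing R] [CommRing S] {d : ℕ}
    {F : MvPolynomial (Fin 7) R} (hF : Bihomogeneous d F) (φ : R →+* S) (a : S) (P : Fin 7 → S) :
    F.eval₂ φ (fun i => a * P i) = a ^ d * a ^ 2 * F.eval₂ φ P := by
  rw [← hF.eval₂_mul]
  congr 1
  funext i
  fin_cases i <;> rfl

section Path

variable {K L : Type*} [Field K] [Field L] (c : K →+* L) {n : ℕ} (v : Fin n → K) (σ : Fin n → L)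

/-- The point at time `t` of the path from `v` at `0` to `σ` at infinity. -/
def pathPoint (i : Fin n) : FractionRing L[X] :=
  algebraMap L[X] _ (C (c (v i)) + C (σ i) * X) / algebraMap L[X] _ (1 + X)

/-- `q` is `(1 + t) ^ D` times the value of `p` along the path. -/
structure IsAlongPath (p : MvPolynomial (Fin n) K) (D : ℕ) (q : L[X]) : Prop where
  natDegree_le : q.natDegree ≤ D
  coeff_zero : q.coeff 0 = c (p.eval v)
  coeff_top : q.coeff D = p.eval₂ c σ
  eq : algebraMap L[X] (FractionRing L[X]) q = algebraMap L[X] _ (1 + X) ^ D *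
    p.eval₂ (((algebraMap L[X] _).comp C).comp c) (pathPoint c v σ)

variable {c v σ}

theorem natDegree_one_add_X_pow (k : ℕ) : ((1 + X : L[X]) ^ k).natDegree = k := by
  have : (1 + X : L[X]) = X + C 1 := by simp [add_comm]
  rw [this, natDegree_pow, natDegree_X_add_C, mul_one]

theorem IsAlongPath.pad {p : MvPolynomial (Fin n) K} {D : ℕ} {q : L[X]}
    (h : IsAlongPath c v σ p D q) (k : ℕ) :
    IsAlongPath c v σ p (D + k) (q * (1 + X) ^ k) where
  natDegree_le := natDegree_mul_le_of_le h.natDegree_le (natDegree_one_add_X_pow k).le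
  coeff_zero := by rw [mul_coeff_zero, h.coeff_zero, coeff_zero_eq_eval_zero ((1 + X) ^ k)]; simp
  coeff_top := by
    rw [coeff_mul_add_eq_of_natDegree_le h.natDegree_le (natDegree_one_add_X_pow k).le,
      h.coeff_top]
    have : (1 + X : L[X]) = X + C 1 := by simp [add_comm]
    have h1 : ((1 + X : L[X]) ^ k).Monic := by
      rw [this]; exact (monic_X_add_C 1).pow k
    have := h1.coeff_natDegree
    rw [natDegree_one_add_X_pow] at this
    rw [this, mul_one]
  eq := by
    rw [map_mul, h.eq, map_pow]
    ring

variable (c v σ)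

theorem exists_isAlongPath (p : MvPolynomial (Fin n) K) : ∃ D q, IsAlongPath c v σ p D q := by
  induction p using MvPolynomial.induction_on with
  | C a => exact ⟨0, C (c a), by simp, by simp, by simp, by simp⟩
  | add p q hp hq =>
    obtain ⟨D, P, h⟩ := hp
    obtain ⟨D', P', h'⟩ := hq
    have h1 := h.pad D'
    have h2 := h'.pad D
    rw [add_comm] at h2
    refine ⟨D + D', _, natDegree_add_le_of_degree_le h1.natDegree_le h2.natDegree_le, ?_, ?_, ?_⟩
    · rw [coeff_add, h1.coeff_zero, h2.coeff_zero, map_add, map_add]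
    · rw [coeff_add, h1.coeff_top, h2.coeff_top, MvPolynomial.eval₂_add]
    · rw [map_add, h1.eq, h2.eq, MvPolynomial.eval₂_add, mul_add]
  | mul_X p i hp =>
    obtain ⟨D, q, h⟩ := hp
    have hdeg : (C (c (v i)) + C (σ i) * X).natDegree ≤ 1 := by
      rw [add_comm]; exact natDegree_linear_le
    refine ⟨D + 1, q * (C (c (v i)) + C (σ i) * X), natDegree_mul_le_of_le h.natDegree_le hdeg,
      ?_, ?_, ?_⟩
    · rw [mul_coeff_zero, h.coeff_zero]
      simp
    · rw [coeff_mul_add_eq_of_natDegree_le h.natDegree_le hdeg, h.coeff_top]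
      simp [coeff_C]
    · have h0 : algebraMap L[X] (FractionRing L[X]) (1 + X) ≠ 0 := by
        rw [Ne, map_eq_zero_iff _ (IsFractionRing.injective _ _)]
        intro h
        have := congrArg (eval 0) h
        simp at this
      rw [map_mul, h.eq, MvPolynomial.eval₂_mul, MvPolynomial.eval₂_X, pathPoint]
      field_simp
      ring

theorem exists_isAlongPath_family {ι : Type*} [Fintype ι] (p : ι → MvPolynomial (Fin n) K) :
    ∃ (D : ℕ) (q : ι → L[X]), ∀ i, IsAlongPath c v σ (p i) D (q i) := by
  choose D q h using fun i => exists_isAlongPath c v σ (p i)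
  refine ⟨∑ i, D i, fun i => q i * (1 + X) ^ (∑ i, D i - D i), fun i => ?_⟩
  have := (h i).pad (∑ i, D i - D i)
  rwa [Nat.add_sub_cancel' (Finset.single_le_sum (fun _ _ => Nat.zero_le _) (Finset.mem_univ i))]
    at this

variable {c v σ}

theorem eval₂_along_path {d : ℕ} {F : MvPolynomial (Fin 7) K} (hF : Bihomogeneous d F)
    {p : Fin 7 → MvPolynomial (Fin n) K} (hp : F.eval₂ MvPolynomial.C p = 0) {D : ℕ}
    {q : Fin 7 → L[X]} (h : ∀ i, IsAlongPath c v σ (p i) D (q i)) :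
    F.eval₂ (C.comp c) q = 0 := by
  apply IsFractionRing.injective L[X] (FractionRing L[X])
  rw [map_zero, MvPolynomial.hom_eval₂, ← RingHom.comp_assoc]
  have hq : (algebraMap L[X] (FractionRing L[X])) ∘ q = fun i =>
      algebraMap L[X] _ (1 + X) ^ D *
        (p i).eval₂ (((algebraMap L[X] _).comp C).comp c) (pathPoint c v σ) :=
    _root_.funext fun i => (h i).eq
  change MvPolynomial.eval₂ _ ((algebraMap L[X] (FractionRing L[X])) ∘ q) F = 0
  rw [hq, hF.eval₂_mul_same]
  have := congrArg (MvPolynomial.eval₂Hom (((algebraMap L[X] (FractionRing L[X])).comp C).comp c)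
    (pathPoint c v σ)) hp
  rw [map_zero, MvPolynomial.hom_eval₂] at this
  have hC : (MvPolynomial.eval₂Hom (((algebraMap L[X] (FractionRing L[X])).comp C).comp c)
      (pathPoint c v σ)).comp MvPolynomial.C = ((algebraMap L[X] _).comp C).comp c := by
    ext a
    simp
  rw [hC] at this
  rw [mul_eq_zero]
  right
  exact this

end Path

/-- A path of solutions joining a constant solution to the generic point of a variety which is a
retract of a rational one. -/
theorem exists_path_of_retract {K L M : Type*} [Field K] [Infinite K] [Field L] [Field M]
    {c : K →+* L} {n d : ℕ} {F : MvPolynomial (Fin 7) K} (hF : Bihomogeneous d F)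
    {τ : MvPolynomial (Fin n) K →+* M} (hτ : Function.Injective τ) {y' : Fin 5 → M}
    {y : Fin 5 → L} {g : MvPolynomial (Fin n) K} {G : Fin 5 → MvPolynomial (Fin n) K}
    {σ : Fin n → L} (hg : g ≠ 0) (hG : ∀ i, y' i * τ g = τ (G i)) (hgσ : g.eval₂ c σ ≠ 0)
    (hGσ : ∀ i, (G i).eval₂ c σ = y i * g.eval₂ c σ)
    (hy : F.eval₂ (τ.comp MvPolynomial.C)
      (biPoint ![1, y' 0, y' 1] ![1, y' 2, y' 3, y' 4]) = 0) :
    ∃ (x : Fin 3 → L[X]) (z : Fin 4 → L[X]) (D : ℕ) (s : L),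
      F.eval₂ (C.comp c) (biPoint x z) = 0 ∧ z ≠ 0 ∧ (∀ j, ∃ a, (x j).coeff 0 = c a) ∧
      (x 0).coeff 0 ≠ 0 ∧ (∀ j, (x j).natDegree ≤ D) ∧
      ∀ j, ![1, y 0, y 1] j = s * (x j).coeff D := by
  obtain ⟨v, hv⟩ : ∃ v, MvPolynomial.eval v g ≠ 0 := by
    by_contra! hcon
    exact hg (MvPolynomial.funext fun v => by rw [hcon v, map_zero])
  let p : Fin 7 → MvPolynomial (Fin n) K := biPoint ![g, G 0, G 1] ![g, G 2, G 3, G 4]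
  have hp : F.eval₂ MvPolynomial.C p = 0 := by
    apply hτ
    rw [map_zero, MvPolynomial.hom_eval₂]
    have : (fun i => τ (p i)) = fun i => τ g *
        biPoint ![1, y' 0, y' 1] ![1, y' 2, y' 3, y' 4] i := by
      funext i
      fin_cases i <;> simp [p, biPoint, ← hG, mul_comm]
    change MvPolynomial.eval₂ _ (fun i => τ (p i)) F = 0
    rw [this, hF.eval₂_mul_same, hy, mul_zero]
  obtain ⟨D, q, hq⟩ := exists_isAlongPath_family c v σ p
  refine ⟨![q 0, q 1, q 2], ![q 3, q 4, q 5, q 6], D, (g.eval₂ c σ)⁻¹, ?_, ?_, ?_, ?_, ?_, ?_⟩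
  · rw [← eval₂_along_path hF hp hq]
    congr 1
    funext i
    fin_cases i <;> rfl
  · intro h
    have h3 : q 3 = 0 := congrFun h 0
    have := (hq 3).coeff_zero
    rw [h3, Polynomial.coeff_zero] at this
    exact hv ((map_eq_zero c).1 this.symm)
  · intro j
    fin_cases j
    · exact ⟨_, (hq 0).coeff_zero⟩
    · exact ⟨_, (hq 1).coeff_zero⟩
    · exact ⟨_, (hq 2).coeff_zero⟩
  · change (q 0).coeff 0 ≠ 0
    rw [(hq 0).coeff_zero]
    exact (_root_.map_ne_zero c).2 hv
  · intro j
    fin_cases j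
    · exact (hq 0).natDegree_le
    · exact (hq 1).natDegree_le
    · exact (hq 2).natDegree_le
  · intro j
    fin_cases j
    · change 1 = _ * (q 0).coeff D
      rw [(hq 0).coeff_top]
      exact (inv_mul_cancel₀ hgσ).symm
    · change y 0 = _ * (q 1).coeff D
      rw [(hq 1).coeff_top]
      change _ = _ * (G 0).eval₂ c σ
      rw [hGσ]
      field_simp
    · change y 1 = _ * (q 2).coeff D
      rw [(hq 2).coeff_top]
      change _ = _ * (G 1).eval₂ c σ
      rw [hGσ]
      field_simp

end

section

open Polynomial

section Chart

variable {R S : Type*} [CommRing R] [CommRing S]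

/-- The generic point of the chart `x₀ = z₀ = 1`, with `z₂` as main variable. -/
def chartPoint (R : Type*) [CommRing R] : Fin 7 → (MvPolynomial (Fin 4) R)[X] :=
  biPoint ![1, C (MvPolynomial.X 3), C (MvPolynomial.X 2)]
    ![1, C (MvPolynomial.X 0), X, C (MvPolynomial.X 1)]

/-- The equation of the chart `x₀ = z₀ = 1`, as a polynomial in `z₂`. -/
def chartEquation (F : MvPolynomial (Fin 7) R) : (MvPolynomial (Fin 4) R)[X] :=
  F.eval₂ (C.comp MvPolynomial.C) (chartPoint R)

theorem map_chartPoint (φ : R →+* S) (i : Fin 7) :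
    (chartPoint R i).map (MvPolynomial.map φ) = chartPoint S i := by
  fin_cases i <;> simp [chartPoint, biPoint]

theorem map_chartEquation (φ : R →+* S) (F : MvPolynomial (Fin 7) R) :
    (chartEquation F).map (MvPolynomial.map φ) = chartEquation (F.map φ) := by
  rw [chartEquation, chartEquation, ← coe_mapRingHom, MvPolynomial.hom_eval₂,
    MvPolynomial.eval₂_map]
  congr 1
  · ext a
    simp
  · funext i
    exact map_chartPoint φ i

theorem natDegree_chartPoint_le (i : Fin 7) :
    (chartPoint R i).natDegree ≤ if i = 5 then 1 else 0 := by
  fin_cases i <;> simp [chartPoint, biPoint, natDegree_X_le]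

theorem natDegree_chartEquation_le {d : ℕ} {F : MvPolynomial (Fin 7) R} (hF : Bihomogeneous d F) :
    (chartEquation F).natDegree ≤ 2 := by
  rw [chartEquation, MvPolynomial.eval₂_eq']
  refine natDegree_sum_le_of_forall_le _ _ fun m hm => ?_
  have h2 := (hF m (MvPolynomial.mem_support_iff.1 hm)).2
  refine (natDegree_C_mul_le _ _).trans ((natDegree_prod_le _ _).trans ?_)
  calc ∑ i, (chartPoint R i ^ m i).natDegree ≤ ∑ i : Fin 7, m i * if i = 5 then 1 else 0 :=
        Finset.sum_le_sum fun i _ => natDegree_pow_le.trans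
          (Nat.mul_le_mul_left _ (natDegree_chartPoint_le i))
    _ = m 5 := by simp
    _ ≤ 2 := by omega

theorem chartEquation_of_eval₂ {F : MvPolynomial (Fin 7) R} {d : ℕ}
    (hF : F = (MvPolynomial.X 0 + MvPolynomial.X 1 + MvPolynomial.X 2) ^ d *
      hptForm (MvPolynomial.X 0) (MvPolynomial.X 1) (MvPolynomial.X 2)
        ![MvPolynomial.X 3, MvPolynomial.X 4, MvPolynomial.X 5, MvPolynomial.X 6]) :
    chartEquation F = C ((1 + MvPolynomial.X 3 + MvPolynomial.X 2) ^ d) *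
      (C (MvPolynomial.X 2) * X ^ 2 + C (MvPolynomial.X 3 * MvPolynomial.X 2 * MvPolynomial.X 0 ^ 2
        + MvPolynomial.X 3 * MvPolynomial.X 1 ^ 2
        + hptConic 1 (MvPolynomial.X 3) (MvPolynomial.X 2))) := by
  rw [chartEquation, hF]
  have h := map_hptConic (C : _ →+* (MvPolynomial (Fin 4) R)[X]) 1 (MvPolynomial.X 3)
    (MvPolynomial.X 2)
  rw [map_one] at h
  rw [C_add, h]
  simp only [hptForm, hptConic, chartPoint, biPoint, MvPolynomial.eval₂_mul, MvPolynomial.eval₂_add,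
    MvPolynomial.eval₂_pow, MvPolynomial.eval₂_sub, MvPolynomial.eval₂_X, Matrix.cons_val,
    Matrix.cons_val_zero, Matrix.cons_val_one, map_add, map_mul, map_pow, map_one,
    MvPolynomial.eval₂_ofNat]
  ring

end Chart

/-- The change of coordinates from the chart coordinates. -/
def chartCoord : MvPolynomial (Fin 5) ℂ →+* (MvPolynomial (Fin 4) ℂ)[X] :=
  MvPolynomial.eval₂Hom (C.comp MvPolynomial.C)
    ![C (MvPolynomial.X 3), C (MvPolynomial.X 2), C (MvPolynomial.X 0), X, C (MvPolynomial.X 1)]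

/-- The change of coordinates to the chart coordinates. -/
def chartCoordInv : (MvPolynomial (Fin 4) ℂ)[X] →+* MvPolynomial (Fin 5) ℂ :=
  eval₂RingHom (MvPolynomial.eval₂Hom MvPolynomial.C ![MvPolynomial.X 2, MvPolynomial.X 4,
    MvPolynomial.X 1, MvPolynomial.X 0]) (MvPolynomial.X 3)

theorem chartCoord_inv (g : (MvPolynomial (Fin 4) ℂ)[X]) : chartCoord (chartCoordInv g) = g := by
  have : chartCoord.comp chartCoordInv = RingHom.id _ := by
    apply Polynomial.ringHom_ext
    · intro a
      have : ((chartCoord.comp chartCoordInv).comp C) = C := by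
        apply MvPolynomial.ringHom_ext
        · intro r
          simp [chartCoord, chartCoordInv]
        · intro i
          fin_cases i <;> simp [chartCoord, chartCoordInv]
      exact RingHom.congr_fun this a
    · simp [chartCoord, chartCoordInv]
  exact RingHom.congr_fun this g

theorem chartCoordInv_coord (g : MvPolynomial (Fin 5) ℂ) : chartCoordInv (chartCoord g) = g := by
  have : chartCoordInv.comp chartCoord = RingHom.id _ := by
    apply MvPolynomial.ringHom_ext
    · intro r
      simp [chartCoord, chartCoordInv]
    · intro i
      fin_cases i <;> simp [chartCoord, chartCoordInv]
  exact RingHom.congr_fun this g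

theorem chartCoord_dehomP2P3 (F : MvPolynomial (Fin 7) ℂ) :
    chartCoord (dehomP2P3 F) = chartEquation F := by
  have : chartCoord.comp dehomP2P3 =
      MvPolynomial.eval₂Hom (C.comp MvPolynomial.C) (chartPoint ℂ) := by
    apply MvPolynomial.ringHom_ext
    · intro r
      simp [chartCoord, dehomP2P3]
    · intro i
      fin_cases i <;> simp [chartCoord, dehomP2P3, chartPoint, biPoint]
  exact RingHom.congr_fun this F

/-- The function field of a bidegree hypersurface as a quotient of a ring of polynomials in one
variable over a polynomial ring. -/
theorem exists_chart_parametrization (F : MvPolynomial (Fin 7) ℂ) [IsDomain (bidegreeChartRing F)] :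
    ∃ π : (MvPolynomial (Fin 4) ℂ)[X] →+* FractionRing (bidegreeChartRing F),
      π (chartEquation F) = 0 ∧ (∀ g, π g = 0 → chartEquation F ∣ g) ∧
      (∀ l, ∃ a b, π b ≠ 0 ∧ l * π b = π a) ∧
      (π.comp C).comp MvPolynomial.C = bidegreeChartFFMap F := by
  have hinj := IsFractionRing.injective (bidegreeChartRing F) (FractionRing (bidegreeChartRing F))
  let q : MvPolynomial (Fin 5) ℂ →+* bidegreeChartRing F := Ideal.Quotient.mk _
  have hq : ∀ a, ∃ g, q (chartCoordInv g) = a := fun a => by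
    obtain ⟨b, rfl⟩ := Ideal.Quotient.mk_surjective (I := Ideal.span {dehomP2P3 F}) a
    exact ⟨chartCoord b, by rw [chartCoordInv_coord]; rfl⟩
  let π := ((algebraMap (bidegreeChartRing F) (FractionRing (bidegreeChartRing F))).comp q).comp
    chartCoordInv
  have hq0 : ∀ b, q b = 0 ↔ b ∈ Ideal.span {dehomP2P3 F} := fun b => Ideal.Quotient.eq_zero_iff_mem
  refine ⟨π, ?_, fun g hg => ?_, fun l => ?_, ?_⟩
  · have : q (chartCoordInv (chartEquation F)) = 0 := by
      rw [hq0, ← chartCoord_dehomP2P3, chartCoordInv_coord]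
      exact Ideal.mem_span_singleton_self _
    change algebraMap _ _ (q (chartCoordInv (chartEquation F))) = 0
    rw [this, map_zero]
  · have h0 : q (chartCoordInv g) = 0 := hinj (by rw [map_zero]; exact hg)
    rw [hq0, Ideal.mem_span_singleton] at h0
    obtain ⟨h, hh⟩ := h0
    refine ⟨chartCoord h, ?_⟩
    rw [← chartCoord_dehomP2P3, ← map_mul, ← hh, chartCoord_inv]
  · obtain ⟨a, b, hb, rfl⟩ := IsFractionRing.div_surjective (A := bidegreeChartRing F) l
    obtain ⟨a, rfl⟩ := hq a
    obtain ⟨b, rfl⟩ := hq b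
    have : algebraMap _ (FractionRing (bidegreeChartRing F)) (q (chartCoordInv b)) ≠ 0 :=
      (map_ne_zero_iff _ hinj).2 (nonZeroDivisors.ne_zero hb)
    exact ⟨a, b, this, div_mul_cancel₀ _ this⟩
  · ext r
    simp [π, bidegreeChartFFMap, chartCoordInv, q]
    rfl

theorem isDomain_bidegreeChartRing {F : MvPolynomial (Fin 7) ℂ} {m : ℕ} {M : Type*} [Field M]
    (e : FractionRing (MvPolynomial (Fin m) (FractionRing (bidegreeChartRing F))) ≃+* M) :
    IsDomain (bidegreeChartRing F) := by
  have h1 := (IsFractionRing.injective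
    (MvPolynomial (Fin m) (FractionRing (bidegreeChartRing F)))
    (FractionRing (MvPolynomial (Fin m) (FractionRing (bidegreeChartRing F)))))
  have h2 := MvPolynomial.C_injective (Fin m) (FractionRing (bidegreeChartRing F))
  have h3 := IsFractionRing.injective (bidegreeChartRing F) (FractionRing (bidegreeChartRing F))
  let f : bidegreeChartRing F →+* M := ((e.toRingHom.comp (algebraMap
    (MvPolynomial (Fin m) (FractionRing (bidegreeChartRing F))) _)).comp MvPolynomial.C).comp
      (algebraMap _ _)
  have hf : Function.Injective f := ((e.injective.comp h1).comp h2).comp h3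
  exact hf.isDomain f

end

section

open Polynomial

theorem exists_valuationSubring_of_algebraicIndependent {K ι : Type*} [Field K] [Algebra ℚ K]
    {a : ι → K} (ha : AlgebraicIndependent ℚ a) (b : ι → ℤ) :
    ∃ O : ValuationSubring K, (∀ i, a i ∈ O) ∧ (∀ i, O.valuation (a i - b i) < 1) ∧
      (2 : K)⁻¹ ∈ O := by
  let A := Algebra.adjoin ℚ (Set.range a)
  let φ : A →+* ℚ := (MvPolynomial.eval fun i => (b i : ℚ)).comp (ha.aevalEquiv.symm : A →+* _)
  obtain ⟨O, hO, hI⟩ := Ideal.image_subset_nonunits_valuationSubring (A := A.toSubring)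
    (RingHom.ker φ) (RingHom.ker_ne_top φ)
  have hA : ∀ i, a i ∈ A := fun i => Algebra.subset_adjoin ⟨i, rfl⟩
  refine ⟨O, fun i => hO (hA i), fun i => ?_, hO ?_⟩
  · have hb : a i - b i ∈ A := sub_mem (hA i) (intCast_mem A _)
    rw [← ValuationSubring.mem_nonunits_iff]
    refine hI ⟨⟨a i - b i, hb⟩, ?_, rfl⟩
    have h1 : ha.aevalEquiv.symm ⟨a i - b i, hb⟩ = MvPolynomial.X i - (b i : MvPolynomial ι ℚ) := by
      rw [AlgEquiv.symm_apply_eq]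
      apply Subtype.ext
      simp
    change MvPolynomial.eval _ (ha.aevalEquiv.symm ⟨a i - b i, hb⟩) = 0
    rw [h1]
    simp
  · have : (2 : K)⁻¹ = algebraMap ℚ K 2⁻¹ := by simp
    rw [this]
    exact A.algebraMap_mem _

/-- The exponents of bidegree `(d, 2)`. -/
abbrev BidegreeExponent (d : ℕ) : Type :=
  {m : Fin 7 →₀ ℕ // m 0 + m 1 + m 2 = d ∧ m 3 + m 4 + m 5 + m 6 = 2}

instance (d : ℕ) : Finite (BidegreeExponent d) := by
  refine Set.Finite.subset (Set.finite_Iic (Finsupp.equivFunOnFinite.symm fun _ => d + 2)) ?_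
  rintro m ⟨h1, h2⟩ i
  change m i ≤ d + 2
  fin_cases i <;> simp <;> omega

theorem isWeightedHomogeneous_biWeight1_iff {R : Type*} [CommRing R] {d : ℕ}
    {F : MvPolynomial (Fin 7) R} :
    MvPolynomial.IsWeightedHomogeneous biWeight1 F d ↔
      ∀ m, F.coeff m ≠ 0 → m 0 + m 1 + m 2 = d := by
  simp [MvPolynomial.IsWeightedHomogeneous, Finsupp.weight_apply, Finsupp.sum_fintype,
    Fin.sum_univ_seven, biWeight1]

theorem isWeightedHomogeneous_biWeight2_iff {R : Type*} [CommRing R] {d : ℕ}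
    {F : MvPolynomial (Fin 7) R} :
    MvPolynomial.IsWeightedHomogeneous biWeight2 F d ↔
      ∀ m, F.coeff m ≠ 0 → m 3 + m 4 + m 5 + m 6 = d := by
  simp [MvPolynomial.IsWeightedHomogeneous, Finsupp.weight_apply, Finsupp.sum_fintype,
    Fin.sum_univ_seven, biWeight2]

theorem bihomogeneous_iff {R : Type*} [CommRing R] {d : ℕ} {F : MvPolynomial (Fin 7) R} :
    Bihomogeneous d F ↔ MvPolynomial.IsWeightedHomogeneous biWeight1 F d ∧
      MvPolynomial.IsWeightedHomogeneous biWeight2 F 2 := by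
  rw [isWeightedHomogeneous_biWeight1_iff, isWeightedHomogeneous_biWeight2_iff]
  exact ⟨fun h => ⟨fun m hm => (h m hm).1, fun m hm => (h m hm).2⟩,
    fun h m hm => ⟨h.1 m hm, h.2 m hm⟩⟩

/-- The special member of the family of hypersurfaces of bidegree `(d + 2, 2)`. -/
def specialForm (R : Type*) [CommRing R] (d : ℕ) : MvPolynomial (Fin 7) R :=
  (MvPolynomial.X 0 + MvPolynomial.X 1 + MvPolynomial.X 2) ^ d *
    hptForm (MvPolynomial.X 0) (MvPolynomial.X 1) (MvPolynomial.X 2)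
      ![MvPolynomial.X 3, MvPolynomial.X 4, MvPolynomial.X 5, MvPolynomial.X 6]

theorem map_specialForm {R S : Type*} [CommRing R] [CommRing S] (φ : R →+* S) (d : ℕ) :
    (specialForm R d).map φ = specialForm S d := by
  simp [specialForm, hptForm, hptConic]

theorem eval₂_specialForm {R S : Type*} [CommRing R] [CommRing S] (φ : R →+* S) (d : ℕ)
    (x : Fin 3 → S) (z : Fin 4 → S) :
    (specialForm R d).eval₂ φ (biPoint x z) =
      (x 0 + x 1 + x 2) ^ d * hptForm (x 0) (x 1) (x 2) z := by
  simp [specialForm, hptForm, hptConic, biPoint]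

theorem isWeightedHomogeneous_specialForm {R : Type*} [CommRing R] {w : Fin 7 → ℕ} {r s : ℕ}
    (h0 : w 0 = r) (h1 : w 1 = r) (h2 : w 2 = r) (h3 : w 3 = s) (h4 : w 4 = s) (h5 : w 5 = s)
    (h6 : w 6 = s) (d : ℕ) :
    MvPolynomial.IsWeightedHomogeneous w (specialForm R d) (d * r + (2 * r + 2 * s)) := by
  have hX : ∀ i n, w i = n →
      MvPolynomial.IsWeightedHomogeneous w (MvPolynomial.X i : MvPolynomial (Fin 7) R) n := by
    rintro i _ rfl
    exact MvPolynomial.isWeightedHomogeneous_X _ _ _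
  have hadd : ∀ {n} {p q : MvPolynomial (Fin 7) R}, MvPolynomial.IsWeightedHomogeneous w p n →
      MvPolynomial.IsWeightedHomogeneous w q n → MvPolynomial.IsWeightedHomogeneous w (p + q) n :=
    fun hp hq => hp.add hq
  have hsq : ∀ i n, w i = n → MvPolynomial.IsWeightedHomogeneous w
      (MvPolynomial.X i ^ 2 : MvPolynomial (Fin 7) R) (2 * n) := fun i n h => by
    simpa using (hX i n h).pow 2
  have hmul : ∀ i j, w i = r → w j = r → MvPolynomial.IsWeightedHomogeneous w
      (MvPolynomial.X i * MvPolynomial.X j : MvPolynomial (Fin 7) R) (2 * r) := fun i j h h' => by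
    have := (hX i r h).mul (hX j r h')
    rwa [← two_mul] at this
  have hconic : MvPolynomial.IsWeightedHomogeneous w (hptConic (MvPolynomial.X 0)
      (MvPolynomial.X 1) (MvPolynomial.X 2) : MvPolynomial (Fin 7) R) (2 * r) := by
    have h := hadd (hadd (hmul 0 1 h0 h1) (hmul 1 2 h1 h2)) (hmul 0 2 h0 h2)
    have h' := (MvPolynomial.isWeightedHomogeneous_C w (-2 : R)).mul h
    rw [zero_add] at h'
    have h'' := hadd (hadd (hadd (hsq 0 r h0) (hsq 1 r h1)) (hsq 2 r h2)) h'
    convert h'' using 1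
    simp only [hptConic, MvPolynomial.C_neg, map_ofNat]
    ring
  refine MvPolynomial.IsWeightedHomogeneous.mul ?_ ?_
  · simpa using (hadd (hadd (hX 0 r h0) (hX 1 r h1)) (hX 2 r h2)).pow d
  · exact hadd (hadd (hadd ((hmul 1 2 h1 h2).mul (hsq 4 s h4)) ((hmul 0 2 h0 h2).mul (hsq 5 s h5)))
      ((hmul 0 1 h0 h1).mul (hsq 6 s h6))) (hconic.mul (hsq 3 s h3))

theorem bihomogeneous_specialForm (R : Type*) [CommRing R] (d : ℕ) :
    Bihomogeneous (d + 2) (specialForm R d) := by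
  rw [bihomogeneous_iff]
  constructor
  · simpa using isWeightedHomogeneous_specialForm (R := R) (w := biWeight1) (r := 1) (s := 0)
      rfl rfl rfl rfl rfl rfl rfl d
  · simpa using isWeightedHomogeneous_specialForm (R := R) (w := biWeight2) (r := 0) (s := 1)
      rfl rfl rfl rfl rfl rfl rfl d

/-- A form with algebraically independent coefficients specializes to the special form. -/
theorem exists_specialization {d : ℕ} {F : MvPolynomial (Fin 7) ℂ} (hF : Bihomogeneous (d + 2) F)
    (hind : AlgebraicIndependent ℚ fun m : BidegreeExponent (d + 2) => F.coeff m.1) :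
    ∃ (O : ValuationSubring ℂ) (k : Type) (_ : Field k) (κ : O →+* k) (F' : MvPolynomial (Fin 7) O)
      (t : ℂ), (∀ a, κ a = 0 ↔ O.valuation a < 1) ∧ (2 : k) ≠ 0 ∧ (∃ i : k, i ^ 2 = -1) ∧
      F'.map O.subtype = F ∧ F'.map κ = specialForm k d ∧ t ≠ 0 ∧ O.valuation t < 1 := by
  obtain ⟨O, ha, hb, h2⟩ := exists_valuationSubring_of_algebraicIndependent hind
    fun m => (specialForm ℤ d).coeff m.1
  have hκ : ∀ a : O, IsLocalRing.residue O a = 0 ↔ O.valuation a < 1 := fun a => by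
    rw [IsLocalRing.residue_eq_zero_iff, ValuationSubring.valuation_lt_one_iff]
  have hmem : ∀ m, F.coeff m ∈ O := fun m => by
    by_cases hm : F.coeff m = 0
    · rw [hm]
      exact zero_mem O
    · exact ha ⟨m, hF m hm⟩
  obtain ⟨F', hF'⟩ := exists_mvPolynomial_lift O (p := F)
    fun m => (O.valuation_le_one_iff _).2 (hmem m)
  let m₀ : BidegreeExponent (d + 2) :=
    ⟨Finsupp.single 0 (d + 2) + Finsupp.single 3 2, by simp⟩
  refine ⟨O, IsLocalRing.ResidueField O, inferInstance, IsLocalRing.residue O, F',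
    F.coeff m₀.1 - (specialForm ℤ d).coeff m₀.1, hκ, ?_, ?_, hF', ?_, ?_, hb m₀⟩
  · have : (2 : O) * ⟨_, h2⟩ = 1 := Subtype.ext (mul_inv_cancel₀ two_ne_zero)
    intro h
    have := congrArg (IsLocalRing.residue O) this
    rw [map_mul, map_ofNat, h, zero_mul, map_one] at this
    exact zero_ne_one this
  · have hI : Complex.I ∈ O := by
      rw [← O.valuation_le_one_iff]
      have : O.valuation Complex.I ^ 2 = 1 := by
        rw [← map_pow, Complex.I_sq, Valuation.map_neg, map_one]
      by_contra! h
      exact (one_lt_pow₀ h two_ne_zero).ne' this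
    refine ⟨IsLocalRing.residue O ⟨_, hI⟩, ?_⟩
    have : (⟨_, hI⟩ : O) ^ 2 = -1 := Subtype.ext Complex.I_sq
    rw [← map_pow, this, map_neg, map_one]
  · rw [← map_specialForm (Int.castRingHom _)]
    ext m
    rw [MvPolynomial.coeff_map, MvPolynomial.coeff_map]
    have hc : ((F'.coeff m : O) : ℂ) = F.coeff m := by
      rw [← hF', MvPolynomial.coeff_map]
      rfl
    by_cases hm : m 0 + m 1 + m 2 = d + 2 ∧ m 3 + m 4 + m 5 + m 6 = 2
    · have : IsLocalRing.residue O (F'.coeff m - (((specialForm ℤ d).coeff m : ℤ) : O)) = 0 := by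
        rw [hκ]
        have := hb ⟨m, hm⟩
        rw [← hc] at this
        simpa using this
      rw [map_sub, map_intCast, sub_eq_zero] at this
      exact this
    · have h1 : (specialForm ℤ d).coeff m = 0 := by
        by_contra h
        exact hm (bihomogeneous_specialForm ℤ d m h)
      have h2 : F.coeff m = 0 := by
        by_contra h
        exact hm (hF m h)
      rw [h2] at hc
      have h3 : F'.coeff m = 0 := Subtype.ext hc
      rw [h1, h3, map_zero, map_zero]
  · intro h
    have h1 := hind.transcendental m₀
    rw [sub_eq_zero] at h
    have h2 : F.coeff m₀.1 = algebraMap ℚ ℂ (((specialForm ℤ d).coeff m₀.1 : ℤ) : ℚ) := by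
      rw [h]
      simp
    exact h1 (by rw [h2]; exact isAlgebraic_algebraMap _)

theorem bihomogeneous_of_mem {d : ℕ} {F : MvPolynomial (Fin 7) ℂ}
    (hF : F ∈ MvPolynomial.weightedHomogeneousSubmodule ℂ biWeight1 d ⊓
      MvPolynomial.weightedHomogeneousSubmodule ℂ biWeight2 2) : Bihomogeneous d F :=
  bihomogeneous_iff.2 hF

/-- A very general form has algebraically independent coefficients. -/
theorem veryGeneral_algebraicIndependent (d : ℕ) :
    VeryGeneral
      (P := (MvPolynomial.weightedHomogeneousSubmodule ℂ biWeight1 d ⊓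
        MvPolynomial.weightedHomogeneousSubmodule ℂ biWeight2 2 :
        Submodule ℂ (MvPolynomial (Fin 7) ℂ)))
      (fun F => AlgebraicIndependent ℚ
        fun m : BidegreeExponent d => (F : MvPolynomial (Fin 7) ℂ).coeff m.1) := by
  refine ⟨Set.range fun (G : {G : MvPolynomial (BidegreeExponent d) ℚ // G ≠ 0}) F =>
    MvPolynomial.aeval (fun m : BidegreeExponent d => (F : MvPolynomial (Fin 7) ℂ).coeff m.1) G.1,
    ?_, ?_, ?_⟩
  · have : Countable (MvPolynomial (BidegreeExponent d) ℚ) := by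
      rw [← Cardinal.mk_le_aleph0_iff]
      refine MvPolynomial.cardinalMk_le_max.trans ?_
      simp
    exact Set.countable_range _
  · rintro _ ⟨⟨G, hG⟩, rfl⟩
    constructor
    · let e := Finite.equivFin (BidegreeExponent d)
      refine ⟨Nat.card (BidegreeExponent d), fun i => (MvPolynomial.lcoeff ℂ (e.symm i).1).comp
        (Submodule.subtype _), MvPolynomial.rename e (G.map (algebraMap ℚ ℂ)), fun F => ?_⟩
      rw [MvPolynomial.eval_rename, MvPolynomial.eval_map]
      change MvPolynomial.eval₂ _ _ G = _
      congr 1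
      funext m
      simp
    · intro h
      have hG' : G.map (algebraMap ℚ ℂ) ≠ 0 := (map_ne_zero_iff _
        (MvPolynomial.map_injective _ (algebraMap ℚ ℂ).injective)).2 hG
      obtain ⟨v, hv⟩ : ∃ v, MvPolynomial.eval v (G.map (algebraMap ℚ ℂ)) ≠ 0 := by
        by_contra! hcon
        exact hG' (MvPolynomial.funext fun v => by rw [hcon v, map_zero])
      have := Fintype.ofFinite (BidegreeExponent d)
      let F : MvPolynomial (Fin 7) ℂ := ∑ m : BidegreeExponent d, MvPolynomial.monomial m.1 (v m)
      have hF : ∀ m : BidegreeExponent d, F.coeff m.1 = v m := fun m => by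
        classical
        rw [MvPolynomial.coeff_sum, Finset.sum_eq_single m]
        · simp
        · intro b _ hb
          rw [MvPolynomial.coeff_monomial, if_neg fun h => hb (Subtype.ext h)]
        · simp
      have hmem : Bihomogeneous d F := fun m hm => by
        classical
        rw [MvPolynomial.coeff_sum] at hm
        obtain ⟨b, -, hb⟩ := Finset.exists_ne_zero_of_sum_ne_zero hm
        rw [MvPolynomial.coeff_monomial] at hb
        have : b.1 = m := by
          by_contra h
          exact hb (if_neg h)
        exact this ▸ b.2
      apply hv
      have := congrFun h ⟨F, bihomogeneous_iff.1 hmem⟩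
      simp only [hF] at this
      rw [MvPolynomial.eval_map, ← MvPolynomial.aeval_def]
      exact this
  · intro F hF
    rw [algebraicIndependent_iff]
    intro G hG
    by_contra h
    exact hF _ ⟨⟨G, h⟩, rfl⟩ hG

end

section

open Polynomial

theorem eval₂_chartPoint {R L : Type*} [CommRing R] [CommRing L]
    (π : (MvPolynomial (Fin 4) R)[X] →+* L) (F : MvPolynomial (Fin 7) R) {y : Fin 5 → L}
    (hy : y = ![π (C (MvPolynomial.X 3)), π (C (MvPolynomial.X 2)), π (C (MvPolynomial.X 0)), π X,
      π (C (MvPolynomial.X 1))]) :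
    F.eval₂ ((π.comp C).comp MvPolynomial.C) (biPoint ![1, y 0, y 1] ![1, y 2, y 3, y 4]) =
      π (chartEquation F) := by
  rw [chartEquation, MvPolynomial.hom_eval₂]
  congr 1
  subst hy
  funext i
  fin_cases i <;> simp [chartPoint, biPoint]

/-- The function field of a form with algebraically independent coefficients, reduced to the
function field of the special form. -/
theorem exists_quadraticReduction {L : Type} [Field L] {d : ℕ} {F : MvPolynomial (Fin 7) ℂ}
    (hF : Bihomogeneous (d + 2) F) {O : ValuationSubring ℂ} {k : Type} [Field k]
    {κ : O →+* k} {F' : MvPolynomial (Fin 7) O} (hκ : ∀ a, κ a = 0 ↔ O.valuation a < 1)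
    (h2 : (2 : k) ≠ 0) (hF' : F'.map O.subtype = F) (hFκ : F'.map κ = specialForm k d)
    {π : (MvPolynomial (Fin 4) ℂ)[X] →+* L} (h0 : π (chartEquation F) = 0)
    (hdvd : ∀ g, π g = 0 → chartEquation F ∣ g)
    (hquot : ∀ l, ∃ a b, π b ≠ 0 ∧ l * π b = π a) :
    ∃ (G E : Type) (_ : Field G) (_ : Field E) (D : QuadraticReduction O (Fin 4) k G E L),
      D.κ = κ ∧ D.π = π ∧
      ¬ Isotropic3 1 (D.j (D.ψ (MvPolynomial.X 3))) (D.j (D.ψ (MvPolynomial.X 2))) := by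
  obtain ⟨G, E, _, _, ψ, j, w, hψ, hjw, hw, hiso⟩ := exists_hpt_function_field k h2
  have hbF' : Bihomogeneous (d + 2) F' := fun m hm => hF m (by
    rw [← hF', MvPolynomial.coeff_map]
    exact fun h => hm (Subtype.ext h))
  have hred := chartEquation_of_eval₂ (F := F'.map κ) (d := d) hFκ
  rw [← map_chartEquation] at hred
  have hmap : (chartEquation F').map (MvPolynomial.map O.subtype) = chartEquation F := by
    rw [map_chartEquation, hF']
  refine ⟨G, E, _, _, ⟨κ, ψ, j, w, chartEquation F', π, hκ, hψ, hjw,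
    natDegree_chartEquation_le hbF', ?_, ?_, ?_, ?_, hquot⟩, rfl, rfl, hiso⟩
  · rw [← Polynomial.coeff_map, hred, coeff_C_mul, coeff_add, coeff_C_mul, coeff_X_pow, coeff_C]
    have h1 : (1 + MvPolynomial.X 3 + MvPolynomial.X 2 : MvPolynomial (Fin 4) k) ≠ 0 := fun h => by
      have := congrArg (MvPolynomial.eval 0) h
      simp at this
    simp [h1, MvPolynomial.X_ne_zero]
  · have h : (chartEquation F').eval₂ ((j.comp ψ).comp (MvPolynomial.map κ)) w =
        ((chartEquation F').map (MvPolynomial.map κ)).eval₂ (j.comp ψ) w := by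
      rw [eval₂_map]
    rw [h, hred, eval₂_mul, eval₂_add, eval₂_mul, eval₂_C, eval₂_C, eval₂_C, eval₂_pow, eval₂_X, hw,
      mul_zero]
  · rw [hmap, h0]
  · rw [hmap]
    exact hdvd

theorem false_of_stably_rational {L : Type} [Field L] {d : ℕ} {F : MvPolynomial (Fin 7) ℂ}
    (hF : Bihomogeneous (d + 2) F)
    (hind : AlgebraicIndependent ℚ fun m : BidegreeExponent (d + 2) => F.coeff m.1)
    {π : (MvPolynomial (Fin 4) ℂ)[X] →+* L} (h0 : π (chartEquation F) = 0)
    (hdvd : ∀ g, π g = 0 → chartEquation F ∣ g)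
    (hquot : ∀ l, ∃ a b, π b ≠ 0 ∧ l * π b = π a) {c : ℂ →+* L}
    (hc : (π.comp C).comp MvPolynomial.C = c) {m n : ℕ}
    (e : FractionRing (MvPolynomial (Fin m) L) ≃+* FractionRing (MvPolynomial (Fin n) ℂ))
    (he : ∀ a, e (algebraMap (MvPolynomial (Fin m) L) _ (MvPolynomial.C (c a))) =
      algebraMap (MvPolynomial (Fin n) ℂ) _ (MvPolynomial.C a)) : False := by
  obtain ⟨O, k, _, κ, F', t, hκ, h2, ⟨i, hi⟩, hF', hFκ, ht0, ht⟩ := exists_specialization hF hind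
  obtain ⟨G, E, _, _, D, hDκ, hDπ, hiso⟩ :=
    exists_quadraticReduction hF hκ h2 hF' hFκ h0 hdvd hquot
  have : Infinite L := Infinite.of_injective c c.injective
  let y : Fin 5 → L := ![π (C (MvPolynomial.X 3)), π (C (MvPolynomial.X 2)),
    π (C (MvPolynomial.X 0)), π X, π (C (MvPolynomial.X 1))]
  obtain ⟨g, H, σ, hg, hH, hgσ, hHσ⟩ := exists_retract e he y
  let η : L →+* FractionRing (MvPolynomial (Fin n) ℂ) :=
    (e.toRingHom.comp (algebraMap (MvPolynomial (Fin m) L) _)).comp MvPolynomial.C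
  have hη : η.comp c = (algebraMap (MvPolynomial (Fin n) ℂ) _).comp MvPolynomial.C :=
    RingHom.ext he
  have hy : F.eval₂ ((algebraMap (MvPolynomial (Fin n) ℂ) _).comp MvPolynomial.C)
      (biPoint ![1, η (y 0), η (y 1)] ![1, η (y 2), η (y 3), η (y 4)]) = 0 := by
    have h := congrArg η (eval₂_chartPoint π F (y := y) rfl)
    rw [h0, map_zero, hc, MvPolynomial.hom_eval₂, hη] at h
    rw [← h]
    congr 1
    funext i
    fin_cases i <;> simp [biPoint]
  obtain ⟨x, z, N, s, hxz, hz, hx0, hx00, hN, hs⟩ := exists_path_of_retract hF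
    (IsFractionRing.injective (MvPolynomial (Fin n) ℂ) (FractionRing (MvPolynomial (Fin n) ℂ)))
    (y' := fun i => η (y i)) hg hH hgσ hHσ hy
  let toRing : O →+* D.ring := (D.πO.comp C).comp MvPolynomial.C
  have hρ : D.ρ.comp toRing = (D.j.comp D.ψ).comp (MvPolynomial.C.comp κ) := by
    ext a
    change D.ρ (D.πO (C (MvPolynomial.C a))) = _
    rw [D.ρ_πO, D.Φ_C, MvPolynomial.map_C, hDκ]
    rfl
  have hsub : D.ring.subtype.comp toRing = c.comp O.subtype := by
    ext a
    change D.π (D.ι (C (MvPolynomial.C a))) = c a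
    rw [← hc, hDπ]
    simp [QuadraticReduction.ι]
  have hW : ∀ (x : Fin 3 → L[X]) (z : Fin 4 → L[X]),
      (F'.map toRing).eval₂ (C.comp D.ring.subtype) (biPoint x z) =
        F.eval₂ (C.comp c) (biPoint x z) := fun x z => by
    rw [MvPolynomial.eval₂_map, RingHom.comp_assoc, hsub, ← RingHom.comp_assoc,
      ← MvPolynomial.eval₂_map, hF']
  let a : Fin 3 → D.ring := ![1, D.πO (C (MvPolynomial.X 3)), D.πO (C (MvPolynomial.X 2))]
  have hx : ∀ i, D.πO (C (MvPolynomial.X i)) = π (C (MvPolynomial.X i)) := fun i => by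
    rw [D.coe_πO, hDπ]
    simp [QuadraticReduction.ι]
  have ha : ∀ j, (a j : L) = s * (x j).coeff N := fun j => by
    rw [← hs]
    fin_cases j
    · rfl
    · exact hx 3
    · exact hx 2
  have haρ1 : D.ρ (a 0) = 1 := map_one _
  have haρ2 : D.ρ (a 1) = D.j (D.ψ (MvPolynomial.X 3)) := by
    change D.ρ (D.πO _) = _
    rw [D.ρ_πO, D.Φ_C, MvPolynomial.map_X]
  have haρ3 : D.ρ (a 2) = D.j (D.ψ (MvPolynomial.X 2)) := by
    change D.ρ (D.πO _) = _
    rw [D.ρ_πO, D.Φ_C, MvPolynomial.map_X]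
  have hX : ∀ i, D.j (D.ψ (MvPolynomial.X i)) ≠ 0 := fun i =>
    (_root_.map_ne_zero D.j).2 ((map_ne_zero_iff _ D.ψ_injective).2 (MvPolynomial.X_ne_zero i))
  have haρ : ∀ j, D.ρ (a j) ≠ 0 := fun j => by
    fin_cases j
    · exact haρ1 ▸ one_ne_zero
    · exact haρ2 ▸ hX 3
    · exact haρ3 ▸ hX 2
  have hϖ : D.ring.valuation (c t) < 1 := by
    have htO : t ∈ O := (O.valuation_le_one_iff t).1 ht.le
    have h1 : ((toRing ⟨t, htO⟩ : D.ring) : L) = c t := RingHom.congr_fun hsub ⟨t, htO⟩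
    rw [← h1, ← D.ρ_eq_zero_iff]
    have h3 := RingHom.congr_fun hρ ⟨t, htO⟩
    have h4 : κ ⟨t, htO⟩ = 0 := (hκ _).2 ht
    change D.ρ (toRing _) = D.j (D.ψ (MvPolynomial.C (κ _))) at h3
    rw [h3, h4, map_zero, map_zero, map_zero]
  let i' : E := D.j (D.ψ (MvPolynomial.C i))
  have hi' : i' ^ 2 = -1 := by
    rw [← map_pow, ← map_pow, ← map_pow, hi]
    simp
  have key := isotropic3_path (W := D.ring) (ρ := D.ρ) (F := F'.map toRing) (x := x) (z := z)
    (d := d) D.ρ_eq_zero_iff (fun l hl m hm => D.exists_valuation_pow hl hm)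
    ((_root_.map_ne_zero c).2 ht0) hϖ hi' (fun x z => ?_) (fun b b' x z h => ?_) hz
    (by rw [hW, hxz]) hx00 (fun h1 => ?_) hN s a ha haρ
  · rw [haρ1, haρ2, haρ3] at key
    exact hiso key
  · rw [MvPolynomial.eval₂_map, RingHom.comp_assoc, hρ, ← RingHom.comp_assoc, ← RingHom.comp_assoc,
      ← MvPolynomial.eval₂_map, hFκ, eval₂_specialForm]
  · rw [hW] at h ⊢
    rw [hF.eval₂_biPoint_mul, h, mul_zero]
  · obtain ⟨b₀, hb₀⟩ := hx0 0
    obtain ⟨b₁, hb₁⟩ := hx0 1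
    have hb : b₁ ≠ 0 := by
      rintro rfl
      exact h1 (by rw [hb₁, map_zero])
    obtain ⟨r, hr⟩ := IsAlgClosed.exists_pow_nat_eq (-(b₀ / b₁)) two_pos
    refine ⟨c r, ?_⟩
    rw [hb₀, hb₁, ← map_pow, hr, ← map_mul, ← map_add]
    have : b₀ + -(b₀ / b₁) * b₁ = 0 := by
      field_simp
      ring
    rw [this, map_zero]

end

theorem very_general_bidegree_d_2_hypersurface_not_stably_rational
    (d : ℕ) (hd : 2 ≤ d) :
    VeryGeneral
      (P := (MvPolynomial.weightedHomogeneousSubmodule ℂ biWeight1 d ⊓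
        MvPolynomial.weightedHomogeneousSubmodule ℂ biWeight2 2 :
        Submodule ℂ (MvPolynomial (Fin 7) ℂ)))
      (fun F => ¬ IsStablyRationalFunctionField
        (bidegreeChartFFMap (F : MvPolynomial (Fin 7) ℂ))) := by
  obtain ⟨d, rfl⟩ := Nat.exists_eq_add_of_le' hd
  obtain ⟨𝒞, h𝒞, hpoly, hgen⟩ := veryGeneral_algebraicIndependent (d + 2)
  refine ⟨𝒞, h𝒞, hpoly, fun F hF ⟨m, n, e, he⟩ => ?_⟩
  have := isDomain_bidegreeChartRing e
  obtain ⟨π, h0, hdvd, hquot, hc⟩ := exists_chart_parametrization F.1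
  exact false_of_stably_rational (bihomogeneous_of_mem F.2) (hgen F hF) h0 hdvd hquot hc e
    fun a => RingHom.congr_fun he a

end
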